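/- arXiv:1803.08224 — 3 statements merged into one kernel-verified Lean document; each statement's English description precedes it below -/
import Mathlib

section
/- Let K ⊆ ℝ^n be a convex body and 0 < δ < |K|. Then the convex floating body and the Ulam floating body satisfy K_{((e-1)/e)δ} ⊆ M_δ(K) ⊆ K_{δ/e}. -/
open MeasureTheory Metric Set
open scoped RealInnerProductSpace ENNReal Topology Pointwise

noncomputable def metronoid {n : ℕ} (μ : Measure (EuclideanSpace ℝ (Fin n))) :
    Set (EuclideanSpace ℝ (Fin n)) :=
  {z | ∃ f : EuclideanSpace ℝ (Fin n) → ℝ,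
    (∀ y, 0 ≤ f y ∧ f y ≤ 1) ∧ Integrable f μ ∧ (∫ y, f y ∂μ) = 1 ∧
    Integrable (fun y => f y • y) μ ∧ z = ∫ y, f y • y ∂μ}

/-- The Ulam floating body `M_δ(K)`. -/
noncomputable def ulam {n : ℕ} (K : Set (EuclideanSpace ℝ (Fin n))) (δ : ℝ) :
    Set (EuclideanSpace ℝ (Fin n)) :=
  metronoid ((volume.restrict K).withDensity fun _ => ENNReal.ofReal (1 / δ))

/-- The convex floating body `K_δ`: the intersection of all half-spaces `H⁻` whose
complementary half-space cuts off a set of volume at most `δ` from `K`. -/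
noncomputable def cfloat {n : ℕ} (K : Set (EuclideanSpace ℝ (Fin n))) (δ : ℝ) :
    Set (EuclideanSpace ℝ (Fin n)) :=
  {x | ∀ θ : EuclideanSpace ℝ (Fin n), ‖θ‖ = 1 → ∀ d : ℝ,
    (volume (K ∩ {y | d ≤ ⟪y, θ⟫})).toReal ≤ δ → ⟪x, θ⟫ ≤ d}

lemma bm_compact (A B : Set ℝ) (hA : IsCompact A) (hB : IsCompact B) (hAn : A.Nonempty)
    (hBn : B.Nonempty) : volume A + volume B ≤ volume (A + B) := by
  obtain ⟨a, ha⟩ := hA.exists_isGreatest hAn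
  obtain ⟨b, hb⟩ := hB.exists_isLeast hBn
  have h1 : volume ((b +ᵥ A) ∪ (a +ᵥ B)) = volume (b +ᵥ A) + volume (a +ᵥ B) := by
    apply measure_union₀' 
    · exact (hA.measurableSet.const_vadd b).nullMeasurableSet
    · apply measure_mono_null (t := {a + b})
      · rintro x ⟨hx, hy⟩
        obtain ⟨y, hy, rfl⟩ := hx
        obtain ⟨z, hz, hzz⟩ := hy
        have := ha.2 hy
        have := hb.2 hz
        simp only [vadd_eq_add] at hzz ⊢
        simp only [mem_singleton_iff]
        linarith
      · simp
  rw [measure_vadd, measure_vadd] at h1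
  rw [← h1]
  apply measure_mono
  rintro x (⟨y, hy, rfl⟩ | ⟨y, hy, rfl⟩)
  · exact ⟨y, hy, b, hb.1, by simp [add_comm]⟩
  · exact ⟨a, ha.1, y, hy, by simp⟩

lemma bm_meas (A B H : Set ℝ) (hA : MeasurableSet A) (hB : MeasurableSet B) (hAn : A.Nonempty)
    (hBn : B.Nonempty) (hH : A + B ⊆ H) : volume A + volume B ≤ volume H := by
  obtain ⟨a, ha⟩ := hAn
  obtain ⟨b, hb⟩ := hBn
  have key : ∀ K L : Set ℝ, K ⊆ A → L ⊆ B → IsCompact K → IsCompact L →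
      volume K + volume L ≤ volume H := by
    intro K L hK hL hKc hLc
    calc volume K + volume L ≤ volume (insert a K) + volume (insert b L) := by
          gcongr <;> exact subset_insert _ _
      _ ≤ volume (insert a K + insert b L) := bm_compact _ _ (hKc.insert a) (hLc.insert b)
            (insert_nonempty _ _) (insert_nonempty _ _)
      _ ≤ volume H := by
          apply measure_mono
          refine Subset.trans ?_ hH
          apply add_subset_add <;> exact insert_subset (by assumption) (by assumption)
  refine le_of_forall_lt fun c hc => ?_
  by_contra hcon
  push Not at hcon
  revert hc
  simp only [imp_false, not_lt]
  refine le_trans ?_ hcon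
  rw [hA.measure_eq_iSup_isCompact, hB.measure_eq_iSup_isCompact]
  simp only [iSup_and']
  refine ENNReal.biSup_add_biSup_le' ⟨∅, by simp⟩ ⟨∅, by simp⟩ ?_
  rintro K ⟨h1, h2⟩ L ⟨h3, h4⟩
  exact key K L h1 h3 h2 h4

lemma ennreal_amgm (a b : ℝ≥0∞) (p q : ℝ) (hp : 0 < p) (hq : 0 < q) (hpq : p + q = 1) :
    a ^ p * b ^ q ≤ ENNReal.ofReal p * a + ENNReal.ofReal q * b := by
  have h : (p⁻¹).HolderConjugate q⁻¹ := by
    rw [Real.holderConjugate_iff]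
    refine ⟨(one_lt_inv₀ hp).2 (by linarith), by simpa⟩
  have := ENNReal.young_inequality (a ^ p) (b ^ q) h
  rw [← ENNReal.rpow_mul, ← ENNReal.rpow_mul, mul_inv_cancel₀ hp.ne', mul_inv_cancel₀ hq.ne',
    ENNReal.rpow_one, ENNReal.rpow_one, ENNReal.ofReal_inv_of_pos hp, ENNReal.ofReal_inv_of_pos hq,
    div_eq_mul_inv, div_eq_mul_inv, inv_inv, inv_inv, mul_comm a, mul_comm b] at this
  exact this

/-- layer cake for functions bounded by one -/
lemma layer_one (f : ℝ → ℝ≥0∞) (hf : Measurable f) (h1 : ∀ x, f x ≤ 1) :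
    ∫⁻ x, f x = ∫⁻ t in Ioo (0:ℝ) 1, volume {x | ENNReal.ofReal t < f x} := by
  have e1 : ∀ x, f x = ENNReal.ofReal ((f x).toReal) := fun x =>
    (ENNReal.ofReal_toReal (ne_top_of_le_ne_top ENNReal.one_ne_top (h1 x))).symm
  have e2 : ∀ t : ℝ, 0 < t → {x | t < (f x).toReal} = {x | ENNReal.ofReal t < f x} := by
    intro t ht
    ext x
    simp only [mem_ofPred_eq]
    rw [ENNReal.ofReal_lt_iff_lt_toReal ht.le (ne_top_of_le_ne_top ENNReal.one_ne_top (h1 x))]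
  rw [lintegral_congr e1, lintegral_eq_lintegral_meas_lt _ (by filter_upwards with x; simp)
    hf.ennreal_toReal.aemeasurable]
  rw [← Ioo_union_Ici_eq_Ioi (zero_lt_one' ℝ), lintegral_union measurableSet_Ici
    (by rw [disjoint_left]; rintro x ⟨_, h⟩ h'; exact not_lt.2 h' h)]
  rw [setLIntegral_congr_fun (g := fun _ => 0) measurableSet_Ici]
  · simp only [lintegral_zero, add_zero]
    exact setLIntegral_congr_fun measurableSet_Ioo fun t ht => by simp only [e2 t ht.1]
  · intro t ht
    have : {x | t < (f x).toReal} = ∅ := by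
      ext x
      simp only [mem_ofPred_eq, mem_empty_iff_false, iff_false, not_lt]
      refine le_trans ?_ ht
      exact ENNReal.toReal_mono ENNReal.one_ne_top (h1 x)
    simp [this]

lemma pl_norm (p q : ℝ) (hp : 0 < p) (hq : 0 < q) (hpq : p + q = 1) (f g h : ℝ → ℝ≥0∞)
    (hf : Measurable f) (hg : Measurable g) (hh : Measurable h)
    (f1 : ⨆ x, f x = 1) (g1 : ⨆ x, g x = 1)
    (H : ∀ x y, f x ^ p * g y ^ q ≤ h (p * x + q * y)) :
    (∫⁻ x, f x) ^ p * (∫⁻ x, g x) ^ q ≤ ∫⁻ x, h x := by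
  refine (ennreal_amgm _ _ p q hp hq hpq).trans ?_
  calc ENNReal.ofReal p * (∫⁻ x, f x) + ENNReal.ofReal q * (∫⁻ x, g x) 
      ≤ ∫⁻ x, min (h x) 1 := ?_
    _ ≤ ∫⁻ x, h x := lintegral_mono fun x => min_le_left _ _
  rw [layer_one f hf fun x => f1 ▸ le_iSup f x, layer_one g hg fun x => g1 ▸ le_iSup g x,
    layer_one _ (hh.min measurable_const) fun x => min_le_right _ _]
  rw [← lintegral_const_mul' _ _ (by simp), ← lintegral_const_mul' _ _ (by simp)]
  refine (le_lintegral_add _ _).trans ?_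
  refine setLIntegral_mono' measurableSet_Ioo ?_
  rintro t ⟨ht0, ht1⟩
  have ht1' : ENNReal.ofReal t < 1 := by simpa using ht1
  have hA : {x | ENNReal.ofReal t < f x}.Nonempty := by
    rw [← f1] at ht1'
    exact lt_iSup_iff.1 ht1'
  have hB : {x | ENNReal.ofReal t < g x}.Nonempty := by
    rw [← g1] at ht1'
    exact lt_iSup_iff.1 ht1'
  have sA : volume (p • {x | ENNReal.ofReal t < f x}) = 
     ENNReal.ofReal p * volume {x | ENNReal.ofReal t < f x} := by
    rw [Measure.addHaar_smul]; simp [abs_of_pos hp]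
  have sB : volume (q • {x | ENNReal.ofReal t < g x}) = 
     ENNReal.ofReal q * volume {x | ENNReal.ofReal t < g x} := by
    rw [Measure.addHaar_smul]; simp [abs_of_pos hq]
  rw [← sA, ← sB]
  refine bm_meas _ _ _ ((measurableSet_lt measurable_const hf).const_smul₀ p) 
    ((measurableSet_lt measurable_const hg).const_smul₀ q) (hA.smul_set) (hB.smul_set) ?_
  rintro _ ⟨_, ⟨x, hx, rfl⟩, _, ⟨y, hy, rfl⟩, rfl⟩
  simp only [mem_ofPred_eq, smul_eq_mul, lt_min_iff] at hx hy ⊢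
  refine ⟨lt_of_lt_of_le ?_ (H x y), ht1'⟩
  calc ENNReal.ofReal t = ENNReal.ofReal t ^ p * ENNReal.ofReal t ^ q := by
        rw [← ENNReal.rpow_add _ _ (by simpa using ht0) (by simp), hpq, ENNReal.rpow_one]
    _ < f x ^ p * g y ^ q := ENNReal.mul_lt_mul (ENNReal.rpow_lt_rpow hx hp)
          (ENNReal.rpow_lt_rpow hy hq)

lemma pl_bdd (p q : ℝ) (hp : 0 < p) (hq : 0 < q) (hpq : p + q = 1) (f g h : ℝ → ℝ≥0∞)
    (hf : Measurable f) (hg : Measurable g) (hh : Measurable h)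
    (f1 : ⨆ x, f x ≠ ⊤) (g1 : ⨆ x, g x ≠ ⊤)
    (H : ∀ x y, f x ^ p * g y ^ q ≤ h (p * x + q * y)) :
    (∫⁻ x, f x) ^ p * (∫⁻ x, g x) ^ q ≤ ∫⁻ x, h x := by
  set a := ⨆ x, f x with ha
  set b := ⨆ x, g x with hb
  by_cases a0 : a = 0
  · have : ∀ x, f x = 0 := by simpa [ha] using a0
    simp [this, hp]
  by_cases b0 : b = 0
  · have : ∀ x, g x = 0 := by simpa [hb] using b0
    simp [this, hq]
  have ap0 : a ^ p ≠ 0 := by simp [a0, f1]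
  have bq0 : b ^ q ≠ 0 := by simp [b0, g1]
  have apt : a ^ p ≠ ⊤ := ENNReal.rpow_ne_top_of_nonneg hp.le f1
  have bqt : b ^ q ≠ ⊤ := ENNReal.rpow_ne_top_of_nonneg hq.le g1
  have := pl_norm p q hp hq hpq (fun x => a⁻¹ * f x) (fun x => b⁻¹ * g x) 
    (fun x => ((a ^ p)⁻¹ * (b ^ q)⁻¹) * h x) (hf.const_mul _) (hg.const_mul _) (hh.const_mul _)
    (by rw [← ENNReal.mul_iSup, ← ha, ENNReal.inv_mul_cancel a0 f1]) 
    (by rw [← ENNReal.mul_iSup, ← hb, ENNReal.inv_mul_cancel b0 g1]) 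
    (by
      intro x y
      rw [ENNReal.mul_rpow_of_nonneg _ _ hp.le, ENNReal.mul_rpow_of_nonneg _ _ hq.le,
        ENNReal.inv_rpow, ENNReal.inv_rpow, mul_mul_mul_comm]
      gcongr
      exact H x y)
  rw [lintegral_const_mul _ hf, lintegral_const_mul _ hg, lintegral_const_mul _ hh,
    ENNReal.mul_rpow_of_nonneg _ _ hp.le, ENNReal.mul_rpow_of_nonneg _ _ hq.le,
        ENNReal.inv_rpow, ENNReal.inv_rpow, mul_mul_mul_comm] at this
  refine (ENNReal.mul_le_mul_iff_right ?_ ?_).1 this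
  · simp [apt, bqt]
  · exact ENNReal.mul_ne_top (by simpa using ap0) (by simpa using bq0)

lemma lint_trunc (f : ℝ → ℝ≥0∞) (hf : Measurable f) :
    ∫⁻ x, f x = ⨆ N : ℕ, ∫⁻ x, min (f x) N := by
  rw [← lintegral_iSup (fun N => hf.min measurable_const)]
  · congr with x
    have := inf_iSup_eq (f x) (fun N : ℕ => (N : ℝ≥0∞))
    rw [ENNReal.iSup_natCast] at this
    simpa using this
  · intro M N h x
    dsimp
    gcongr

lemma rpow_iSup' (p : ℝ) (hp : 0 < p) (u : ℕ → ℝ≥0∞) : (⨆ n, u n) ^ p = ⨆ n, u n ^ p :=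
  (ENNReal.orderIsoRpow p hp).map_iSup u

lemma pl_one (p q : ℝ) (hp : 0 < p) (hq : 0 < q) (hpq : p + q = 1) (f g h : ℝ → ℝ≥0∞)
    (hf : Measurable f) (hg : Measurable g) (hh : Measurable h)
    (H : ∀ x y, f x ^ p * g y ^ q ≤ h (p * x + q * y)) :
    (∫⁻ x, f x) ^ p * (∫⁻ x, g x) ^ q ≤ ∫⁻ x, h x := by
  rw [lint_trunc f hf, lint_trunc g hg, rpow_iSup' p hp, rpow_iSup' q hq, ENNReal.iSup_mul]
  refine iSup_le fun M => ?_
  rw [ENNReal.mul_iSup]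
  refine iSup_le fun N => ?_
  refine pl_bdd p q hp hq hpq _ _ h (hf.min measurable_const) (hg.min measurable_const) hh ?_ ?_ ?_
  · exact ne_top_of_le_ne_top (ENNReal.natCast_ne_top M) (iSup_le fun x => min_le_right _ _)
  · exact ne_top_of_le_ne_top (ENNReal.natCast_ne_top N) (iSup_le fun x => min_le_right _ _)
  · intro x y
    refine le_trans ?_ (H x y)
    gcongr <;> exact min_le_left _ _

lemma pl_multi (p q : ℝ) (hp : 0 < p) (hq : 0 < q) (hpq : p + q = 1) (n : ℕ) :
    ∀ (f g h : (Fin n → ℝ) → ℝ≥0∞) (_ : Measurable f) (_ : Measurable g) (_ : Measurable h)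
    (_ : ∀ x y, f x ^ p * g y ^ q ≤ h (p • x + q • y)),
    (∫⁻ x, f x) ^ p * (∫⁻ x, g x) ^ q ≤ ∫⁻ x, h x := by
  induction n with
  | zero =>
    intro f g h _ _ _ H
    simp only [lintegral_unique]
    have key : ∀ z : Fin 0 → ℝ, f z ^ p * g z ^ q ≤ h z := by
      intro z
      have := H z z
      rwa [Subsingleton.elim (p • z + q • z) z] at this
    have hv : volume (univ : Set (Fin 0 → ℝ)) = 1 := by simp [volume_pi]
    rw [hv]
    simp only [mul_one]
    exact key _
  | succ n ih =>
    intro f g h hf hg hh H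
    have e := volume_preserving_piFinSuccAbove (fun _ : Fin (n+1) => ℝ) 0
    have conv : ∀ f : (Fin (n+1) → ℝ) → ℝ≥0∞, Measurable f →
      ∫⁻ x, f x = ∫⁻ t, ∫⁻ y, f ((MeasurableEquiv.piFinSuccAbove (fun _ => ℝ) 0).symm (t, y)) := by
      intro f hf
      rw [← e.symm.lintegral_comp hf]
      rw [Measure.volume_eq_prod, lintegral_prod]
      exact (hf.comp (MeasurableEquiv.measurable _)).aemeasurable
    have meas : ∀ f : (Fin (n+1) → ℝ) → ℝ≥0∞, Measurable f → Measurable fun z : ℝ × (Fin n → ℝ) =>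
      f ((MeasurableEquiv.piFinSuccAbove (fun _ => ℝ) 0).symm z) := fun f hf =>
      hf.comp (MeasurableEquiv.measurable _)
    rw [conv f hf, conv g hg, conv h hh]
    refine pl_one p q hp hq hpq _ _ _ (meas f hf).lintegral_prod_right' 
      (meas g hg).lintegral_prod_right' (meas h hh).lintegral_prod_right' ?_
    intro s t
    refine ih _ _ _ ((meas f hf).comp measurable_prodMk_left) ((meas g hg).comp measurable_prodMk_left)
      ((meas h hh).comp measurable_prodMk_left) ?_
    intro x y
    refine (H _ _).trans (le_of_eq ?_)
    congr 1
    ext i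
    refine Fin.cases ?_ (fun i => ?_) i <;> simp [MeasurableEquiv.piFinSuccAbove]

lemma bm_euclid (p q : ℝ) (hp : 0 < p) (hq : 0 < q) (hpq : p + q = 1) (n : ℕ)
    (A B H : Set (EuclideanSpace ℝ (Fin n))) (hA : MeasurableSet A) (hB : MeasurableSet B)
    (hH : MeasurableSet H) (hs : ∀ x ∈ A, ∀ y ∈ B, p • x + q • y ∈ H) :
    volume A ^ p * volume B ^ q ≤ volume H := by
  have e := (EuclideanSpace.volume_preserving_symm_measurableEquiv_toLp (Fin n)).symm
  set E := (MeasurableEquiv.toLp 2 (Fin n → ℝ)) with hE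
  have mA := hA.preimage E.measurable
  have mB := hB.preimage E.measurable
  have mH := hH.preimage E.measurable
  have := pl_multi p q hp hq hpq n ((E ⁻¹' A).indicator 1) ((E ⁻¹' B).indicator 1)
    ((E ⁻¹' H).indicator 1) (measurable_one.indicator mA) (measurable_one.indicator mB)
    (measurable_one.indicator mH) (by
      intro x y
      by_cases hx : E x ∈ A
      · by_cases hy : E y ∈ B
        · have : E (p • x + q • y) ∈ H := hs _ hx _ hy
          simp [indicator, hx, hy, this]
        · simp [indicator, hy, hq]
      · simp [indicator, hx, hp])
  rw [lintegral_indicator_one mA, lintegral_indicator_one mB, lintegral_indicator_one mH] at this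
  have e' : MeasurePreserving E := e
  rwa [e'.measure_preimage hA.nullMeasurableSet, e'.measure_preimage hB.nullMeasurableSet,
    e'.measure_preimage hH.nullMeasurableSet] at this

/-- An exponential tangent to a log-concave decreasing function. -/
lemma exists_tangent (φ : ℝ → ℝ) (hanti : Antitone φ)
    (hlc : ∀ p q s t : ℝ, 0 < p → 0 < q → p + q = 1 → φ s ^ p * φ t ^ q ≤ φ (p * s + q * t))
    (d t0 t1 : ℝ) (h1 : d < t1) (h1' : 0 < φ t1) (h0 : t0 < d) (h0' : φ d < φ t0)
    (hnn : ∀ t, 0 ≤ φ t) :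
    ∃ c, 0 < c ∧ ∀ t, φ t ≤ φ d * Real.exp (-c * (t - d)) := by
  have hd : 0 < φ d := h1'.trans_le (hanti h1.le)
  have hpos : ∀ t, t < d → 0 < φ t := fun t ht => hd.trans_le (hanti ht.le)
  -- slopes
  have slope : ∀ s t, s < d → d < t → 0 < φ t →
      (Real.log (φ t) - Real.log (φ d)) / (t - d) ≤ (Real.log (φ d) - Real.log (φ s)) / (d - s) := by
    intro s t hs ht htp
    have hts : 0 < t - s := by linarith
    have := hlc ((t - d) / (t - s)) ((d - s) / (t - s)) s t (by apply div_pos <;> linarith)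
      (by apply div_pos <;> linarith) (by field_simp; ring)
    have e : (t - d) / (t - s) * s + (d - s) / (t - s) * t = d := by field_simp; ring
    rw [e] at this
    have h2 := Real.log_le_log (by have := hpos s hs; positivity) this
    rw [Real.log_mul (by have := hpos s hs; positivity) (by positivity),
      Real.log_rpow (hpos s hs), Real.log_rpow htp] at h2
    rw [div_le_div_iff₀ (by linarith) (by linarith)]
    have h3 : (t - d) * Real.log (φ s) + (d - s) * Real.log (φ t) ≤ (t - s) * Real.log (φ d) := by
      have := mul_le_mul_of_nonneg_left h2 hts.le
      refine le_trans (le_of_eq ?_) this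
      field_simp
    nlinarith
  set S := Set.image (fun s => (Real.log (φ d) - Real.log (φ s)) / (d - s)) (Iio d) with hS
  have Sne : S.Nonempty := ⟨_, t0, h0, rfl⟩
  have Sbdd : BddBelow S := ⟨_, by rintro _ ⟨s, hs, rfl⟩; exact slope s t1 hs h1 h1'⟩
  refine ⟨-sInf S, ?_, ?_⟩
  · have h2 : sInf S ≤ (Real.log (φ d) - Real.log (φ t0)) / (d - t0) := csInf_le Sbdd ⟨t0, h0, rfl⟩
    have h3 : (Real.log (φ d) - Real.log (φ t0)) / (d - t0) < 0 := by
      apply div_neg_of_neg_of_pos _ (by linarith)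
      have := Real.log_lt_log hd h0'
      linarith
    linarith
  · intro t
    rw [neg_neg]
    rcases lt_trichotomy t d with h | h | h
    · have h2 : sInf S ≤ (Real.log (φ d) - Real.log (φ t)) / (d - t) := csInf_le Sbdd ⟨t, h, rfl⟩
      rw [le_div_iff₀ (by linarith)] at h2
      rw [← Real.log_le_log_iff (hpos t h) (by positivity), Real.log_mul hd.ne' (by positivity),
        Real.log_exp]
      linarith
    · subst h; simp
    · rcases (hnn t).eq_or_lt with h0 | htp
      · rw [← h0]; positivity
      have h2 : (Real.log (φ t) - Real.log (φ d)) / (t - d) ≤ sInf S := 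
        le_csInf Sne (by rintro _ ⟨s, hs, rfl⟩; exact slope s t hs h htp)
      rw [div_le_iff₀ (by linarith)] at h2
      rw [← Real.log_le_log_iff htp (by positivity), Real.log_mul hd.ne' (by positivity),
        Real.log_exp]
      linarith

lemma hyper_null {n : ℕ} (θ : EuclideanSpace ℝ (Fin n)) (hθ : ‖θ‖ = 1) (d : ℝ) :
    volume {y : EuclideanSpace ℝ (Fin n) | ⟪y, θ⟫ = d} = 0 := by
  let A : AffineSubspace ℝ (EuclideanSpace ℝ (Fin n)) :=
    AffineSubspace.mk' (d • θ) ((innerSL ℝ θ).toLinearMap.ker)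
  have hA : (A : Set (EuclideanSpace ℝ (Fin n))) = {y | ⟪y, θ⟫ = d} := by
    ext y
    simp [A, AffineSubspace.mem_mk', inner_sub_right, inner_smul_right, hθ, sub_eq_zero,
      real_inner_comm]
  rw [← hA]
  apply Measure.addHaar_affineSubspace
  intro h
  have : (d + 1) • θ ∈ (A : Set (EuclideanSpace ℝ (Fin n))) := by rw [h]; simp
  rw [hA] at this
  simp [inner_smul_left, hθ] at this

lemma cont_inner {n : ℕ} (θ : EuclideanSpace ℝ (Fin n)) : 
    Continuous fun y : EuclideanSpace ℝ (Fin n) => ⟪y, θ⟫ := by fun_prop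

lemma cap_meas {n : ℕ} {K : Set (EuclideanSpace ℝ (Fin n))} (hK : IsCompact K)
    (θ : EuclideanSpace ℝ (Fin n)) (t : ℝ) : MeasurableSet (K ∩ {y | t ≤ ⟪y, θ⟫}) :=
  hK.measurableSet.inter (measurableSet_le measurable_const (cont_inner θ).measurable)

lemma grun {n : ℕ} (K : Set (EuclideanSpace ℝ (Fin n))) (hK : IsCompact K) (hKc : Convex ℝ K)
    (f : EuclideanSpace ℝ (Fin n) → ℝ) (hf : ∀ y, 0 ≤ f y ∧ f y ≤ 1) (hfi : IntegrableOn f K)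
    (θ : EuclideanSpace ℝ (Fin n)) (hθ : ‖θ‖ = 1) (d δ : ℝ) (hδ : 0 < δ)
    (hfδ : ∫ y in K, f y = δ)
    (hd : (volume (K ∩ {y | d ≤ ⟪y, θ⟫})).toReal ≤ δ / Real.exp 1) :
    IntegrableOn (fun y => f y * (⟪y, θ⟫ - d)) K ∧ ∫ y in K, f y * (⟪y, θ⟫ - d) < 0 := by
  have hKfin : volume K ≠ ⊤ := hK.measure_lt_top.ne
  set φ : ℝ → ℝ := fun t => (volume (K ∩ {y | t ≤ ⟪y, θ⟫})).toReal with hφ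
  have capfin : ∀ t, volume (K ∩ {y | t ≤ ⟪y, θ⟫}) ≠ ⊤ := fun t =>
    ne_top_of_le_ne_top hKfin (measure_mono inter_subset_left)
  have hnn : ∀ t, 0 ≤ φ t := fun t => ENNReal.toReal_nonneg
  have hanti : Antitone φ := by
    intro s t h
    apply ENNReal.toReal_mono (capfin s)
    apply measure_mono
    rintro y ⟨hy, hy'⟩
    exact ⟨hy, le_trans h hy'⟩
  have hlc : ∀ p q s t : ℝ, 0 < p → 0 < q → p + q = 1 →
      φ s ^ p * φ t ^ q ≤ φ (p * s + q * t) := by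
    intro p q s t hp hq hpq
    have := bm_euclid p q hp hq hpq n _ _ _ (cap_meas hK θ s) (cap_meas hK θ t)
      (cap_meas hK θ (p * s + q * t)) (by
        rintro x ⟨hx, hx'⟩ y ⟨hy, hy'⟩
        refine ⟨hKc hx hy hp.le hq.le hpq, ?_⟩
        simp only [mem_ofPred_eq, inner_add_left, inner_smul_left] at *
        have := mul_le_mul_of_nonneg_left hx' hp.le
        have := mul_le_mul_of_nonneg_left hy' hq.le
        simp
        linarith)
    have := ENNReal.toReal_mono (capfin _) this
    rwa [ENNReal.toReal_mul, ← ENNReal.toReal_rpow, ← ENNReal.toReal_rpow] at this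
  have ub : ∀ s, IntegrableOn (fun y => f y * (⟪y, θ⟫ - s)) K := by
    intro s
    apply hfi.mul_continuousOn _ hK
    exact ((cont_inner θ).sub continuous_const).continuousOn
  refine ⟨ub d, ?_⟩
  obtain ⟨R, hR⟩ : ∃ R : ℝ, ∀ y ∈ K, |⟪y, θ⟫| < R := by
    obtain ⟨R, hR⟩ := hK.exists_bound_of_continuousOn (cont_inner θ).continuousOn
    exact ⟨R + 1, fun y hy => lt_of_le_of_lt (hR y hy) (by linarith)⟩
  by_cases hcase : ∀ t, d < t → φ t = 0
  · -- a.e. u ≤ d on K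
    have hlt : ∀ᵐ y ∂(volume.restrict K), ⟪y, θ⟫ < d := by
      have h1 : ∀ᵐ y ∂(volume.restrict K), ⟪y, θ⟫ ≠ d := by
        apply ae_restrict_of_ae
        rw [ae_iff]
        simpa using hyper_null θ hθ d
      have h2 : ∀ᵐ y ∂(volume.restrict K), ∀ m : ℕ, ¬ (d + 1 / ((m:ℝ) + 1) ≤ ⟪y, θ⟫) := by
        rw [ae_all_iff]
        intro m
        rw [ae_iff, Measure.restrict_apply]
        · have := hcase (d + 1 / ((m:ℝ) + 1)) (by have : (0:ℝ) < 1 / ((m:ℝ) + 1) := by positivity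
                                                  linarith)
          simp only [hφ, ENNReal.toReal_eq_zero_iff, capfin, or_false] at this
          simpa [inter_comm] using this
        · simp only [not_not]
          exact measurableSet_le measurable_const (cont_inner θ).measurable
      filter_upwards [h1, h2] with y h1 h2
      by_contra hcon
      push Not at hcon
      have : d < ⟪y, θ⟫ := lt_of_le_of_ne hcon (Ne.symm h1)
      obtain ⟨m, hm⟩ := exists_nat_one_div_lt (sub_pos.2 this)
      exact h2 m (by linarith)
    by_contra hcon
    push Not at hcon
    have hnp : ∀ᵐ y ∂(volume.restrict K), 0 ≤ - (f y * (⟪y, θ⟫ - d)) := by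
      filter_upwards [hlt] with y hy
      nlinarith [(hf y).1]
    have h0 : ∫ y in K, - (f y * (⟪y, θ⟫ - d)) = 0 := by
      apply le_antisymm
      · rw [integral_neg]; linarith
      · exact integral_nonneg_of_ae hnp
    rw [integral_eq_zero_iff_of_nonneg_ae hnp (ub d).neg] at h0
    have : ∫ y in K, f y = 0 := by
      rw [integral_eq_zero_of_ae]
      filter_upwards [h0, hlt] with y h0 h1
      simp only [Pi.zero_apply, neg_eq_zero, mul_eq_zero] at h0 ⊢
      rcases h0 with h | h
      · exact h
      · linarith
    linarith
  · push Not at hcase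
    obtain ⟨t1, ht1, ht1'⟩ := hcase
    have ht1p : 0 < φ t1 := lt_of_le_of_ne (hnn t1) (Ne.symm ht1')
    have hle : δ ≤ (volume K).toReal := by
      rw [← hfδ]
      have : ∫ y in K, f y ≤ ∫ y in K, (1:ℝ) := 
        integral_mono hfi (integrable_const_iff.2 (Or.inr ⟨by simpa using hK.measure_lt_top⟩)) fun y => (hf y).2
      simpa [Measure.real] using this
    have hfull : ∀ t, t ≤ -R → φ t = (volume K).toReal := by
      intro t ht
      have : K ∩ {y | t ≤ ⟪y, θ⟫} = K := by
        apply inter_eq_left.2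
        intro y hy
        have := (abs_lt.1 (hR y hy)).1
        exact (ht.trans this.le)
      simp only [hφ, this]
    have hdlt : φ d < δ := lt_of_le_of_lt hd (div_lt_self hδ (by simp))
    obtain ⟨c, hc, hexp⟩ := exists_tangent φ hanti hlc d (min (-R) (d - 1)) t1 ht1 ht1p
      (lt_of_le_of_lt (min_le_right _ _) (by linarith))
      (by rw [hfull _ (min_le_left _ _)]; linarith) hnn
    set s := d - 1 / c with hs
    have hsd : s < d := by have : 0 < 1 / c := by positivity
                           linarith
    -- layer cake
    have posint : IntegrableOn (fun y : EuclideanSpace ℝ (Fin n) => max (⟪y, θ⟫ - s) 0) K := 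
      ContinuousOn.integrableOn_compact hK
        (((cont_inner θ).sub continuous_const).max continuous_const).continuousOn
    have step1 : ∫ y in K, f y * (⟪y, θ⟫ - s) ≤ ∫ y in K, max (⟪y, θ⟫ - s) 0 := by
      apply integral_mono (ub s) posint
      intro y
      dsimp only
      rcases le_total 0 (⟪y, θ⟫ - s) with h | h
      · rw [max_eq_left h]; nlinarith [(hf y).2]
      · rw [max_eq_right h]; nlinarith [(hf y).1]
    set T := max R d with hT
    have hsT : s < T := lt_of_lt_of_le hsd (le_max_right _ _)
    have step2 : ∫ y in K, max (⟪y, θ⟫ - s) 0 ≤ 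
        ∫ t in (0:ℝ)..(T - s), φ d * Real.exp (-c * (s + t - d)) := by
      have hcont : Continuous fun t : ℝ => φ d * Real.exp (-c * (s + t - d)) := by fun_prop
      rw [integral_eq_lintegral_of_nonneg_ae (by filter_upwards with y; exact le_max_right _ _)
        posint.aestronglyMeasurable]
      rw [lintegral_eq_lintegral_meas_le _ (by filter_upwards with y; exact le_max_right _ _)
        posint.aemeasurable]
      rw [intervalIntegral.integral_of_le (by linarith)]
      rw [integral_eq_lintegral_of_nonneg_ae (by filter_upwards with y; simp; have := hnn d; positivity)
        hcont.aestronglyMeasurable]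
      apply ENNReal.toReal_mono
      · exact ((hcont.integrableOn_Ioc).lintegral_lt_top).ne
      · rw [← Ioc_union_Ioi_eq_Ioi (by linarith : (0:ℝ) ≤ T - s)]
        refine (lintegral_union_le _ _ _).trans ?_
        rw [setLIntegral_congr_fun (g := fun _ => 0) measurableSet_Ioi]
        · simp only [lintegral_zero, add_zero]
          apply setLIntegral_mono' measurableSet_Ioc
          rintro t ⟨ht, -⟩
          have e : {a : EuclideanSpace ℝ (Fin n) | t ≤ max (⟪a, θ⟫ - s) 0} = 
              {y | s + t ≤ ⟪y, θ⟫} := by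
            ext y
            simp only [mem_ofPred_eq, le_max_iff, not_le.2 ht, or_false]
            constructor <;> intro <;> linarith
          rw [e, Measure.restrict_apply
            (measurableSet_le measurable_const (cont_inner θ).measurable), inter_comm]
          rw [← ENNReal.ofReal_toReal (capfin (s + t))]
          exact ENNReal.ofReal_le_ofReal (hexp (s + t))
        · intro t ht
          dsimp only
          rw [Measure.restrict_apply' hK.measurableSet]
          convert measure_empty (μ := volume)
          ext y
          simp only [mem_inter_iff, mem_ofPred_eq, mem_empty_iff_false, iff_false, not_and]
          intro h hy
          have h1 := (abs_lt.1 (hR y hy)).2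
          have h2 : R ≤ T := le_max_left _ _
          have h3 : T - s < t := ht
          have : max (⟪y, θ⟫ - s) 0 < t := max_lt (by linarith) (by linarith)
          linarith
    have step3 : ∫ t in (0:ℝ)..(T - s), φ d * Real.exp (-c * (s + t - d)) < δ / c := by
      have hder : ∀ t : ℝ, HasDerivAt (fun t => -(φ d / c) * Real.exp (-c * (s + t - d)))
          (φ d * Real.exp (-c * (s + t - d))) t := by
        intro t
        have h1 : HasDerivAt (fun t : ℝ => -c * (s + t - d)) (-c) t := by
          have := (((hasDerivAt_id t).const_add s).sub_const d).const_mul (-c)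
          simpa using this
        have := (h1.exp).const_mul (-(φ d / c))
        refine this.congr_deriv ?_
        have hcc : φ d / c * c = φ d := div_mul_cancel₀ _ hc.ne'
        linear_combination Real.exp (-c * (s + t - d)) * hcc
      rw [intervalIntegral.integral_eq_sub_of_hasDerivAt (fun t _ => hder t)
        (Continuous.intervalIntegrable (by fun_prop) _ _)]
      have e : -c * (s + 0 - d) = 1 := by rw [hs]; field_simp; ring
      rw [e]
      have hdp : 0 < φ d := ht1p.trans_le (hanti ht1.le)
      have h2 : 0 < φ d / c * Real.exp (-c * (s + (T - s) - d)) := by positivity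
      have h3 : φ d / c * Real.exp 1 ≤ δ / c := by
        rw [le_div_iff₀ (by positivity)] at hd
        rw [div_mul_eq_mul_div]
        gcongr
      linarith
    have e : ∫ y in K, f y * (⟪y, θ⟫ - d) = (∫ y in K, f y * (⟪y, θ⟫ - s)) - δ / c := by
      have h1 : ∀ y : EuclideanSpace ℝ (Fin n), 
          f y * (⟪y, θ⟫ - d) = f y * (⟪y, θ⟫ - s) - f y * (1 / c) := by
        intro y; rw [hs]; ring
      simp_rw [h1]
      rw [integral_sub (ub s) (hfi.mul_const _), integral_mul_const, hfδ]
      ring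
    rw [e]
    linarith

lemma weak_sep {n : ℕ} (A : Set (EuclideanSpace ℝ (Fin n))) (hA : Convex ℝ A) (hne : A.Nonempty)
    (x : EuclideanSpace ℝ (Fin n)) (hx : x ∉ A) :
    ∃ θ : EuclideanSpace ℝ (Fin n), ‖θ‖ = 1 ∧ ∀ a ∈ A, ⟪a, θ⟫ ≤ ⟪x, θ⟫ := by
  suffices h : ∃ θ : EuclideanSpace ℝ (Fin n), θ ≠ 0 ∧ ∀ a ∈ A, ⟪a, θ⟫ ≤ ⟪x, θ⟫ by
    obtain ⟨θ, h0, h⟩ := h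
    refine ⟨‖θ‖⁻¹ • θ, by rw [norm_smul, norm_inv, norm_norm, inv_mul_cancel₀ (by simpa using h0)], ?_⟩
    intro a ha
    rw [inner_smul_right, inner_smul_right]
    exact mul_le_mul_of_nonneg_left (h a ha) (by positivity)
  by_cases hint : (interior A).Nonempty
  · obtain ⟨f, hf0, hf⟩ := geometric_hahn_banach_of_nonempty_interior_point (x := x) hA
      (fun h => hx (interior_subset h)) hint
    refine ⟨(InnerProductSpace.toDual ℝ _).symm f, by simpa using hf0, fun a ha => ?_⟩
    rw [real_inner_comm, real_inner_comm _ x, InnerProductSpace.toDual_symm_apply,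
      InnerProductSpace.toDual_symm_apply]
    exact hf a ha
  · rw [hA.interior_nonempty_iff_affineSpan_eq_top] at hint
    obtain ⟨a0, ha0⟩ := hne
    have hdir : (affineSpan ℝ A).direction ≠ ⊤ := by
      intro h
      rw [AffineSubspace.direction_eq_top_iff_of_nonempty ⟨a0, subset_affineSpan ℝ A ha0⟩] at h
      exact hint h
    have hperp : (affineSpan ℝ A).directionᗮ ≠ ⊥ := by
      intro h
      exact hdir ((Submodule.orthogonal_eq_bot_iff).1 h)
    obtain ⟨θ, hθ, hθ0⟩ := Submodule.exists_mem_ne_zero_of_ne_bot hperp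
    have heq : ∀ a ∈ A, ⟪a, θ⟫ = ⟪a0, θ⟫ := by
      intro a ha
      have h1 := AffineSubspace.vsub_mem_direction (subset_affineSpan ℝ A ha)
        (subset_affineSpan ℝ A ha0)
      have h2 := (Submodule.mem_orthogonal _ _).1 hθ _ h1
      rw [vsub_eq_sub, inner_sub_left] at h2
      linarith
    rcases le_total (⟪a0, θ⟫) (⟪x, θ⟫) with h | h
    · exact ⟨θ, hθ0, fun a ha => by rw [heq a ha]; exact h⟩
    · refine ⟨-θ, by simpa using hθ0, fun a ha => ?_⟩
      rw [inner_neg_right, inner_neg_right, heq a ha]; linarith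

lemma mem_ulam {n : ℕ} {K : Set (EuclideanSpace ℝ (Fin n))} (hK : IsCompact K) {δ : ℝ}
    (hδ : 0 < δ) (z : EuclideanSpace ℝ (Fin n)) :
    z ∈ ulam K δ ↔ ∃ f : EuclideanSpace ℝ (Fin n) → ℝ, (∀ y, 0 ≤ f y ∧ f y ≤ 1) ∧
      IntegrableOn f K ∧ ∫ y in K, f y = δ ∧ IntegrableOn (fun y => f y • y) K ∧
      z = δ⁻¹ • ∫ y in K, f y • y := by
  have hc0 : ENNReal.ofReal (1 / δ) ≠ 0 := by simpa using hδ
  have hct : ENNReal.ofReal (1 / δ) ≠ ⊤ := by simp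
  have hr : (ENNReal.ofReal (1 / δ)).toReal = δ⁻¹ := by
    rw [ENNReal.toReal_ofReal (by positivity), one_div]
  unfold ulam metronoid
  rw [withDensity_const]
  simp only [mem_ofPred_eq, integrable_smul_measure hc0 hct, integral_smul_measure, hr]
  constructor
  · rintro ⟨f, h1, h2, h3, h4, h5⟩
    refine ⟨f, h1, h2, ?_, h4, h5⟩
    rw [smul_eq_mul] at h3
    field_simp at h3
    exact h3
  · rintro ⟨f, h1, h2, h3, h4, h5⟩
    refine ⟨f, h1, h2, ?_, h4, h5⟩
    rw [h3, smul_eq_mul, inv_mul_cancel₀ hδ.ne']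

lemma integrable_smul_id {n : ℕ} {K : Set (EuclideanSpace ℝ (Fin n))} (hK : IsCompact K)
    {f : EuclideanSpace ℝ (Fin n) → ℝ} (hf : IntegrableOn f K) :
    IntegrableOn (fun y => f y • y) K :=
  hf.smul_continuousOn continuousOn_id hK

lemma ulam_convex {n : ℕ} {K : Set (EuclideanSpace ℝ (Fin n))} (hK : IsCompact K) {δ : ℝ}
    (hδ : 0 < δ) : Convex ℝ (ulam K δ) := by
  intro x hx y hy a b ha hb hab
  rw [mem_ulam hK hδ] at *
  obtain ⟨f, f1, f2, f3, f4, rfl⟩ := hx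
  obtain ⟨g, g1, g2, g3, g4, rfl⟩ := hy
  refine ⟨fun y => a * f y + b * g y, fun y => ⟨?_, ?_⟩, ?_, ?_, ?_, ?_⟩
  · have := (f1 y).1; have := (g1 y).1; positivity
  · have := (f1 y).2; have := (g1 y).2; nlinarith
  · exact (f2.const_mul a).add (g2.const_mul b)
  · rw [integral_add (f2.const_mul a) (g2.const_mul b), integral_const_mul, integral_const_mul,
      f3, g3, ← add_mul, hab, one_mul]
  · exact integrable_smul_id hK ((f2.const_mul a).add (g2.const_mul b))
  · simp_rw [add_smul, mul_smul]
    rw [integral_add (f := fun y => a • f y • y) (g := fun y => b • g y • y) (f4.smul a) (g4.smul b),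
      integral_smul, integral_smul, smul_add,
      smul_comm a, smul_comm b]

lemma inner_bary {n : ℕ} {K : Set (EuclideanSpace ℝ (Fin n))} (hK : IsCompact K)
    {f : EuclideanSpace ℝ (Fin n) → ℝ} (hf : IntegrableOn f K)
    (θ : EuclideanSpace ℝ (Fin n)) (δ : ℝ) :
    ⟪δ⁻¹ • ∫ y in K, f y • y, θ⟫ = δ⁻¹ * ∫ y in K, f y * ⟪y, θ⟫ := by
  rw [inner_smul_left, real_inner_comm, ← integral_inner (integrable_smul_id hK hf)]
  simp only [inner_smul_right, real_inner_comm θ]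
  simp

lemma cap_cont {n : ℕ} {K : Set (EuclideanSpace ℝ (Fin n))} (hK : IsCompact K)
    (θ : EuclideanSpace ℝ (Fin n)) (hθ : ‖θ‖ = 1) :
    Continuous fun t : ℝ => (volume (K ∩ {y | t ≤ ⟪y, θ⟫})).toReal := by
  have mm : ∀ t : ℝ, MeasurableSet {y : EuclideanSpace ℝ (Fin n) | t ≤ ⟪y, θ⟫} := fun t =>
    measurableSet_le measurable_const (cont_inner θ).measurable
  have e : (fun t : ℝ => (volume (K ∩ {y | t ≤ ⟪y, θ⟫})).toReal) =
      fun t => ∫ y in K, ({y : EuclideanSpace ℝ (Fin n) | t ≤ ⟪y, θ⟫}.indicator (fun _ => (1:ℝ)) y) := by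
    funext t
    rw [integral_indicator (mm t), Measure.restrict_restrict (mm t)]
    simp [Measure.real, inter_comm]
  rw [e, continuous_iff_continuousAt]
  intro t
  apply continuousAt_of_dominated (bound := fun _ => 1)
  · filter_upwards with s
    exact (measurable_const.indicator (mm s)).aestronglyMeasurable
  · filter_upwards with s
    filter_upwards with y
    by_cases h : s ≤ ⟪y, θ⟫ <;> simp [indicator, h]
  · exact integrable_const_iff.2 (Or.inr ⟨by simpa using hK.measure_lt_top⟩)
  · have h1 : ∀ᵐ y ∂(volume.restrict K), ⟪y, θ⟫ ≠ t := by
      apply ae_restrict_of_ae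
      rw [ae_iff]
      simpa using hyper_null θ hθ t
    filter_upwards [h1] with y hy
    rcases lt_or_gt_of_ne hy with h | h
    · apply ContinuousAt.congr (f := fun _ => (0:ℝ)) continuousAt_const
      filter_upwards [lt_mem_nhds h] with s hs
      simp [indicator, not_le.2 hs]
    · apply ContinuousAt.congr (f := fun _ => (1:ℝ)) continuousAt_const
      filter_upwards [gt_mem_nhds h] with s hs
      simp [indicator, hs.le]

/-- `K_{((e-1)/e)δ} ⊆ M_δ(K) ⊆ K_{δ/e}`. -/
theorem stmt6 (n : ℕ) (K : Set (EuclideanSpace ℝ (Fin n)))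
    (hK : IsCompact K) (hKc : Convex ℝ K) (hKi : (interior K).Nonempty)
    (δ : ℝ) (hδ0 : 0 < δ) (hδ1 : δ < (volume K).toReal) :
    cfloat K ((Real.exp 1 - 1) / Real.exp 1 * δ) ⊆ ulam K δ ∧
    ulam K δ ⊆ cfloat K (δ / Real.exp 1) := by
  have hKfin : volume K ≠ ⊤ := hK.measure_lt_top.ne
  have constint : ∀ c : ℝ, IntegrableOn (fun _ : EuclideanSpace ℝ (Fin n) => c) K := fun c =>
    integrable_const_iff.2 (Or.inr ⟨by simpa using hK.measure_lt_top⟩)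
  constructor
  · intro x hx
    by_contra hxu
    have hne : (ulam K δ).Nonempty := by
      have hV : 0 < (volume K).toReal := hδ0.trans hδ1
      refine ⟨_, (mem_ulam hK hδ0 _).2 ⟨fun _ => δ / (volume K).toReal, fun _ => ⟨by positivity,
        (div_le_one hV).2 hδ1.le⟩, constint _, ?_, integrable_smul_id hK (constint _), rfl⟩⟩
      simp only [integral_const, Measure.real, Measure.restrict_apply_univ, smul_eq_mul]
      field_simp
    obtain ⟨θ, hθ, hsep⟩ := weak_sep _ (ulam_convex hK hδ0) hne x hxu
    have hcont := cap_cont hK θ hθ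
    set φ : ℝ → ℝ := fun t => (volume (K ∩ {y | t ≤ ⟪y, θ⟫})).toReal with hφ
    obtain ⟨R, hR⟩ : ∃ R : ℝ, ∀ y ∈ K, |⟪y, θ⟫| < R := by
      obtain ⟨R, hR⟩ := hK.exists_bound_of_continuousOn (cont_inner θ).continuousOn
      exact ⟨R + 1, fun y hy => lt_of_le_of_lt (hR y hy) (by linarith)⟩
    obtain ⟨s, hs⟩ : ∃ s, φ s = δ := by
      have := mem_range_of_exists_le_of_exists_ge (c := δ) hcont ⟨R, ?_⟩ ⟨-R, ?_⟩
      · exact this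
      · have : K ∩ {y | R ≤ ⟪y, θ⟫} = ∅ := by
          ext y
          simp only [mem_inter_iff, mem_ofPred_eq, mem_empty_iff_false, iff_false, not_and, not_le]
          exact fun hy => (abs_lt.1 (hR y hy)).2
        simp only [hφ, this]; simpa using hδ0.le
      · have : K ∩ {y | -R ≤ ⟪y, θ⟫} = K := by
          apply inter_eq_left.2
          intro y hy
          exact (abs_lt.1 (hR y hy)).1.le
        simp only [hφ, this]; exact hδ1.le
    set C := K ∩ {y | s ≤ ⟪y, θ⟫} with hC
    have hCK : C ⊆ K := inter_subset_left
    have hCc : IsCompact C := hK.inter_right (isClosed_le continuous_const (cont_inner θ))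
    have hCconv : Convex ℝ C := by
      apply hKc.inter
      intro x hx y hy a b ha hb hab
      simp only [mem_ofPred_eq, inner_add_left, inner_smul_left] at *
      have h1 := mul_le_mul_of_nonneg_left hx ha
      have h2 := mul_le_mul_of_nonneg_left hy hb
      have h3 : s = a * s + b * s := by rw [← add_mul, hab, one_mul]
      simp
      linarith
    have hCm := hCc.measurableSet
    have hCfin : volume C ≠ ⊤ := hCc.measure_lt_top.ne
    have hCv : (volume C).toReal = δ := hs
    have onei : IntegrableOn (fun _ : EuclideanSpace ℝ (Fin n) => (1:ℝ)) C :=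
      (constint 1).mono_set hCK
    have hui : IntegrableOn (fun y : EuclideanSpace ℝ (Fin n) => ⟪y, θ⟫) C :=
      (cont_inner θ).continuousOn.integrableOn_compact hCc
    set m := δ⁻¹ * ∫ y in C, ⟪y, θ⟫ with hm
    have hmm : ∫ y in C, ⟪y, θ⟫ = δ * m := by rw [hm]; field_simp
    have hone : ∫ y in C, (1:ℝ) = δ := by simpa [Measure.real] using hCv
    have hmx : m ≤ ⟪x, θ⟫ := by
      have hi : IntegrableOn (C.indicator fun _ => (1:ℝ)) K := (constint 1).indicator hCm
      have hmem : δ⁻¹ • ∫ y in K, (C.indicator (fun _ => (1:ℝ)) y) • y ∈ ulam K δ := by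
        refine (mem_ulam hK hδ0 _).2 ⟨C.indicator fun _ => 1, fun y => ?_, hi, ?_,
          integrable_smul_id hK hi, rfl⟩
        · by_cases h : y ∈ C <;> simp [h]
        · rw [setIntegral_indicator hCm, inter_eq_right.2 hCK, hone]
      have := hsep _ hmem
      rw [inner_bary hK hi] at this
      refine le_trans (le_of_eq ?_) this
      rw [hm]
      congr 1
      have : ∀ y : EuclideanSpace ℝ (Fin n), C.indicator (fun _ => (1:ℝ)) y * ⟪y, θ⟫ = 
          C.indicator (fun y => ⟪y, θ⟫) y := by
        intro y
        by_cases h : y ∈ C <;> simp [h]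
      simp_rw [this]
      rw [setIntegral_indicator hCm, inter_eq_right.2 hCK]
    have hsm : s ≤ m := by
      have : ∫ y in C, s ≤ ∫ y in C, ⟪y, θ⟫ := by
        apply setIntegral_mono_on (integrable_const_iff.2 (Or.inr ⟨by simpa using hCc.measure_lt_top⟩))
          hui hCm
        intro y hy
        exact hy.2
      rw [hmm, setIntegral_const, smul_eq_mul, Measure.real, hCv] at this
      exact le_of_mul_le_mul_left this hδ0
    have hlim : (Real.exp 1 - 1) / Real.exp 1 * δ ≤ φ m := by
      have h1 : ∀ d, d < m → (Real.exp 1 - 1) / Real.exp 1 * δ ≤ φ d := by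
        intro d hd
        by_contra hcon
        push Not at hcon
        have := hx θ hθ d hcon.le
        linarith
      have ht : Filter.Tendsto φ (𝓝[<] m) (𝓝 (φ m)) := (hcont.tendsto m).mono_left nhdsWithin_le_nhds
      apply ge_of_tendsto ht
      filter_upwards [self_mem_nhdsWithin] with d hd
      exact h1 d hd
    have hvol : (volume (C ∩ {y | -m ≤ ⟪y, -θ⟫})).toReal ≤ δ / Real.exp 1 := by
      have e1 : C ∩ {y | -m ≤ ⟪y, -θ⟫} = C ∩ {y | ⟪y, θ⟫ ≤ m} := by
        ext y; simp
      have e2 : C = (C ∩ {y | ⟪y, θ⟫ ≤ m}) ∪ (K ∩ {y | m ≤ ⟪y, θ⟫}) := by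
        ext y
        simp only [hC, mem_union, mem_inter_iff, mem_ofPred_eq]
        constructor
        · rintro ⟨h1, h2⟩
          rcases le_total (⟪y, θ⟫) m with h | h
          · exact Or.inl ⟨⟨h1, h2⟩, h⟩
          · exact Or.inr ⟨h1, h⟩
        · rintro (h | h)
          · exact h.1
          · exact ⟨h.1, hsm.trans h.2⟩
      have e3 : volume ((C ∩ {y | ⟪y, θ⟫ ≤ m}) ∪ (K ∩ {y | m ≤ ⟪y, θ⟫})) =
          volume (C ∩ {y | ⟪y, θ⟫ ≤ m}) + volume (K ∩ {y | m ≤ ⟪y, θ⟫}) := by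
        apply measure_union₀ (cap_meas hK θ m).nullMeasurableSet
        apply measure_mono_null _ (hyper_null θ hθ m)
        rintro y ⟨h1, h2⟩
        exact le_antisymm h1.2 h2.2
      rw [← e2] at e3
      have e4 := congrArg ENNReal.toReal e3
      rw [ENNReal.toReal_add (ne_top_of_le_ne_top hCfin (measure_mono inter_subset_left))
        (ne_top_of_le_ne_top hKfin (measure_mono inter_subset_left)), hCv] at e4
      rw [e1]
      have e5 : (Real.exp 1 - 1) / Real.exp 1 * δ = δ - δ / Real.exp 1 := by
        field_simp
      have e6 : φ m = (volume (K ∩ {y | m ≤ ⟪y, θ⟫})).toReal := rfl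
      linarith
    have := (grun C hCc hCconv (fun _ => 1) (fun _ => by norm_num) onei (-θ) (by simpa using hθ)
      (-m) δ hδ0 hone hvol).2
    have e : ∫ y in C, (1:ℝ) * (⟪y, -θ⟫ - -m) = 0 := by
      have h1 : ∀ y : EuclideanSpace ℝ (Fin n), (1:ℝ) * (⟪y, -θ⟫ - -m) = 1 * m - ⟪y, θ⟫ := by
        intro y; rw [inner_neg_right]; ring
      simp_rw [h1]
      rw [integral_sub (onei.mul_const m) hui, integral_mul_const, hone, hmm, sub_self]
    linarith
  · intro z hz θ hθ d hd
    obtain ⟨f, f1, f2, f3, f4, rfl⟩ := (mem_ulam hK hδ0 _).1 hz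
    obtain ⟨h1, h2⟩ := grun K hK hKc f f1 f2 θ hθ d δ hδ0 f3 hd
    rw [inner_bary hK f2]
    have e : ∫ y in K, f y * (⟪y, θ⟫ - d) = (∫ y in K, f y * ⟪y, θ⟫) - δ * d := by
      simp_rw [mul_sub]
      rw [integral_sub (f2.mul_continuousOn (cont_inner θ).continuousOn hK) (f2.mul_const d),
        integral_mul_const, f3]
    rw [inv_mul_le_iff₀ hδ0]
    linarith
end

section
/- Let g: ℝ → [0,∞) be an integrable log-concave function with ∫g > 0 and let m be a point such that ∫_{t≥m} g(t)dt ≥ (1/e)∫g and ∫_{t≤m} g(t)dt ≥ (1/e)∫g. Equivalently: for any log-concave density, the mass on either side of the barycenter of the measure g(t)dt is at least 1/e of the total mass. -/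
open MeasureTheory Set
open scoped Topology

def LC (g : ℝ → ℝ) : Prop := ∀ x y : ℝ, ∀ t : ℝ, 0 ≤ t → t ≤ 1 →
      g x ^ (1 - t) * g y ^ t ≤ g ((1 - t) * x + t * y)

lemma lc_shift {g : ℝ → ℝ} (hg0 : ∀ t, 0 ≤ g t) (h : LC g) {u v w z : ℝ}
    (h1 : u ≤ w) (h2 : w ≤ v) (h3 : u + v = w + z) : g u * g v ≤ g w * g z := by
  rcases eq_or_lt_of_le (h1.trans h2) with e | e
  · have hw : w = u := by linarith
    have hz : z = v := by linarith
    rw [hw, hz]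
  · have hd : 0 < v - u := by linarith
    set t := (w - u) / (v - u) with ht
    have htd : t * (v - u) = w - u := by rw [ht]; field_simp
    have t0 : 0 ≤ t := div_nonneg (by linarith) hd.le
    have t1 : t ≤ 1 := by rw [ht, div_le_one hd]; linarith
    have A := h u v t t0 t1
    have B := h u v (1 - t) (by linarith) (by linarith)
    rw [show (1 - t) * u + t * v = w by linarith] at A
    rw [show (1 - (1 - t)) * u + (1 - t) * v = z by linarith,
      show 1 - (1 - t) = t by ring] at B
    have e1 : g u = g u ^ (1 - t) * g u ^ t := by
      rw [← Real.rpow_add_of_nonneg (hg0 u) (by linarith) t0]; simp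
    have e2 : g v = g v ^ t * g v ^ (1 - t) := by
      rw [← Real.rpow_add_of_nonneg (hg0 v) t0 (by linarith)]; simp
    have n1 : 0 ≤ g u ^ t * g v ^ (1 - t) :=
      mul_nonneg (Real.rpow_nonneg (hg0 _) _) (Real.rpow_nonneg (hg0 _) _)
    calc g u * g v = (g u ^ (1 - t) * g u ^ t) * (g v ^ t * g v ^ (1 - t)) := by
          rw [← e1, ← e2]
      _ = (g u ^ (1 - t) * g v ^ t) * (g u ^ t * g v ^ (1 - t)) := by ring
      _ ≤ g w * g z := mul_le_mul A B n1 (hg0 _)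

lemma lc_ratio {g : ℝ → ℝ} (hg0 : ∀ t, 0 ≤ g t) (hgint : Integrable g) (h : LC g) {a b : ℝ}
    (hab : a ≤ b) : (∫ t in Iic a, g t) * g b ≤ g a * ∫ t in Iic b, g t := by
  have e : ∫ t in Iic b, g t = ∫ t in Iic a, g (t + (b - a)) := by
    have := (measurePreserving_add_right volume (b - a)).setIntegral_preimage_emb
      (MeasurableEquiv.addRight (b - a)).measurableEmbedding g (Iic b)
    rw [← this]
    simp
  rw [e, ← integral_mul_const, ← integral_const_mul]
  apply setIntegral_mono_on
  · exact (hgint.mul_const _).integrableOn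
  · exact ((hgint.comp_add_right (b - a)).const_mul _).integrableOn
  · exact measurableSet_Iic
  · intro t ht
    exact lc_shift hg0 h (mem_Iic.1 ht) hab (by ring)

lemma gron {f : ℝ → ℝ} (hf : Continuous f) {c a b : ℝ} (hc : 0 ≤ c) (hab : a ≤ b)
    (h : ∀ x ∈ Icc a b, f x ≤ f a + c * ∫ t in a..x, f t) :
    f b ≤ f a * Real.exp (c * (b - a)) := by
  let P : ℝ → ℝ := fun x => (f a + c * ∫ t in a..x, f t) * Real.exp (-(c * (x - a)))
  have hd : ∀ x, HasDerivAt P ((c * f x) * Real.exp (-(c * (x - a))) +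
      (f a + c * ∫ t in a..x, f t) * (Real.exp (-(c * (x - a))) * (-(c * 1)))) x := by
    intro x
    have h1 : HasDerivAt (fun x => f a + c * ∫ t in a..x, f t) (c * f x) x :=
      ((hf.integral_hasStrictDerivAt a x).hasDerivAt.const_mul c).const_add _
    have h2 : HasDerivAt (fun x => Real.exp (-(c * (x - a))))
        (Real.exp (-(c * (x - a))) * (-(c * 1))) x :=
      ((((hasDerivAt_id x).sub_const a).const_mul c).neg).exp
    exact h1.mul h2
  have hanti : AntitoneOn P (Icc a b) := by
    apply antitoneOn_of_deriv_nonpos (convex_Icc a b)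
    · exact fun x _ => (hd x).continuousAt.continuousWithinAt
    · exact fun x _ => (hd x).differentiableAt.differentiableWithinAt
    · intro x hx
      rw [(hd x).deriv]
      have := h x (interior_subset hx)
      have e := Real.exp_pos (-(c * (x - a)))
      have : c * Real.exp (-(c * (x - a))) * (f x - (f a + c * ∫ t in a..x, f t)) ≤ 0 :=
        mul_nonpos_of_nonneg_of_nonpos (by positivity) (by linarith)
      linarith
  have k := hanti (left_mem_Icc.2 hab) (right_mem_Icc.2 hab) hab
  simp only [P] at k
  simp at k
  have k2 := h b (right_mem_Icc.2 hab)
  rw [Real.exp_neg, ← div_eq_mul_inv, div_le_iff₀ (Real.exp_pos _)] at k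
  linarith

lemma lc_tangent {g : ℝ → ℝ} (hg0 : ∀ t, 0 ≤ g t) (hgint : Integrable g) (h : LC g) {m : ℝ}
    (hF : 0 < ∫ t in Iic m, g t) (x : ℝ) :
    (∫ t in Iic x, g t) ≤
      (∫ t in Iic m, g t) * Real.exp ((g m / ∫ t in Iic m, g t) * (x - m)) := by
  set F : ℝ → ℝ := fun x => ∫ t in Iic x, g t with hFdef
  change F x ≤ F m * Real.exp (g m / F m * (x - m))
  change 0 < F m at hF
  have hsub : ∀ a b, F b = F a + ∫ t in a..b, g t := by
    intro a b
    have := intervalIntegral.integral_Iic_sub_Iic (f := g) (μ := volume) (a := a) (b := b)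
      hgint.integrableOn hgint.integrableOn
    simp only [hFdef]; linarith
  have hcont : Continuous F := by
    have : F = fun x => F 0 + ∫ t in (0:ℝ)..x, g t := funext fun x => hsub 0 x
    rw [this]
    exact continuous_const.add (hgint.continuous_primitive 0)
  set c := g m / F m with hc
  have hc0 : 0 ≤ c := div_nonneg (hg0 _) hF.le
  have hcm : c * F m = g m := by rw [hc]; field_simp
  have hr : ∀ a b, a ≤ b → F a * g b ≤ g a * F b := fun a b hab => lc_ratio hg0 hgint h hab
  rcases le_total m x with hx | hx
  · apply gron hcont hc0 hx
    intro y hy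
    rw [hsub m y, ← intervalIntegral.integral_const_mul]
    gcongr
    apply intervalIntegral.integral_mono_on hy.1 hgint.intervalIntegrable
      ((hcont.intervalIntegrable _ _).const_mul c)
    intro t ht
    have := hr m t ht.1
    rw [← hcm] at this
    have : F m * g t ≤ F m * (c * F t) := by linarith
    exact le_of_mul_le_mul_left this hF
  · have := gron (f := fun x => - F x) hcont.neg (c := c) (a := x) (b := m) hc0 hx ?_
    · have h2 : F x * Real.exp (c * (m - x)) ≤ F m := by linarith
      rw [show c * (x - m) = -(c * (m - x)) by ring, Real.exp_neg, ← div_eq_mul_inv,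
        le_div_iff₀ (Real.exp_pos _)]
      exact h2
    · intro y hy
      have : ∫ t in x..y, c * F t ≤ ∫ t in x..y, g t := by
        apply intervalIntegral.integral_mono_on hy.1
          ((hcont.intervalIntegrable _ _).const_mul c) hgint.intervalIntegrable
        intro t ht
        have := hr t m (ht.2.trans hy.2)
        rw [← hcm] at this
        have : F m * (c * F t) ≤ F m * g t := by linarith
        exact le_of_mul_le_mul_left this hF
      rw [intervalIntegral.integral_const_mul] at this
      simp only [intervalIntegral.integral_neg]
      rw [hsub x y]
      linarith

lemma meas_cdf_le (ν : Measure ℝ) [IsProbabilityMeasure ν] (u : ℝ) :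
    ν {x | ν.real (Iic x) ≤ u} ≤ ENNReal.ofReal u := by
  have hmono : Monotone fun x => ν.real (Iic x) := fun x y hxy =>
    measureReal_mono (Iic_subset_Iic.2 hxy)
  have hm : MeasurableSet {x | ν.real (Iic x) ≤ u} :=
    measurableSet_le hmono.measurable measurable_const
  rw [hm.measure_eq_iSup_isCompact_of_ne_top (measure_ne_top _ _)]
  refine iSup_le fun K => iSup_le fun hK => iSup_le fun hKc => ?_
  rcases K.eq_empty_or_nonempty with rfl | hne
  · simp
  · obtain ⟨a, ha⟩ := hKc.exists_isGreatest hne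
    have h1 : ν K ≤ ν (Iic a) := measure_mono fun x hx => ha.2 hx
    have h2 : ν.real (Iic a) ≤ u := hK ha.1
    rw [← ofReal_measureReal (s := Iic a)] at h1
    exact h1.trans (ENNReal.ofReal_le_ofReal h2)

lemma lint_log_cdf (ν : Measure ℝ) [IsProbabilityMeasure ν] :
    ∫⁻ x, ENNReal.ofReal (- Real.log (ν.real (Iic x))) ∂ν ≤ 1 := by
  have hmono : Monotone fun x => ν.real (Iic x) := fun x y hxy =>
    measureReal_mono (Iic_subset_Iic.2 hxy)
  rw [lintegral_eq_lintegral_meas_lt]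
  · calc ∫⁻ t in Ioi 0, ν {a | t < - Real.log (ν.real (Iic a))}
        ≤ ∫⁻ t in Ioi (0:ℝ), ENNReal.ofReal (Real.exp (-t)) := by
          apply setLIntegral_mono (by fun_prop)
          intro t ht
          refine le_trans (measure_mono ?_) (meas_cdf_le ν (Real.exp (-t)))
          intro x hx
          simp only [mem_ofPred_eq] at hx ⊢
          rcases eq_or_lt_of_le (measureReal_nonneg (μ := ν) (s := Iic x)) with e | e
          · rw [← e]; positivity
          · rw [← Real.log_le_iff_le_exp e]; linarith
      _ = ENNReal.ofReal (∫ t in Ioi (0:ℝ), Real.exp (-t)) := by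
          rw [ofReal_integral_eq_lintegral_ofReal]
          · exact integrableOn_exp_neg_Ioi 0
          · exact Filter.Eventually.of_forall fun t => (Real.exp_pos _).le
      _ = 1 := by rw [integral_exp_neg_Ioi]; simp
  · refine Filter.Eventually.of_forall fun x => ?_
    have := Real.log_nonpos (measureReal_nonneg (μ := ν) (s := Iic x)) measureReal_le_one
    simpa using this
  · exact (Real.measurable_log.comp hmono.measurable).neg.aemeasurable

lemma lc_pos_exists {g : ℝ → ℝ} (hg0 : ∀ t, 0 ≤ g t) (hpos : 0 < ∫ t, g t) : ∃ p, 0 < g p := by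
  by_contra! hcon
  have : g = fun _ => 0 := funext fun t => le_antisymm (hcon t) (hg0 t)
  rw [this] at hpos
  simp at hpos

lemma lc_moment {g : ℝ → ℝ} (hg0 : ∀ t, 0 ≤ g t) (hgint : Integrable g) (h : LC g)
    (hpos : 0 < ∫ t, g t) : IntegrableOn (fun t => t * g t) (Ioi 0) := by
  obtain ⟨p, hp⟩ := lc_pos_exists hg0 hpos
  have hq : ∃ q, p < q ∧ g q < g p := by
    by_contra! hcon
    have : IntegrableOn (fun _ : ℝ => g p) (Ioi p) := by
      refine Integrable.mono' hgint.integrableOn (by fun_prop) ?_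
      refine (ae_restrict_iff' measurableSet_Ioi).2 (Filter.Eventually.of_forall fun x hx => ?_)
      rw [Real.norm_of_nonneg hp.le]
      exact hcon x hx
    rw [integrableOn_const_iff] at this
    simp [hp.ne'] at this
  obtain ⟨q, hpq, hqp⟩ := hq
  set y := max (g q) (g p / 2) with hy
  have hy0 : 0 < y := lt_max_of_lt_right (by linarith)
  have hyp : y < g p := max_lt hqp (by linarith)
  set k := Real.log (g p) - Real.log y with hk
  have hk0 : 0 < k := by have := Real.log_lt_log hy0 hyp; linarith
  have hd : 0 < q - p := by linarith
  set κ := k / (q - p) with hκ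
  have hκ0 : 0 < κ := by positivity
  have hκd : κ * (q - p) = k := by rw [hκ]; field_simp
  have decay : ∀ x, q < x → g x ≤ g p * Real.exp (-(κ * (x - p))) := by
    intro x hx
    rcases eq_or_lt_of_le (hg0 x) with e | e
    · rw [← e]; positivity
    have hxp : 0 < x - p := by linarith
    set t := (q - p) / (x - p) with ht
    have htd : t * (x - p) = q - p := by rw [ht]; field_simp
    have t0 : 0 ≤ t := by positivity
    have t1 : t ≤ 1 := by rw [ht, div_le_one hxp]; linarith
    have A := h p x t t0 t1
    rw [show (1 - t) * p + t * x = q by linarith] at A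
    have A2 := A.trans (le_max_left (g q) (g p / 2))
    rw [← hy] at A2
    have A3 := Real.log_le_log (by positivity) A2
    rw [Real.log_mul (by positivity) (by positivity), Real.log_rpow hp, Real.log_rpow e] at A3
    have A4 : t * (Real.log (g x) - Real.log (g p)) ≤ -k := by linarith
    have A5 := mul_le_mul_of_nonneg_right A4 hxp.le
    have A6 : (q - p) * (Real.log (g x) - Real.log (g p)) ≤ (q - p) * (-(κ * (x - p))) := by
      calc (q - p) * (Real.log (g x) - Real.log (g p))
          = t * (Real.log (g x) - Real.log (g p)) * (x - p) := by rw [← htd]; ring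
        _ ≤ -k * (x - p) := A5
        _ = (q - p) * (-(κ * (x - p))) := by rw [← hκd]; ring
    have A7 := le_of_mul_le_mul_left A6 hd
    have A8 : Real.log (g x) ≤ Real.log (g p) + -(κ * (x - p)) := by linarith
    calc g x = Real.exp (Real.log (g x)) := (Real.exp_log e).symm
      _ ≤ Real.exp (Real.log (g p) + -(κ * (x - p))) := Real.exp_le_exp.2 A8
      _ = _ := by rw [Real.exp_add, Real.exp_log hp]
  have hmeas : AEStronglyMeasurable (fun t => t * g t) volume :=
    aestronglyMeasurable_id.mul hgint.1
  have I1 : IntegrableOn (fun t => t * g t) (Icc 0 |q|) := by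
    refine Integrable.mono' (hgint.const_mul |q|).integrableOn hmeas.restrict ?_
    refine (ae_restrict_iff' measurableSet_Icc).2 (Filter.Eventually.of_forall fun x hx => ?_)
    rw [Real.norm_of_nonneg (mul_nonneg hx.1 (hg0 x))]
    exact mul_le_mul_of_nonneg_right hx.2 (hg0 x)
  have I2 : IntegrableOn (fun t => t * g t) (Ioi |q|) := by
    have J : IntegrableOn (fun x => |p| * g x +
        (2 / κ * g p * Real.exp (κ / 2 * p)) * Real.exp (-(κ / 2) * x)) (Ioi |q|) :=
      (hgint.const_mul |p|).integrableOn.add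
        ((integrableOn_exp_mul_Ioi (by linarith) |q|).const_mul _)
    refine Integrable.mono' J hmeas.restrict ?_
    refine (ae_restrict_iff' measurableSet_Ioi).2 (Filter.Eventually.of_forall fun x hx => ?_)
    have hx' : |q| < x := hx
    have hqx : q < x := (le_abs_self q).trans_lt hx'
    have hx0 : 0 ≤ x := (abs_nonneg q).trans hx'.le
    rw [Real.norm_of_nonneg (mul_nonneg hx0 (hg0 x))]
    have D := decay x hqx
    have hxp : 0 < x - p := by linarith
    have E : κ / 2 * (x - p) ≤ Real.exp (κ / 2 * (x - p)) := by
      have := Real.add_one_le_exp (κ / 2 * (x - p)); linarith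
    have E2 : x - p ≤ 2 / κ * Real.exp (κ / 2 * (x - p)) := by
      rw [div_mul_eq_mul_div, le_div_iff₀ hκ0]; linarith
    have E3 : (x - p) * g x ≤ (2 / κ * Real.exp (κ / 2 * (x - p))) *
        (g p * Real.exp (-(κ * (x - p)))) :=
      mul_le_mul E2 D (hg0 x) (by positivity)
    have E4 : (2 / κ * Real.exp (κ / 2 * (x - p))) * (g p * Real.exp (-(κ * (x - p)))) =
        (2 / κ * g p * Real.exp (κ / 2 * p)) * Real.exp (-(κ / 2) * x) := by
      rw [show (2 / κ * Real.exp (κ / 2 * (x - p))) * (g p * Real.exp (-(κ * (x - p)))) =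
        2 / κ * g p * (Real.exp (κ / 2 * (x - p)) * Real.exp (-(κ * (x - p)))) by ring,
        mul_assoc (2 / κ * g p), ← Real.exp_add, ← Real.exp_add]
      congr 2; ring
    have E5 : p * g x ≤ |p| * g x := mul_le_mul_of_nonneg_right (le_abs_self p) (hg0 x)
    rw [E4] at E3
    linarith
  refine (I1.union I2).mono_set fun x hx => ?_
  rcases le_or_gt x |q| with h | h
  · exact Or.inl ⟨(mem_Ioi.1 hx).le, h⟩
  · exact Or.inr h

lemma LC.neg {g : ℝ → ℝ} (h : LC g) : LC (fun t => g (-t)) := by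
  intro x y t h0 h1
  have := h (-x) (-y) t h0 h1
  rw [show (1 - t) * -x + t * -y = -((1 - t) * x + t * y) by ring] at this
  exact this

lemma lc_moment' {g : ℝ → ℝ} (hg0 : ∀ t, 0 ≤ g t) (hgint : Integrable g) (h : LC g)
    (hpos : 0 < ∫ t, g t) : Integrable (fun t => t * g t) := by
  have A := lc_moment hg0 hgint h hpos
  have B := lc_moment (g := fun t => g (-t)) (fun t => hg0 _) hgint.comp_neg h.neg
    (by rw [integral_neg_eq_self]; exact hpos)
  have B2 : IntegrableOn (fun t => t * g t) (Iio 0) := by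
    have e := (Measure.measurePreserving_neg (volume : Measure ℝ)).integrableOn_comp_preimage
      (MeasurableEquiv.neg ℝ).measurableEmbedding (f := fun t => t * g t) (s := Iio 0)
    rw [← e]
    have : (Neg.neg ⁻¹' Iio (0:ℝ)) = Ioi 0 := by ext; simp
    rw [this]
    refine B.neg.congr (Filter.Eventually.of_forall fun x => ?_)
    simp
  have B3 : IntegrableOn (fun t => t * g t) (Iic 0) := by
    rwa [integrableOn_Iic_iff_integrableOn_Iio]
  have := B3.union A
  rwa [Iic_union_Ioi, integrableOn_univ] at this

lemma half {g : ℝ → ℝ} (hg0 : ∀ t, 0 ≤ g t) (hgint : Integrable g) (h : LC g)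
    (hpos : 0 < ∫ t, g t) (m : ℝ) (hm : m = (∫ t, t * g t) / ∫ t, g t) :
    (1 / Real.exp 1) * (∫ t, g t) ≤ (∫ t in Set.Iic m, g t) := by
  have hmom := lc_moment' hg0 hgint h hpos
  set I := ∫ t, g t with hI
  have hcent : ∫ t, (t - m) * g t = 0 := by
    simp_rw [sub_mul]
    rw [integral_sub hmom (hgint.const_mul m), integral_const_mul, ← hI, hm]
    field_simp; ring
  have hcint : Integrable fun t => (t - m) * g t := by
    simp_rw [sub_mul]; exact hmom.sub (hgint.const_mul m)
  have hF : 0 < ∫ t in Iic m, g t := by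
    rcases eq_or_lt_of_le (setIntegral_nonneg measurableSet_Iic fun t _ => hg0 t :
      0 ≤ ∫ t in Iic m, g t) with e | e
    · exfalso
      have h1 := (setIntegral_eq_zero_iff_of_nonneg_ae
        (Filter.Eventually.of_forall hg0) hgint.integrableOn).1 e.symm
      have h1' := (ae_restrict_iff' measurableSet_Iic).1 h1
      have h2 : 0 ≤ᵐ[volume] fun t => (t - m) * g t := by
        filter_upwards [h1'] with t ht
        rcases le_total t m with hh | hh
        · have := ht hh
          simp at this
          simp [this]
        · exact mul_nonneg (by linarith) (hg0 t)
      have h3 := (integral_eq_zero_iff_of_nonneg_ae h2 hcint).1 hcent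
      have h4 : g =ᵐ[volume] 0 := by
        filter_upwards [h1', h3] with t ht ht3
        rcases le_or_gt t m with hh | hh
        · exact ht hh
        · have : (t - m) * g t = 0 := ht3
          rcases mul_eq_zero.1 this with h5 | h5
          · linarith
          · exact h5
      rw [hI, integral_congr_ae h4] at hpos
      simp at hpos
    · exact e
  let d : ℝ → ENNReal := fun t => ENNReal.ofReal (g t / I)
  let ν : Measure ℝ := volume.withDensity d
  have hdm : AEMeasurable d := (hgint.1.aemeasurable.div_const I).ennreal_ofReal
  have hdfin : ∀ᵐ x, d x < ⊤ := Filter.Eventually.of_forall fun x => ENNReal.ofReal_lt_top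
  have hdr : ∀ x, (d x).toReal = g x / I := fun x =>
    ENNReal.toReal_ofReal (div_nonneg (hg0 x) hpos.le)
  have hset : ∀ s, MeasurableSet s → ν s = ENNReal.ofReal ((∫ t in s, g t) / I) := by
    intro s hs
    rw [withDensity_apply _ hs, ← integral_div, ofReal_integral_eq_lintegral_ofReal]
    · exact (hgint.div_const I).integrableOn
    · exact Filter.Eventually.of_forall fun x => div_nonneg (hg0 x) hpos.le
  have hprob : IsProbabilityMeasure ν := ⟨by
    rw [hset _ MeasurableSet.univ, setIntegral_univ, ← hI, div_self hpos.ne']; simp⟩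
  have hcdf : ∀ x, ν.real (Iic x) = (∫ t in Iic x, g t) / I := by
    intro x
    rw [measureReal_def, hset _ measurableSet_Iic, ENNReal.toReal_ofReal]
    exact div_nonneg (setIntegral_nonneg measurableSet_Iic fun t _ => hg0 t) hpos.le
  set c := g m / ∫ t in Iic m, g t with hc
  set Fm := ν.real (Iic m) with hFm
  have hFm0 : 0 < Fm := by rw [hFm, hcdf]; exact div_pos hF hpos
  have htan : ∀ x, ν.real (Iic x) ≤ Fm * Real.exp (c * (x - m)) := by
    intro x
    rw [hFm, hcdf, hcdf, div_mul_eq_mul_div]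
    exact div_le_div_of_nonneg_right (lc_tangent hg0 hgint h hF x) hpos.le
  have hae : ∀ᵐ x ∂ν, 0 < ν.real (Iic x) := by
    have := meas_cdf_le ν 0
    rw [ENNReal.ofReal_zero, nonpos_iff_eq_zero] at this
    rw [ae_iff]
    simpa using this
  have hid : Integrable (fun x => x - m) ν := by
    rw [integrable_withDensity_iff_integrable_smul₀' hdm hdfin]
    refine (hcint.div_const I).congr (Filter.Eventually.of_forall fun x => ?_)
    simp only [hdr, smul_eq_mul]; ring
  have hid0 : ∫ x, (x - m) ∂ν = 0 := by
    rw [integral_withDensity_eq_integral_toReal_smul₀ hdm hdfin]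
    have : ∀ x, (d x).toReal • (x - m) = (x - m) * g x / I := by
      intro x; simp only [hdr, smul_eq_mul]; ring
    simp_rw [this]
    rw [integral_div, hcent, zero_div]
  have hk : Integrable (fun x => -Real.log Fm - c * (x - m)) ν :=
    (integrable_const _).sub (hid.const_mul c)
  have hk0 : ∫ x, (-Real.log Fm - c * (x - m)) ∂ν = -Real.log Fm := by
    rw [integral_sub (integrable_const _) (hid.const_mul c), integral_const_mul, hid0]; simp
  have key : -Real.log Fm ≤ 1 := by
    rw [← hk0, integral_eq_lintegral_pos_part_sub_lintegral_neg_part hk]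
    have : (∫⁻ x, ENNReal.ofReal (-Real.log Fm - c * (x - m)) ∂ν) ≤ 1 := by
      refine le_trans (lintegral_mono_ae ?_) (lint_log_cdf ν)
      filter_upwards [hae] with x hx
      apply ENNReal.ofReal_le_ofReal
      have := Real.log_le_log hx (htan x)
      rw [Real.log_mul hFm0.ne' (Real.exp_pos _).ne', Real.log_exp] at this
      linarith
    have t1 := ENNReal.toReal_mono ENNReal.one_ne_top this
    have t2 := ENNReal.toReal_nonneg (a := ∫⁻ x, ENNReal.ofReal (-(-Real.log Fm - c * (x - m))) ∂ν)
    rw [ENNReal.toReal_one] at t1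
    linarith
  have fin : Real.exp (-1) ≤ Fm := by
    rw [← Real.le_log_iff_exp_le hFm0]; linarith
  rw [hFm, hcdf, le_div_iff₀ hpos, Real.exp_neg] at fin
  rw [one_div]
  exact fin

/-- Grünbaum's inequality for log-concave functions on `ℝ`: if `g ≥ 0` is integrable,
log-concave, with positive total integral, and `m` is the barycenter of the measure
`g(t)dt`, then the mass on either side of `m` is at least `1/e` of the total mass. -/
theorem stmt7 (g : ℝ → ℝ) (hg0 : ∀ t, 0 ≤ g t) (hgint : Integrable g)
    (hglc : ∀ x y : ℝ, ∀ t : ℝ, 0 ≤ t → t ≤ 1 →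
      g x ^ (1 - t) * g y ^ t ≤ g ((1 - t) * x + t * y))
    (hpos : 0 < ∫ t, g t)
    (m : ℝ) (hm : m = (∫ t, t * g t) / ∫ t, g t) :
    (1 / Real.exp 1) * (∫ t, g t) ≤ (∫ t in Set.Ici m, g t) ∧
    (1 / Real.exp 1) * (∫ t, g t) ≤ (∫ t in Set.Iic m, g t) := by
  refine ⟨?_, half hg0 hgint hglc hpos m hm⟩
  have e1 : ∫ t, g (-t) = ∫ t, g t := integral_neg_eq_self g volume
  have e2 : ∫ t, t * g (-t) = - ∫ t, t * g t := by
    rw [← integral_neg_eq_self, ← integral_neg]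
    simp
  have := half (g := fun t => g (-t)) (fun t => hg0 _) hgint.comp_neg (LC.neg hglc)
    (by rw [e1]; exact hpos) (-m) (by rw [e1, e2, hm]; ring)
  rw [e1, integral_comp_neg_Iic, neg_neg, ← integral_Ici_eq_integral_Ioi] at this
  exact this
end

section
/- Let K ⊆ ℝ^n be a convex body whose boundary is of class C^k for some k ≥ 0. Then for any 0 < δ < |K|, the boundary of the Ulam floating body M_δ(K) is of class C^{k+1}. -/
open MeasureTheory Metric Set
open scoped RealInnerProductSpace ENNReal Topology

/-- The radial function of `K` with center `v`; the boundary of a convex body is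
`C^k` iff the radial function at some interior point is `C^k` on the sphere. -/
noncomputable def radialFn {n : ℕ} (K : Set (EuclideanSpace ℝ (Fin n)))
    (v θ : EuclideanSpace ℝ (Fin n)) : ℝ :=
  sSup {r : ℝ | 0 ≤ r ∧ v + r • θ ∈ K}

set_option linter.unusedSectionVars false
namespace Ulam
open Filter

/-- gauge of `K` about the moving center `c`. -/
noncomputable def cg {E : Type*} [AddCommGroup E] [Module ℝ E] (K : Set E) (c x : E) : ℝ :=
  gauge {y | c + y ∈ K} x

section cg
variable {E : Type*} [NormedAddCommGroup E] [NormedSpace ℝ E] {K : Set E} {c x : E}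

lemma shift_convex (hK : Convex ℝ K) (c : E) : Convex ℝ {y | c + y ∈ K} := by
  have := hK.translate_preimage_right c
  exact this

lemma shift_nhds (hc : c ∈ interior K) : {y | c + y ∈ K} ∈ 𝓝 (0 : E) := by
  have h : ContinuousAt (fun y : E => c + y) 0 := by fun_prop
  apply h
  simpa using mem_interior_iff_mem_nhds.1 hc

lemma shift_closed (hK : IsClosed K) (c : E) : IsClosed {y | c + y ∈ K} :=
  hK.preimage (by fun_prop : Continuous fun y : E => c + y)

lemma shift_interior (c : E) : interior {y | c + y ∈ K} = {y | c + y ∈ interior K} :=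
  ((Homeomorph.addLeft c).preimage_interior K).symm

lemma shift_bounded (hb : Bornology.IsBounded K) (c : E) :
    Bornology.IsBounded {y | c + y ∈ K} := by
  obtain ⟨R, hR⟩ := hb.exists_norm_le
  refine (isBounded_iff_forall_norm_le).2 ⟨R + ‖c‖, fun y hy => ?_⟩
  have := hR _ hy
  have h2 : y = (c + y) - c := by abel
  rw [h2]
  exact (norm_sub_le _ _).trans (by gcongr)

lemma cg_lt_iff (hK : Convex ℝ K) (hc : c ∈ interior K) {t : ℝ} (ht : 0 < t) :
    cg K c x < t ↔ c + t⁻¹ • x ∈ interior K := by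
  have h1 := gauge_lt_one_iff_mem_interior (x := t⁻¹ • x) (shift_convex hK c) (shift_nhds hc)
  rw [shift_interior, gauge_smul_of_nonneg (inv_nonneg.2 ht.le), smul_eq_mul,
    inv_mul_lt_iff₀ ht, mul_one] at h1
  exact h1

lemma cg_le_iff (hK : Convex ℝ K) (hcl : IsClosed K) (hc : c ∈ interior K) {t : ℝ} (ht : 0 < t) :
    cg K c x ≤ t ↔ c + t⁻¹ • x ∈ K := by
  have h1 := gauge_le_one_iff_mem_closure (x := t⁻¹ • x) (shift_convex hK c) (shift_nhds hc)
  rw [(shift_closed hcl c).closure_eq, gauge_smul_of_nonneg (inv_nonneg.2 ht.le), smul_eq_mul,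
    inv_mul_le_iff₀ ht, mul_one] at h1
  exact h1

lemma cg_pos (hb : Bornology.IsBounded K) (hc : c ∈ interior K) (hx : x ≠ 0) : 0 < cg K c x :=
  (gauge_pos (absorbent_nhds_zero (shift_nhds hc))
    ((NormedSpace.isVonNBounded_iff ℝ).2 (shift_bounded hb c))).2 hx

lemma cg_nonneg : 0 ≤ cg K c x := gauge_nonneg _

lemma cg_continuousAt (hK : Convex ℝ K) (hcl : IsClosed K) (hc : c ∈ interior K) :
    ContinuousAt (fun q : E × E => cg K q.1 q.2) (c, x) := by
  have hev : ∀ᶠ q : E × E in 𝓝 (c, x), q.1 ∈ interior K :=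
    continuousAt_fst.eventually (isOpen_interior.mem_nhds hc)
  refine tendsto_order.2 ⟨fun a ha => ?_, fun a ha => ?_⟩
  · rcases lt_or_ge a 0 with h0 | h0
    · exact Eventually.of_forall fun q => h0.trans_le cg_nonneg
    · obtain ⟨t, hat, htg⟩ := exists_between ha
      have ht : 0 < t := h0.trans_lt hat
      have h1 : c + t⁻¹ • x ∈ Kᶜ := fun h => htg.not_ge ((cg_le_iff hK hcl hc ht).2 h)
      have h2 : ContinuousAt (fun q : E × E => q.1 + t⁻¹ • q.2) (c, x) := by fun_prop
      filter_upwards [hev, h2.eventually (hcl.isOpen_compl.mem_nhds h1)] with q hq hq2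
      refine hat.trans ?_
      by_contra! h
      exact hq2 ((cg_le_iff hK hcl hq ht).1 h)
  · have ht : 0 < a := cg_nonneg.trans_lt ha
    have h1 := (cg_lt_iff hK hc ht).1 ha
    have h2 : ContinuousAt (fun q : E × E => q.1 + a⁻¹ • q.2) (c, x) := by fun_prop
    filter_upwards [hev, h2.eventually (isOpen_interior.mem_nhds h1)] with q hq hq2
    exact (cg_lt_iff hK hq ht).2 hq2

lemma gauge_eq_cg : gauge K = cg K 0 := by
  funext x; simp [cg]

/-- the implicit equation for the moving gauge -/
lemma cg_implicit (hK : Convex ℝ K) (hcl : IsClosed K) (hb : Bornology.IsBounded K)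
    (h0 : (0 : E) ∈ interior K) (hc : c ∈ interior K) (hx : x ≠ 0) :
    gauge K (x + cg K c x • c) = cg K c x := by
  have ht := cg_pos hb hc hx
  set t := cg K c x with htd
  have h1 : c + t⁻¹ • x ∈ K := (cg_le_iff hK hcl hc ht).1 le_rfl
  have h2 : c + t⁻¹ • x ∉ interior K := fun h => (lt_irrefl t) ((cg_lt_iff hK hc ht).2 h)
  have h3 : gauge K (c + t⁻¹ • x) = 1 :=
    (gauge_eq_one_iff_mem_frontier hK (mem_interior_iff_mem_nhds.1 h0)).2
      (by rw [frontier, hcl.closure_eq]; exact ⟨h1, h2⟩)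
  have h4 : x + t • c = t • (c + t⁻¹ • x) := by
    rw [smul_add, smul_smul, mul_inv_cancel₀ ht.ne', one_smul, add_comm]
  rw [h4, gauge_smul_of_nonneg ht.le, h3, smul_eq_mul, mul_one]

lemma cg_contDiffAt [CompleteSpace E] (hK : Convex ℝ K) (hcl : IsClosed K)
    (hb : Bornology.IsBounded K)
    (h0 : (0 : E) ∈ interior K) (hc : c ∈ interior K) (hx : x ≠ 0) (k : ℕ)
    (hg : ContDiffOn ℝ k (gauge K) {0}ᶜ) :
    ContDiffAt ℝ k (fun q : E × E => cg K q.1 q.2) (c, x) := by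
  have hcont : ∀ q : E × E, q.1 ∈ interior K → ContinuousAt (fun q : E × E => cg K q.1 q.2) q :=
    fun q hq => cg_continuousAt hK hcl hq
  have hev : ∀ᶠ q : E × E in 𝓝 (c, x), q.1 ∈ interior K :=
    continuousAt_fst.eventually (isOpen_interior.mem_nhds hc)
  have hev2 : ∀ᶠ q : E × E in 𝓝 (c, x), q.2 ≠ 0 :=
    ContinuousAt.eventually_ne (g := fun q : E × E => q.2) continuousAt_snd hx
  rcases Nat.eq_zero_or_pos k with rfl | hk
  · simp only [Nat.cast_zero]
    rw [contDiffAt_zero]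
    refine ⟨_, hev, fun q hq => (hcont q hq).continuousWithinAt⟩
  have hk0 : (k : WithTop ℕ∞) ≠ 0 := by exact_mod_cast hk.ne'
  set t := cg K c x with htd
  have ht : 0 < t := cg_pos hb hc hx
  let f : (E × E) × ℝ → ℝ := fun q => q.2 - gauge K (q.1.2 + q.2 • q.1.1)
  let u : (E × E) × ℝ := ((c, x), t)
  have himp : gauge K (x + t • c) = t := cg_implicit hK hcl hb h0 hc hx
  have hne : x + t • c ≠ 0 := by
    intro h; rw [h, gauge_zero] at himp; exact ht.ne himp
  have hgat : ContDiffAt ℝ k (gauge K) (x + t • c) :=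
    hg.contDiffAt (isOpen_compl_singleton.mem_nhds hne)
  have hf : ContDiffAt ℝ k f u := by
    have h1 : ContDiffAt ℝ k (fun q : (E × E) × ℝ => q.1.2 + q.2 • q.1.1) u := by fun_prop
    exact contDiffAt_snd.sub (ContDiffAt.comp (g := gauge K) u hgat h1)
  have hfu : f u = 0 := by simp [f, u, himp]
  have hgc : gauge K c < 1 :=
    (gauge_lt_one_iff_mem_interior hK (mem_interior_iff_mem_nhds.1 h0)).2 hc
  have hD : 1 - gauge K c ≤ fderiv ℝ f u (0, 1) := by
    have hd : HasFDerivAt f (fderiv ℝ f u) u := (hf.differentiableAt hk0).hasFDerivAt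
    have hl : HasDerivAt (fun s : ℝ => (((c, x), s) : (E × E) × ℝ)) (0, 1) t :=
      (hasDerivAt_const t (c, x)).prodMk (hasDerivAt_id t)
    have hcomp : HasDerivAt (fun s : ℝ => f ((c, x), s)) (fderiv ℝ f u (0, 1)) t :=
      HasFDerivAt.comp_hasDerivAt (f := fun s : ℝ => (((c, x), s) : (E × E) × ℝ)) t hd hl
    have hsl := hcomp.tendsto_slope_zero_right
    refine ge_of_tendsto hsl ?_
    filter_upwards [self_mem_nhdsWithin] with h hh
    have hh : 0 < h := hh
    have hsub := gauge_add_le hK (absorbent_nhds_zero (mem_interior_iff_mem_nhds.1 h0))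
      (x + t • c) (h • c)
    rw [gauge_smul_of_nonneg hh.le, smul_eq_mul] at hsub
    have he : x + (t + h) • c = x + t • c + h • c := by rw [add_smul, add_assoc]
    rw [smul_eq_mul, ← sub_nonneg]
    have : h⁻¹ * (f ((c, x), t + h) - f ((c, x), t)) - (1 - gauge K c)
      = h⁻¹ * (gauge K (x + t • c) + h * gauge K c - gauge K (x + t • c + h • c)) := by
      simp only [f, he]; field_simp; ring
    rw [this]
    exact mul_nonneg (inv_nonneg.2 hh.le) (by linarith)
  have hDpos : 0 < fderiv ℝ f u (0, 1) := by linarith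
  have hinv : (fderiv ℝ f u ∘L .inr ℝ (E × E) ℝ).IsInvertible := by
    have : fderiv ℝ f u ∘L .inr ℝ (E × E) ℝ =
        (ContinuousLinearEquiv.smulLeft (R₁ := ℝ) (Units.mk0 _ hDpos.ne') : ℝ ≃L[ℝ] ℝ) := by
      ext; simp [Units.smul_def]
    rw [this]
    exact ContinuousLinearMap.isInvertible_equiv
  have h1 := hf.contDiffAt_implicitFunction hk0 hinv
  refine h1.congr_of_eventuallyEq ?_
  have h2 := hf.eventually_apply_eq_iff_implicitFunction hk0 hinv
  have h3 : Tendsto (fun q : E × E => ((q, cg K q.1 q.2) : (E × E) × ℝ)) (𝓝 (c, x)) (𝓝 u) :=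
    continuousAt_id.prodMk (hcont (c, x) hc)
  filter_upwards [h3.eventually h2, hev, hev2] with q hq hqc hqx
  refine (hq.1 ?_).symm
  rw [hfu]
  simp only [f]
  rw [cg_implicit hK hcl hb h0 hqc hqx, sub_self]

end cg
end Ulam

set_option linter.unusedSectionVars false
namespace Ulam
open Filter
open scoped Pointwise

/-- smooth cutoff: `1` on `(-∞,1]`, `0` on `[2,∞)`. -/
noncomputable def chi (s : ℝ) : ℝ := Real.smoothTransition (2 - s)

lemma chi_contDiff (n : ℕ∞) : ContDiff ℝ n chi :=
  Real.smoothTransition.contDiff.comp (contDiff_const.sub contDiff_id)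

lemma chi_one {s : ℝ} (h : s ≤ 1) : chi s = 1 :=
  Real.smoothTransition.one_of_one_le (by linarith)

lemma chi_zero {s : ℝ} (h : 2 ≤ s) : chi s = 0 :=
  Real.smoothTransition.zero_of_nonpos (by linarith)

lemma chi_hasDerivAt (s : ℝ) : HasDerivAt chi (deriv chi s) s :=
  ((chi_contDiff 1).differentiable (by simp) s).hasDerivAt

lemma chi_deriv_zero_left {s : ℝ} (h : s < 1) : deriv chi s = 0 := by
  have : chi =ᶠ[𝓝 s] fun _ => 1 := by
    filter_upwards [gt_mem_nhds h] with y hy using chi_one hy.le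
  rw [this.deriv_eq]; simp

lemma chi_deriv_zero_right {s : ℝ} (h : 2 < s) : deriv chi s = 0 := by
  have : chi =ᶠ[𝓝 s] fun _ => 0 := by
    filter_upwards [lt_mem_nhds h] with y hy using chi_zero hy.le
  rw [this.deriv_eq]; simp

lemma chi_deriv_nonpos (s : ℝ) : deriv chi s ≤ 0 := by
  have : Antitone chi := fun a b hab => Real.smoothTransition.monotone (by linarith)
  exact this.deriv_nonpos

lemma chi_deriv_continuous : Continuous (deriv chi) :=
  (chi_contDiff 1).continuous_deriv (by simp)

lemma chi_deriv_compact : HasCompactSupport (deriv chi) := by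
  refine HasCompactSupport.intro (K := Icc 1 2) isCompact_Icc fun x hx => ?_
  rcases lt_or_ge x 1 with h | h
  · exact chi_deriv_zero_left h
  · exact chi_deriv_zero_right (by by_contra! h2; exact hx ⟨h, h2⟩)

lemma chi_deriv_integrable : Integrable (deriv chi) :=
  chi_deriv_continuous.integrable_of_hasCompactSupport chi_deriv_compact

lemma chi_tendsto_top : Tendsto chi atTop (𝓝 0) :=
  tendsto_const_nhds.congr' (by
    filter_upwards [eventually_ge_atTop 2] with x hx using (chi_zero hx).symm)

lemma chi_tendsto_bot : Tendsto chi atBot (𝓝 1) :=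
  tendsto_const_nhds.congr' (by
    filter_upwards [eventually_le_atBot 1] with x hx using (chi_one hx).symm)

lemma chi_integral_Ici (a : ℝ) : ∫ t in Ici a, deriv chi t = - chi a := by
  rw [integral_Ici_eq_integral_Ioi, integral_Ioi_of_hasDerivAt_of_tendsto
    (chi_hasDerivAt a).continuousAt.continuousWithinAt (fun x _ => chi_hasDerivAt x)
    chi_deriv_integrable.integrableOn chi_tendsto_top, zero_sub]

lemma chi_const_ne (N : ℕ) : (∫ t, deriv chi t * t ^ N) ≠ 0 := by
  have h1 : ∫ t, deriv chi t = 0 - 1 := integral_of_hasDerivAt_of_tendsto chi_hasDerivAt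
    chi_deriv_integrable chi_tendsto_bot chi_tendsto_top
  have h2 : ∫ t, deriv chi t * t ^ N ≤ ∫ t, deriv chi t := by
    refine integral_mono ?_ chi_deriv_integrable fun t => ?_
    · exact (chi_deriv_continuous.mul (by fun_prop)).integrable_of_hasCompactSupport
        chi_deriv_compact.mul_right
    · rcases lt_or_ge t 1 with h | h
      · simp [chi_deriv_zero_left h]
      · have := one_le_pow₀ h (n := N)
        have h3 := chi_deriv_nonpos t
        simp only
        nlinarith
  linarith

section moment
variable {P F H : Type*} [NormedAddCommGroup P] [NormedSpace ℝ P]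
  [NormedAddCommGroup F] [NormedSpace ℝ F] [FiniteDimensional ℝ F]
  [MeasurableSpace F] [BorelSpace F] [NormedAddCommGroup H] [NormedSpace ℝ H] [CompleteSpace H]
  (ν : Measure F) [ν.IsAddHaarMeasure]

lemma gauge_le_iff' {S : Set F} (hc : Convex ℝ S) (hcl : IsClosed S) (h0 : (0 : F) ∈ interior S)
    {t : ℝ} (ht : 0 < t) (x : F) : gauge S x ≤ t ↔ t⁻¹ • x ∈ S := by
  rw [gauge_eq_cg, cg_le_iff hc hcl h0 ht, zero_add]

lemma moment_identity {S : Set F} (hc : Convex ℝ S) (hcl : IsClosed S)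
    (h0 : (0 : F) ∈ interior S) {R : ℝ} (hR : S ⊆ closedBall 0 R)
    (Q : F → H) (hQc : Continuous Q) (d : ℕ) (hQ : ∀ t : ℝ, 0 < t → ∀ x, Q (t • x) = t ^ d • Q x) :
    ∫ x, chi (gauge S x) • Q x ∂ν =
      (-∫ t, deriv chi t * t ^ (d + Module.finrank ℝ F)) • ∫ x in S, Q x ∂ν := by
  have hgc : Continuous (gauge S) := continuous_gauge hc (mem_interior_iff_mem_nhds.1 h0)
  let f : F → ℝ → H := fun x t => (Ici (gauge S x)).indicator (fun t => deriv chi t • Q x) t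
  have hset : MeasurableSet {z : F × ℝ | gauge S z.1 ≤ z.2} :=
    measurableSet_le (hgc.measurable.comp measurable_fst) measurable_snd
  have hIntg : Integrable (Function.uncurry f) (ν.prod volume) := by
    have hq : Integrable ((closedBall (0 : F) (2 * R)).indicator Q) ν :=
      (hQc.continuousOn.integrableOn_compact (isCompact_closedBall 0 (2 * R))).integrable_indicator
        measurableSet_closedBall
    have h1 : Integrable (fun z : F × ℝ => deriv chi z.2 • (closedBall (0 : F) (2 * R)).indicator Q z.1)
        (ν.prod volume) := (chi_deriv_integrable.smul_prod hq).swap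
    refine (h1.indicator hset).congr (Eventually.of_forall fun z => ?_)
    obtain ⟨x, t⟩ := z
    by_cases hz : gauge S x ≤ t
    · have hz1 : ((x, t) : F × ℝ) ∈ {z : F × ℝ | gauge S z.1 ≤ z.2} := hz
      have hz2 : t ∈ Ici (gauge S x) := hz
      simp only [Function.uncurry, f]
      rw [indicator_of_mem hz1, indicator_of_mem hz2]
      by_cases hx : x ∈ closedBall (0 : F) (2 * R)
      · rw [indicator_of_mem hx]
      · rw [indicator_of_notMem hx]
        have : 2 < t := by
          by_contra! h2
          have h3 := hR ((gauge_le_iff' hc hcl h0 two_pos x).1 (hz.trans h2))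
          apply hx
          rw [mem_closedBall_zero_iff] at h3 ⊢
          rw [norm_smul, norm_inv, Real.norm_of_nonneg two_pos.le, inv_mul_le_iff₀ two_pos] at h3
          exact h3
        rw [chi_deriv_zero_right this]; simp
    · have hz1 : ((x, t) : F × ℝ) ∉ {z : F × ℝ | gauge S z.1 ≤ z.2} := hz
      have hz2 : t ∉ Ici (gauge S x) := hz
      simp only [Function.uncurry, f]
      rw [indicator_of_notMem hz1, indicator_of_notMem hz2]
  have hsw := integral_integral_swap hIntg
  have hL : ∀ x, ∫ t, f x t = - (chi (gauge S x) • Q x) := by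
    intro x
    simp only [f]
    rw [integral_indicator measurableSet_Ici, integral_smul_const, chi_integral_Ici, neg_smul]
  have hRt : ∀ t, ∫ x, f x t ∂ν = (deriv chi t * t ^ (d + Module.finrank ℝ F)) • ∫ x in S, Q x ∂ν := by
    intro t
    rcases lt_or_ge t 1 with h | h
    · simp only [f, indicator_apply, chi_deriv_zero_left h]; simp
    have ht : 0 < t := by linarith
    have h1 : ∀ x, f x t = deriv chi t • (t • S).indicator Q x := by
      intro x
      have : t ∈ Ici (gauge S x) ↔ x ∈ t • S := by
        rw [mem_smul_set_iff_inv_smul_mem₀ ht.ne', ← gauge_le_iff' hc hcl h0 ht]; rfl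
      simp only [f]
      by_cases hh : x ∈ t • S
      · rw [indicator_of_mem (this.2 hh), indicator_of_mem hh]
      · rw [indicator_of_notMem (fun h => hh (this.1 h)), indicator_of_notMem hh, smul_zero]
    simp_rw [h1]
    rw [integral_smul, integral_indicator (hcl.measurableSet.const_smul₀ t), mul_smul]
    congr 1
    have h2 := Measure.setIntegral_comp_smul_of_pos ν Q S ht
    simp_rw [hQ t ht] at h2
    rw [integral_smul] at h2
    rw [add_comm, pow_add, mul_smul, h2, smul_smul, mul_inv_cancel₀ (by positivity), one_smul]
  simp_rw [hL, hRt] at hsw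
  rw [integral_neg, integral_smul_const] at hsw
  rw [neg_smul, ← hsw, neg_neg]

lemma moment_contDiffOn {U : Set P} (hU : IsOpen U) (S : P → Set F)
    (hc : ∀ p ∈ U, Convex ℝ (S p)) (hcl : ∀ p ∈ U, IsClosed (S p)) {r R : ℝ} (hr : 0 < r)
    (hball : ∀ p ∈ U, ball 0 r ⊆ S p) (hR : ∀ p ∈ U, S p ⊆ closedBall 0 R) (k : ℕ)
    (hg : ContDiffOn ℝ k (fun q : P × F => gauge (S q.1) q.2) (U ×ˢ {0}ᶜ))
    (Q : F → H) (hQc : Continuous Q) (d : ℕ)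
    (hQ : ∀ t : ℝ, 0 < t → ∀ x, Q (t • x) = t ^ d • Q x) :
    ContDiffOn ℝ k (fun p => ∫ x in S p, Q x ∂ν) U := by
  have h0 : ∀ p ∈ U, (0 : F) ∈ interior (S p) := fun p hp =>
    mem_interior_iff_mem_nhds.2 (mem_of_superset (ball_mem_nhds 0 hr) (hball p hp))
  let g : P → F → ℝ := fun p x => chi (gauge (S p) x)
  have hgs : ∀ p, ∀ x, p ∈ U → x ∉ closedBall (0 : F) (2 * R) → g p x = 0 := by
    intro p x hp hx
    refine chi_zero ?_
    by_contra! h2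
    have h3 := hR p hp ((gauge_le_iff' (hc p hp) (hcl p hp) (h0 p hp) two_pos x).1 h2.le)
    apply hx
    rw [mem_closedBall_zero_iff] at h3 ⊢
    rw [norm_smul, norm_inv, Real.norm_of_nonneg two_pos.le, inv_mul_le_iff₀ two_pos] at h3
    exact h3
  have hgd : ContDiffOn ℝ (k : ℕ∞) (Function.HasUncurry.uncurry g) (U ×ˢ univ) := by
    rintro ⟨p, x⟩ ⟨hp, -⟩
    apply ContDiffAt.contDiffWithinAt
    by_cases hx : x = 0
    · subst hx
      have : (Function.HasUncurry.uncurry g) =ᶠ[𝓝 (p, (0 : F))] fun _ => 1 := by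
        have h1 : ∀ᶠ q : P × F in 𝓝 (p, (0 : F)), q.1 ∈ U :=
          continuousAt_fst.eventually (hU.mem_nhds hp)
        have h2 : ∀ᶠ q : P × F in 𝓝 (p, (0 : F)), q.2 ∈ ball (0 : F) r :=
          continuousAt_snd.eventually (ball_mem_nhds 0 hr)
        filter_upwards [h1, h2] with q hq1 hq2
        exact chi_one (gauge_le_one_of_mem (hball _ hq1 hq2))
      exact contDiffAt_const.congr_of_eventuallyEq this
    · have h1 : ContDiffAt ℝ k (fun q : P × F => gauge (S q.1) q.2) (p, x) :=
        hg.contDiffAt ((hU.prod isOpen_compl_singleton).mem_nhds ⟨hp, hx⟩)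
      exact (chi_contDiff k).contDiffAt.comp (p, x) (by exact_mod_cast h1)
  have hconv := contDiffOn_convolution_right_with_param_comp (μ := ν)
    ((ContinuousLinearMap.lsmul ℝ ℝ : ℝ →L[ℝ] H →L[ℝ] H).flip) (v := fun _ : P => (0 : F))
    contDiffOn_const (f := fun x => Q (-x)) (g := g) hU
    (isCompact_closedBall (0 : F) (2 * R)) hgs (hQc.comp continuous_neg).locallyIntegrable hgd
  set C := (-∫ t, deriv chi t * t ^ (d + Module.finrank ℝ F)) with hC
  have hC0 : C ≠ 0 := neg_ne_zero.2 (chi_const_ne _)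
  have := hconv.const_smul (C⁻¹)
  refine ContDiffOn.congr (by exact_mod_cast this) fun p hp => ?_
  have hid := moment_identity ν (hc p hp) (hcl p hp) (h0 p hp) (hR p hp) Q hQc d hQ
  rw [convolution_def]
  have h5 : ∫ t, ((ContinuousLinearMap.lsmul ℝ ℝ : ℝ →L[ℝ] H →L[ℝ] H).flip (Q (-t))) (g p (0 - t)) ∂ν
      = ∫ x, chi (gauge (S p) x) • Q x ∂ν := by
    rw [← integral_neg_eq_self (fun x => chi (gauge (S p) x) • Q x) ν]
    simp [g]
  rw [h5, hid, smul_smul, inv_mul_cancel₀ hC0, one_smul]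

end moment
end Ulam

set_option linter.unusedSectionVars false
namespace Ulam
open Filter

section cap
variable {F H : Type*}
  [NormedAddCommGroup F] [NormedSpace ℝ F] [FiniteDimensional ℝ F]
  [MeasurableSpace F] [BorelSpace F] [NormedAddCommGroup H] [NormedSpace ℝ H] [CompleteSpace H]

/-- evaluation of an affine function at a point, as a functional of the affine function -/
noncomputable def ev (x : F) : ((F →L[ℝ] ℝ) × ℝ) →L[ℝ] ℝ :=
  (ContinuousLinearMap.apply ℝ ℝ x).comp (ContinuousLinearMap.fst ℝ _ _) +
    ContinuousLinearMap.snd ℝ _ _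

@[simp] lemma ev_apply (x : F) (p : (F →L[ℝ] ℝ) × ℝ) : ev x p = p.1 x + p.2 := by
  simp [ev]

lemma ev_continuous : Continuous (ev : F → ((F →L[ℝ] ℝ) × ℝ) →L[ℝ] ℝ) := by
  unfold ev
  exact (((ContinuousLinearMap.apply ℝ ℝ).continuous).clm_comp continuous_const).add continuous_const

lemma ev_norm_le (x : F) : ‖(ev x : ((F →L[ℝ] ℝ) × ℝ) →L[ℝ] ℝ)‖ ≤ ‖x‖ + 1 := by
  refine ContinuousLinearMap.opNorm_le_bound _ (by positivity) fun p => ?_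
  rw [ev_apply]
  calc ‖p.1 x + p.2‖ ≤ ‖p.1 x‖ + ‖p.2‖ := norm_add_le _ _
    _ ≤ ‖p.1‖ * ‖x‖ + ‖p.2‖ := by gcongr; exact p.1.le_opNorm x
    _ ≤ ‖p‖ * ‖x‖ + ‖p‖ := by gcongr; exacts [norm_fst_le p, norm_snd_le p]
    _ = _ := by ring

/-- slice of `K` by a graph -/
def slice (K : Set (F × ℝ)) (p : (F →L[ℝ] ℝ) × ℝ) : Set F := {x | (x, ev x p) ∈ K}

/-- cap of `K` above a graph -/
def cap (K : Set (F × ℝ)) (p : (F →L[ℝ] ℝ) × ℝ) : Set (F × ℝ) := K ∩ {z | ev z.1 p < z.2}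

lemma graph_continuous (p : (F →L[ℝ] ℝ) × ℝ) : Continuous (fun x : F => (x, ev x p)) :=
  continuous_id.prodMk (by simp only [ev_apply]; fun_prop)

lemma graph_comb (p : (F →L[ℝ] ℝ) × ℝ) (a b : ℝ) (hab : a + b = 1) (x y : F) :
    ((a • x + b • y, ev (a • x + b • y) p) : F × ℝ) = a • (x, ev x p) + b • (y, ev y p) := by
  ext
  · simp
  · have : p.2 = (a + b) * p.2 := by rw [hab, one_mul]
    simp only [ev_apply, map_add, map_smul, Prod.snd_add, Prod.smul_snd, smul_eq_mul]
    linear_combination (this)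

lemma slice_convex {K : Set (F × ℝ)} (hK : Convex ℝ K) (p) : Convex ℝ (slice K p) := by
  intro x hx y hy a b ha hb hab
  show ((a • x + b • y, ev (a • x + b • y) p) : F × ℝ) ∈ K
  rw [graph_comb p a b hab]
  exact hK hx hy ha hb hab

lemma slice_closed {K : Set (F × ℝ)} (hK : IsClosed K) (p) : IsClosed (slice K p) :=
  hK.preimage (graph_continuous p)

lemma slice_frontier {K : Set (F × ℝ)} (hK : Convex ℝ K) (hcl : IsClosed K) {p} {x0 : F}
    (h0 : (x0, ev x0 p) ∈ interior K) {x : F} (hx : (x, ev x p) ∈ frontier K) :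
    x ∈ frontier (slice K p) := by
  rw [(slice_closed hcl p).frontier_eq]
  rw [hcl.frontier_eq] at hx
  refine ⟨hx.1, fun hi => hx.2 ?_⟩
  have hc : ContinuousAt (fun ε : ℝ => x + ε • (x - x0)) 0 := by fun_prop
  have h1 : ∀ᶠ ε : ℝ in 𝓝 0, x + ε • (x - x0) ∈ interior (slice K p) :=
    hc.eventually (isOpen_interior.mem_nhds (by simpa using hi))
  have h2 : ∀ᶠ ε : ℝ in 𝓝[>] 0, x + ε • (x - x0) ∈ interior (slice K p) :=
    h1.filter_mono nhdsWithin_le_nhds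
  obtain ⟨ε, hε, hε0⟩ := (h2.and self_mem_nhdsWithin).exists
  have hε0 : 0 < ε := hε0
  set y := x + ε • (x - x0) with hy
  have hyK : (y, ev y p) ∈ K := (interior_subset hε : y ∈ slice K p)
  have hxe : x = (ε / (1 + ε)) • x0 + (1 / (1 + ε)) • y := by
    have h3 : (1 + ε) ≠ 0 := by positivity
    have e : (ε / (1 + ε)) • x0 + (1 / (1 + ε)) • y = ((1 + ε)⁻¹ * (1 + ε)) • x := by
      rw [hy]; module
    rw [e, inv_mul_cancel₀ h3, one_smul]
  have hsum : ε / (1 + ε) + 1 / (1 + ε) = 1 := by field_simp; ring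
  rw [hxe, graph_comb p _ _ hsum]
  exact hK.openSegment_interior_self_subset_interior h0 hyK
    ⟨_, _, by positivity, by positivity, hsum, rfl⟩

variable (ν : Measure F) [ν.IsAddHaarMeasure]

lemma cont_sm {Z : Type*} [NormedAddCommGroup Z] (f : F → Z) (hf : Continuous f) :
    StronglyMeasurable f := hf.stronglyMeasurable

lemma capInt_hasFDerivAt {K : Set (F × ℝ)} (hK : Convex ℝ K) (hcp : IsCompact K)
    (q : F × ℝ → H) (hq : Continuous q) {p : (F →L[ℝ] ℝ) × ℝ} {x0 : F}
    (h0 : (x0, ev x0 p) ∈ interior K) :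
    HasFDerivAt (fun p => ∫ z in cap K p, q z ∂(ν.prod volume))
      (-∫ x in slice K p, (ev x).smulRight (q (x, ev x p)) ∂ν) p := by
  have hcl := hcp.isClosed
  obtain ⟨R, hR⟩ := hcp.isBounded.subset_closedBall (0 : F × ℝ)
  obtain ⟨C, hC⟩ := hcp.exists_bound_of_continuousOn hq.continuousOn
  have hC' : ∀ z, ‖K.indicator q z‖ ≤ max C 0 := by
    intro z
    by_cases hz : z ∈ K
    · rw [indicator_of_mem hz]; exact (hC z hz).trans (le_max_left _ _)
    · rw [indicator_of_notMem hz, norm_zero]; exact le_max_right _ _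
  set C' := max C 0
  have hC'0 : 0 ≤ C' := le_max_right _ _
  have hRz : ∀ x t, (x, t) ∈ K → x ∈ closedBall (0 : F) R ∧ t ∈ closedBall (0 : ℝ) R := by
    intro x t h
    have := hR h
    rw [mem_closedBall_zero_iff] at *
    rw [mem_closedBall_zero_iff]
    exact ⟨(norm_fst_le _).trans this, (norm_snd_le _).trans this⟩
  have hcapm : ∀ p, MeasurableSet (cap K p) := by
    intro p
    refine hcl.measurableSet.inter (measurableSet_lt ?_ measurable_snd)
    exact (continuous_snd.comp ((graph_continuous p).comp continuous_fst)).measurable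
  have hsm : StronglyMeasurable (K.indicator q) :=
    hq.stronglyMeasurable.indicator hcl.measurableSet
  -- inner integrability
  have hin : ∀ x, Integrable (fun t : ℝ => K.indicator q (x, t)) := by
    intro x
    have : Integrable (fun t : ℝ => (closedBall (0 : ℝ) R).indicator (fun _ => C') t) :=
      (integrable_indicator_iff measurableSet_closedBall).2
        (integrableOn_const (by exact (isCompact_closedBall (0 : ℝ) R).measure_lt_top.ne))
    refine this.mono' (hsm.comp_measurable measurable_prodMk_left).aestronglyMeasurable
      (Eventually.of_forall fun t => ?_)
    by_cases ht : t ∈ closedBall (0 : ℝ) R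
    · rw [indicator_of_mem ht]; exact hC' _
    · rw [indicator_of_notMem ht, indicator_of_notMem (fun h => ht (hRz x t h).2), norm_zero]
  let J : ((F →L[ℝ] ℝ) × ℝ) → F → H := fun p x => ∫ t in Ioi (ev x p), K.indicator q (x, t)
  have hJ : ∀ p x, J p x = ∫ t, (cap K p).indicator q (x, t) := by
    intro p x
    simp only [J]
    rw [← integral_indicator measurableSet_Ioi]
    congr 1; ext t
    by_cases h1 : t ∈ Ioi (ev x p)
    · rw [indicator_of_mem h1]
      by_cases h2 : (x, t) ∈ K
      · rw [indicator_of_mem h2, indicator_of_mem (show (x, t) ∈ cap K p from ⟨h2, h1⟩)]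
      · rw [indicator_of_notMem h2, indicator_of_notMem (fun h => h2 h.1)]
    · rw [indicator_of_notMem h1, indicator_of_notMem (fun h => h1 h.2)]
  have hcapi : ∀ p, Integrable ((cap K p).indicator q) (ν.prod volume) := by
    intro p
    refine (integrable_indicator_iff (hcapm p)).2 ?_
    exact (hq.continuousOn.integrableOn_compact hcp).mono_set inter_subset_left
  have hB : ∀ p, ∫ z in cap K p, q z ∂(ν.prod volume) = ∫ x, J p x ∂ν := by
    intro p
    rw [← integral_indicator (hcapm p), integral_prod _ (hcapi p)]
    simp_rw [hJ]
  simp_rw [hB]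
  have hD : -∫ x in slice K p, (ev x).smulRight (q (x, ev x p)) ∂ν =
      ∫ x, -(slice K p).indicator (fun x => (ev x).smulRight (q (x, ev x p))) x ∂ν := by
    rw [integral_neg, integral_indicator (slice_closed hcl p).measurableSet]
  rw [hD]
  have hcont : Continuous fun x : F => (ev x).smulRight (q (x, ev x p)) := by
    have : Continuous fun x : F => q (x, ev x p) := hq.comp (graph_continuous p)
    have h2 := ((ContinuousLinearMap.smulRightL ℝ ((F →L[ℝ] ℝ) × ℝ) H).continuous.comp
      (ev_continuous (F := F))).clm_apply this
    exact h2
  have hdiffint : ∀ x a b, (∫ t in Ioi a, K.indicator q (x, t)) - ∫ t in Ioi b, K.indicator q (x, t)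
      = ∫ t in a..b, K.indicator q (x, t) := by
    intro x a b
    exact sub_eq_of_eq_add (intervalIntegral.integral_interval_add_Ioi (hin x).integrableOn (hin x).integrableOn).symm
  refine And.right (hasFDerivAt_integral_of_dominated_loc_of_lip (𝕜 := ℝ) (s := univ)
    (bound := fun x => (closedBall (0 : F) R).indicator (fun _ => C' * (R + 1)) x)
    univ_mem (Eventually.of_forall fun p => ?_) ?_ ?_ ?_ ?_ ?_)
  · have : J p = fun x => ∫ t, (cap K p).indicator q (x, t) := funext (hJ p)
    rw [this]
    exact ((hq.stronglyMeasurable.indicator (hcapm p)).integral_prod_right').aestronglyMeasurable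
  · have : J p = fun x => ∫ t, (cap K p).indicator q (x, t) := funext (hJ p)
    rw [this]
    exact (hcapi p).integral_prod_left
  · exact (((cont_sm _ hcont).indicator (slice_closed hcl p).measurableSet).neg).aestronglyMeasurable
  · refine Eventually.of_forall fun x => ?_
    refine LipschitzOnWith.of_dist_le_mul fun p1 _ p2 _ => ?_
    rw [dist_eq_norm]
    simp only [J]
    rw [hdiffint]
    by_cases hx : x ∈ closedBall (0 : F) R
    · rw [indicator_of_mem hx]
      have hx' : ‖x‖ ≤ R := mem_closedBall_zero_iff.1 hx
      have hR0 : 0 ≤ R := (norm_nonneg x).trans hx'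
      rw [Real.coe_nnabs, abs_of_nonneg (by positivity)]
      calc _ ≤ C' * |ev x p2 - ev x p1| :=
            intervalIntegral.norm_integral_le_of_norm_le_const fun t _ => hC' _
        _ = C' * ‖ev x (p2 - p1)‖ := by rw [map_sub]; rfl
        _ ≤ C' * ((R + 1) * ‖p2 - p1‖) := by
            gcongr
            exact ((ev x).le_opNorm _).trans (by gcongr; exact (ev_norm_le x).trans (by gcongr))
        _ = _ := by rw [dist_eq_norm, norm_sub_rev]; ring
    · have : ∀ t, K.indicator q (x, t) = 0 := fun t =>
        indicator_of_notMem (fun h => hx (hRz x t h).1) _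
      simp_rw [this]
      simp only [intervalIntegral.integral_zero, norm_zero]
      positivity
  · exact (integrable_indicator_iff measurableSet_closedBall).2
        (integrableOn_const (by exact (isCompact_closedBall (0 : F) R).measure_lt_top.ne))
  · have hae : ∀ᵐ x ∂ν, x ∉ frontier (slice K p) := by
      exact measure_eq_zero_iff_ae_notMem.1 ((slice_convex hK p).addHaar_frontier ν)
    filter_upwards [hae] with x hx
    have hx' : (x, ev x p) ∉ frontier K := fun h => hx (slice_frontier hK hcl h0 h)
    have hca : ContinuousAt (fun t : ℝ => K.indicator q (x, t)) (ev x p) := by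
      have hpc : ContinuousAt (fun t : ℝ => (x, t)) (ev x p) := by fun_prop
      have hqc : ContinuousAt (fun t : ℝ => q (x, t)) (ev x p) := by fun_prop
      by_cases hxK : (x, ev x p) ∈ K
      · have hxi : (x, ev x p) ∈ interior K := by
          by_contra h
          exact hx' (by rw [hcl.frontier_eq]; exact ⟨hxK, h⟩)
        refine hqc.congr ?_
        filter_upwards [hpc.eventually (isOpen_interior.mem_nhds hxi)] with t ht
        rw [indicator_of_mem (interior_subset ht)]
      · refine (continuousAt_const (y := (0 : H))).congr ?_
        filter_upwards [hpc.eventually (hcl.isOpen_compl.mem_nhds hxK)] with t ht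
        rw [indicator_of_notMem ht]
    have hder : HasDerivAt (fun s => ∫ t in Ioi s, K.indicator q (x, t))
        (-K.indicator q (x, ev x p)) (ev x p) := by
      have h1 : HasDerivAt (fun s => ∫ t in (ev x p)..s, K.indicator q (x, t))
          (K.indicator q (x, ev x p)) (ev x p) :=
        intervalIntegral.integral_hasDerivAt_right (by simp)
          (hsm.comp_measurable measurable_prodMk_left).stronglyMeasurableAtFilter hca
      have h2 := (h1.const_sub (∫ t in Ioi (ev x p), K.indicator q (x, t)))
      refine h2.congr_of_eventuallyEq (Eventually.of_forall fun s => ?_)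
      simp only
      rw [← hdiffint]; abel
    have h3 := hder.hasFDerivAt.comp p (ev x).hasFDerivAt
    have h4 : -(slice K p).indicator (fun x => (ev x).smulRight (q (x, ev x p))) x =
        (ContinuousLinearMap.toSpanSingleton ℝ (-K.indicator q (x, (ev x) p))).comp (ev x) := by
      refine ContinuousLinearMap.ext fun dp => ?_
      by_cases hxK : (x, ev x p) ∈ K
      · rw [indicator_of_mem (show x ∈ slice K p from hxK), indicator_of_mem hxK]
        simp
      · rw [indicator_of_notMem (show x ∉ slice K p from hxK), indicator_of_notMem hxK]
        simp
    rw [h4]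
    exact h3

end cap
end Ulam

set_option linter.unusedSectionVars false
namespace Ulam
open Filter

section capD
variable {F : Type*}
  [NormedAddCommGroup F] [NormedSpace ℝ F] [FiniteDimensional ℝ F]
  [MeasurableSpace F] [BorelSpace F] (ν : Measure F) [ν.IsAddHaarMeasure]

/-- first moment and volume of the cap over a graph -/
noncomputable def capB (K : Set (F × ℝ)) (p : (F →L[ℝ] ℝ) × ℝ) : (F × ℝ) × ℝ :=
  ∫ z in cap K p, (z, (1 : ℝ)) ∂(ν.prod volume)

/-- derivative of `capB` -/
noncomputable def capB' (K : Set (F × ℝ)) (p : (F →L[ℝ] ℝ) × ℝ) :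
    ((F →L[ℝ] ℝ) × ℝ) →L[ℝ] (F × ℝ) × ℝ :=
  -∫ x in slice K p, (ev x).smulRight ((x, ev x p), (1 : ℝ)) ∂ν

lemma slice_compact {K : Set (F × ℝ)} (hcp : IsCompact K) (p) : IsCompact (slice K p) := by
  have : slice K p ⊆ Prod.fst '' K := fun x hx => ⟨(x, ev x p), hx, rfl⟩
  exact (hcp.image continuous_fst).of_isClosed_subset (slice_closed hcp.isClosed p) this

lemma capB_hasFDerivAt {K : Set (F × ℝ)} (hK : Convex ℝ K) (hcp : IsCompact K)
    {p : (F →L[ℝ] ℝ) × ℝ} (h0 : ((0 : F), p.2) ∈ interior K) :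
    HasFDerivAt (capB ν K) (capB' ν K p) p :=
  capInt_hasFDerivAt ν hK hcp (fun z => (z, (1 : ℝ))) (by fun_prop) (x0 := 0) (by simpa using h0)

lemma evS_continuous (p : (F →L[ℝ] ℝ) × ℝ) :
    Continuous fun x : F => (ev x).smulRight (((x, ev x p), (1 : ℝ)) : (F × ℝ) × ℝ) := by
  have : Continuous fun x : F => (((x, ev x p), (1 : ℝ)) : (F × ℝ) × ℝ) :=
    (graph_continuous p).prodMk continuous_const
  exact ((ContinuousLinearMap.smulRightL ℝ ((F →L[ℝ] ℝ) × ℝ) ((F × ℝ) × ℝ)).continuous.comp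
      (ev_continuous (F := F))).clm_apply this

lemma clm_setIntegral_apply {X Y : Type*} [NormedAddCommGroup X] [NormedSpace ℝ X]
    [NormedAddCommGroup Y] [NormedSpace ℝ Y] {S : Set F} (hS : IsCompact S)
    (f : F → X →L[ℝ] Y) (hf : Continuous f) (v : X) :
    (∫ x in S, f x ∂ν) v = ∫ x in S, f x v ∂ν :=
  ContinuousLinearMap.integral_apply (hf.continuousOn.integrableOn_compact hS) v

lemma capB'_apply {K : Set (F × ℝ)} (hcp : IsCompact K) (p dp : (F →L[ℝ] ℝ) × ℝ) :
    capB' ν K p dp = -∫ x in slice K p, ev x dp • (((x, ev x p), (1 : ℝ)) : (F × ℝ) × ℝ) ∂ν := by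
  unfold capB'
  rw [neg_apply, clm_setIntegral_apply ν (slice_compact hcp p) _ (evS_continuous p)]
  rfl

lemma gauge_slice (K : Set (F × ℝ)) (p : (F →L[ℝ] ℝ) × ℝ) (x : F) :
    gauge (slice K p) x = cg K (0, p.2) (x, p.1 x) := by
  unfold cg
  rw [gauge_def', gauge_def']
  congr 1
  ext r
  have : r⁻¹ • x ∈ slice K p ↔
      r⁻¹ • (x, p.1 x) ∈ {y : F × ℝ | ((0 : F), p.2) + y ∈ K} := by
    show (r⁻¹ • x, ev (r⁻¹ • x) p) ∈ K ↔ ((0 : F), p.2) + r⁻¹ • (x, p.1 x) ∈ K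
    rw [ev_apply]
    simp [add_comm]
  exact and_congr Iff.rfl this

/-- assembling map -/
noncomputable def asm (p : (F →L[ℝ] ℝ) × ℝ) : (F × ℝ) →L[ℝ] (F × ℝ) × ℝ :=
  ((ContinuousLinearMap.fst ℝ F ℝ).prod (p.1.comp (ContinuousLinearMap.fst ℝ F ℝ) +
    p.2 • ContinuousLinearMap.snd ℝ F ℝ)).prod (ContinuousLinearMap.snd ℝ F ℝ)

lemma capB'_contDiffAt {K : Set (F × ℝ)} (hK : Convex ℝ K) (hcp : IsCompact K)
    (h0 : (0 : F × ℝ) ∈ interior K) (k : ℕ) (hg : ContDiffOn ℝ k (gauge K) {0}ᶜ) :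
    ContDiffAt ℝ k (capB' ν K) 0 := by
  obtain ⟨ε, hε, hεK⟩ := Metric.isOpen_iff.1 isOpen_interior _ h0
  obtain ⟨R, hR⟩ := hcp.isBounded.subset_closedBall (0 : F × ℝ)
  set U : Set ((F →L[ℝ] ℝ) × ℝ) := ball 0 (ε / 2) with hU
  have hUo : IsOpen U := isOpen_ball
  have hin : ∀ p ∈ U, ∀ x ∈ ball (0 : F) (min ε 1), (x, ev x p) ∈ interior K := by
    intro p hp x hx
    apply hεK
    rw [hU, mem_ball_zero_iff] at hp
    rw [mem_ball_zero_iff, lt_min_iff] at hx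
    rw [mem_ball_zero_iff, Prod.norm_mk, max_lt_iff]
    refine ⟨hx.1, ?_⟩
    calc ‖ev x p‖ ≤ (‖x‖ + 1) * ‖p‖ := ((ev x).le_opNorm p).trans (by gcongr; exact ev_norm_le x)
      _ ≤ 2 * ‖p‖ := by gcongr; linarith [hx.2]
      _ < ε := by linarith
  have hball : ∀ p ∈ U, ball (0 : F) (min ε 1) ⊆ slice K p := fun p hp x hx =>
    show (x, ev x p) ∈ K from interior_subset (hin p hp x hx)
  have hRs : ∀ p ∈ U, slice K p ⊆ closedBall (0 : F) R := by
    intro p _ x hx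
    have := hR hx
    rw [mem_closedBall_zero_iff] at *
    exact (norm_fst_le _).trans this
  have hgs : ContDiffOn ℝ k (fun q : ((F →L[ℝ] ℝ) × ℝ) × F => gauge (slice K q.1) q.2)
      (U ×ˢ {0}ᶜ) := by
    rintro ⟨p, x⟩ ⟨hp, hx⟩
    apply ContDiffAt.contDiffWithinAt
    have hx' : x ≠ 0 := hx
    have h1 : ((0 : F), p.2) ∈ interior K := by
      have := hin p hp 0 (mem_ball_self (by positivity)); simpa using this
    have h2 : ((x, p.1 x) : F × ℝ) ≠ 0 := fun h => hx' (congrArg Prod.fst h)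
    have h3 := cg_contDiffAt hK hcp.isClosed hcp.isBounded h0 h1 h2 k hg
    have h4 : ContDiffAt ℝ k (fun q : ((F →L[ℝ] ℝ) × ℝ) × F =>
        ((((0 : F), q.1.2), (q.2, q.1.1 q.2)) : (F × ℝ) × (F × ℝ))) (p, x) := by
      apply ContDiff.contDiffAt
      exact (contDiff_const.prodMk contDiff_fst.snd).prodMk
        (contDiff_snd.prodMk (contDiff_fst.fst.clm_apply contDiff_snd))
    have heq : (fun q : ((F →L[ℝ] ℝ) × ℝ) × F => gauge (slice K q.1) q.2) =
        (fun q : (F × ℝ) × (F × ℝ) => cg K q.1 q.2) ∘ (fun q : ((F →L[ℝ] ℝ) × ℝ) × F =>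
        ((((0 : F), q.1.2), (q.2, q.1.1 q.2)) : (F × ℝ) × (F × ℝ))) :=
      funext fun q => gauge_slice K q.1 q.2
    rw [heq]
    generalize (fun q : (F × ℝ) × (F × ℝ) => cg K q.1 q.2) = G at h3 ⊢
    exact h3.comp (p, x) h4
  have hmom : ∀ (Q : F → F × ℝ), Continuous Q → ∀ d : ℕ,
      (∀ t : ℝ, 0 < t → ∀ x, Q (t • x) = t ^ d • Q x) →
      ContDiffOn ℝ k (fun p => ∫ x in slice K p, Q x ∂ν) U := fun Q hQ d hd =>
    moment_contDiffOn ν hUo (slice K) (fun p _ => slice_convex hK p)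
      (fun p _ => slice_closed hcp.isClosed p) (by positivity) hball hRs k hgs Q hQ d hd
  have hmain : ContDiffOn ℝ k (capB' ν K) U := by
    rw [contDiffOn_clm_apply]
    intro dp
    have m2 := hmom (fun x => dp.1 x • (x, 0)) (by fun_prop) 2 (by
      intro t ht x; ext <;> simp [smul_smul]; ring_nf)
    have m1 := hmom (fun x => dp.1 x • (0, 1) + dp.2 • (x, 0)) (by fun_prop) 1 (by
      intro t ht x; ext <;> simp [smul_smul, mul_comm])
    have m0 := hmom (fun x => dp.2 • (0, 1)) (by fun_prop) 0 (by
      intro t ht x; simp)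
    have hN := (m2.add m1).add m0
    have hA : ContDiffOn ℝ k (fun p => -asm p (((∫ x in slice K p, dp.1 x • ((x, 0) : F × ℝ) ∂ν) +
        ∫ x in slice K p, (dp.1 x • ((0, 1) : F × ℝ) + dp.2 • (x, 0)) ∂ν) +
        ∫ x in slice K p, dp.2 • ((0, 1) : F × ℝ) ∂ν)) U := by
      refine ContDiffOn.neg ?_
      exact (hN.fst.prodMk ((contDiffOn_fst.clm_apply hN.fst).add
        (contDiffOn_snd.mul hN.snd))).prodMk hN.snd
    refine hA.congr fun p hp => ?_
    rw [capB'_apply ν hcp]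
    have hI : ∀ Q : F → F × ℝ, Continuous Q → Integrable Q (ν.restrict (slice K p)) := fun Q hQ =>
      hQ.continuousOn.integrableOn_compact (slice_compact hcp p)
    rw [← integral_add (hI _ (by fun_prop)) (hI _ (by fun_prop)),
      ← integral_add (hI _ (by fun_prop)) (hI _ (by fun_prop)),
      ← ContinuousLinearMap.integral_comp_comm _ (hI _ (by fun_prop))]
    congr 2
    ext x <;> simp [asm, add_smul] <;> ring
  exact hmain.contDiffAt (ball_mem_nhds 0 (by positivity))

lemma capB_contDiffAt {K : Set (F × ℝ)} (hK : Convex ℝ K) (hcp : IsCompact K)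
    (h0 : (0 : F × ℝ) ∈ interior K) (k : ℕ) (hg : ContDiffOn ℝ k (gauge K) {0}ᶜ) :
    ContDiffAt ℝ (k + 1) (capB ν K) 0 := by
  rw [contDiffAt_succ_iff_hasFDerivAt]
  refine ⟨capB' ν K, ⟨{p | ((0 : F), p.2) ∈ interior K}, ?_, fun p hp => ?_⟩,
    capB'_contDiffAt ν hK hcp h0 k hg⟩
  · have : Continuous fun p : (F →L[ℝ] ℝ) × ℝ => ((0 : F), p.2) := by fun_prop
    exact (isOpen_interior.preimage this).mem_nhds h0
  · exact capB_hasFDerivAt ν hK hcp hp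

end capD
end Ulam

set_option linter.unusedSectionVars false
namespace Ulam
open Filter

section capE
variable {F : Type*}
  [NormedAddCommGroup F] [NormedSpace ℝ F] [FiniteDimensional ℝ F]
  [MeasurableSpace F] [BorelSpace F] (ν : Measure F) [ν.IsAddHaarMeasure]

lemma capB'_zero_pair {K : Set (F × ℝ)} (hcp : IsCompact K) (dp : (F →L[ℝ] ℝ) × ℝ)
    (Λ : (F × ℝ) × ℝ →L[ℝ] ℝ) :
    Λ (capB' ν K 0 dp) = -∫ x in slice K 0, ev x dp * Λ ((x, 0), 1) ∂ν := by
  rw [capB'_apply ν hcp, map_neg]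
  have hI : Integrable (fun x : F => ev x dp • (((x, ev x 0), (1 : ℝ)) : (F × ℝ) × ℝ))
      (ν.restrict (slice K 0)) := by
    refine ContinuousOn.integrableOn_compact (slice_compact hcp 0) (Continuous.continuousOn ?_)
    simp only [ev_apply]
    fun_prop
  rw [← ContinuousLinearMap.integral_comp_comm _ hI]
  simp only [map_smul, map_zero, smul_eq_mul]

lemma capB'_zero_snd {K : Set (F × ℝ)} (hcp : IsCompact K) (dp : (F →L[ℝ] ℝ) × ℝ) :
    (capB' ν K 0 dp).1.2 = 0 := by
  have := capB'_zero_pair ν hcp dp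
    ((ContinuousLinearMap.snd ℝ F ℝ).comp (ContinuousLinearMap.fst ℝ (F × ℝ) ℝ))
  simpa using this

lemma capB'_zero_inj {K : Set (F × ℝ)} (hcp : IsCompact K)
    (h0 : (0 : F × ℝ) ∈ interior K) (dp : (F →L[ℝ] ℝ) × ℝ) (h : capB' ν K 0 dp = 0) : dp = 0 := by
  have h1 := capB'_zero_pair ν hcp dp
    ((dp.1.comp (ContinuousLinearMap.fst ℝ F ℝ)).comp (ContinuousLinearMap.fst ℝ (F × ℝ) ℝ) +
      dp.2 • ContinuousLinearMap.snd ℝ (F × ℝ) ℝ)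
  rw [h, map_zero] at h1
  have h2 : ∫ x in slice K 0, ev x dp * ev x dp ∂ν = 0 := by
    have h3 := neg_eq_zero.1 h1.symm
    simpa using h3
  have hc : Continuous fun x : F => ev x dp := by simp only [ev_apply]; fun_prop
  have hI : IntegrableOn (fun x : F => ev x dp * ev x dp) (slice K 0) ν :=
    ContinuousOn.integrableOn_compact (slice_compact hcp 0) (hc.mul hc).continuousOn
  rw [setIntegral_eq_zero_iff_of_nonneg_ae (Eventually.of_forall fun x => mul_self_nonneg _) hI] at h2
  obtain ⟨ε, hε, hεK⟩ := Metric.isOpen_iff.1 isOpen_interior _ h0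
  have hsub : ball (0 : F) ε ⊆ slice K 0 := by
    intro x hx
    show (x, ev x 0) ∈ K
    apply interior_subset
    apply hεK
    rw [mem_ball_zero_iff] at hx ⊢
    simpa [Prod.norm_def] using hx
  have h4 := ae_restrict_of_ae_restrict_of_subset hsub h2
  have h5 := Measure.eqOn_open_of_ae_eq h4 isOpen_ball (hc.mul hc).continuousOn continuousOn_const
  have h6 : ∀ x ∈ ball (0 : F) ε, dp.1 x + dp.2 = 0 := fun x hx => by
    have : ev x dp * ev x dp = 0 := h5 hx
    simpa using this
  have h7 : dp.2 = 0 := by simpa using h6 0 (mem_ball_self hε)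
  refine Prod.ext (ContinuousLinearMap.ext fun x => ?_) h7
  have h8 : ∀ᶠ t : ℝ in 𝓝[>] 0, t • x ∈ ball (0 : F) ε := by
    have : ContinuousAt (fun t : ℝ => t • x) 0 := by fun_prop
    exact (this.eventually (isOpen_ball.mem_nhds (by simpa using hε))).filter_mono
      nhdsWithin_le_nhds
  obtain ⟨t, ht, ht0⟩ := (h8.and self_mem_nhdsWithin).exists
  have ht0 : 0 < t := ht0
  have h9 := h6 _ ht
  rw [h7, add_zero, map_smul, smul_eq_mul] at h9
  simpa using (mul_eq_zero.1 h9).resolve_left ht0.ne'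

lemma local_radial {K : Set (F × ℝ)} (hK : Convex ℝ K) (hcp : IsCompact K)
    (h0 : (0 : F × ℝ) ∈ interior K) (k : ℕ) (hg : ContDiffOn ℝ k (gauge K) {0}ᶜ)
    {c1 : F × ℝ} {δ : ℝ} (hδ : (capB ν K 0).2 = δ) (hpos : c1.2 < (capB ν K 0).1.2) :
    ∃ r : F × ℝ → ℝ, ContDiffAt ℝ (k + 1) r ((capB ν K 0).1 - c1) ∧
      r ((capB ν K 0).1 - c1) = 1 ∧
      ∀ᶠ z in 𝓝 ((capB ν K 0).1 - c1), 0 < r z ∧ ∃ p, capB ν K p = (c1 + (r z)⁻¹ • z, δ) := by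
  set Ψ : ℝ × ((F →L[ℝ] ℝ) × ℝ) → (F × ℝ) × ℝ := fun q => q.1 • (capB ν K q.2 - (c1, δ)) with hΨ
  set z0 := (capB ν K 0).1 - c1 with hz0
  have hB0 : capB ν K 0 - (c1, δ) = (z0, 0) := by ext <;> simp [hz0, hδ]
  have hΨ0 : Ψ (1, 0) = (z0, 0) := by simp only [hΨ]; rw [hB0, one_smul]
  have hsm : ContDiffAt ℝ (k + 1) Ψ (1, 0) := by
    have h1 : ContDiffAt ℝ (k + 1) (fun q : ℝ × ((F →L[ℝ] ℝ) × ℝ) => capB ν K q.2) (1, 0) :=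
      ContDiffAt.comp (g := capB ν K) (1, 0) (capB_contDiffAt ν hK hcp h0 k hg) contDiffAt_snd
    exact contDiffAt_fst.smul (h1.sub contDiffAt_const)
  let D : (ℝ × ((F →L[ℝ] ℝ) × ℝ)) →L[ℝ] (F × ℝ) × ℝ :=
    (ContinuousLinearMap.fst ℝ _ _).smulRight (z0, (0 : ℝ)) +
      (capB' ν K 0).comp (ContinuousLinearMap.snd ℝ _ _)
  have hD : HasFDerivAt Ψ D (1, 0) := by
    have h1 : HasFDerivAt (fun q : ℝ × ((F →L[ℝ] ℝ) × ℝ) => capB ν K q.2 - (c1, δ))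
        ((capB' ν K 0).comp (ContinuousLinearMap.snd ℝ _ _)) (1, 0) := by
      refine HasFDerivAt.sub_const _ ?_
      exact HasFDerivAt.comp (g := capB ν K) ((1, 0) : ℝ × ((F →L[ℝ] ℝ) × ℝ))
        (capB_hasFDerivAt ν hK hcp (p := 0) h0) hasFDerivAt_snd
    have h2 := (hasFDerivAt_fst (𝕜 := ℝ) (p := ((1, 0) : ℝ × ((F →L[ℝ] ℝ) × ℝ)))).smul h1
    refine h2.congr_fderiv ?_
    simp only [D, hB0, one_smul]
    rw [add_comm]
  have hinj : Function.Injective D := by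
    rw [injective_iff_map_eq_zero]
    rintro ⟨dr, dp⟩ h
    have h1 : dr • ((z0, 0) : (F × ℝ) × ℝ) + capB' ν K 0 dp = 0 := h
    have h2 : dr * z0.2 = 0 := by
      have := congrArg (fun v => v.1.2) h1
      simpa [capB'_zero_snd ν hcp dp] using this
    have hz : 0 < z0.2 := by simp only [hz0, Prod.snd_sub]; linarith
    have h3 : dr = 0 := (mul_eq_zero.1 h2).resolve_right hz.ne'
    rw [h3, zero_smul, zero_add] at h1
    rw [h3, capB'_zero_inj ν hcp h0 dp h1]; rfl
  have hfr : Module.finrank ℝ (ℝ × ((F →L[ℝ] ℝ) × ℝ)) = Module.finrank ℝ ((F × ℝ) × ℝ) := by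
    have : Module.finrank ℝ (F →L[ℝ] ℝ) = Module.finrank ℝ F := by
      rw [← (LinearMap.toContinuousLinearMap (𝕜 := ℝ) (E := F) (F' := ℝ)).finrank_eq]
      exact Subspace.dual_finrank_eq
    simp only [Module.finrank_prod, Module.finrank_self, this]; ring
  let De : (ℝ × ((F →L[ℝ] ℝ) × ℝ)) ≃L[ℝ] (F × ℝ) × ℝ :=
    (LinearEquiv.ofInjectiveOfFinrankEq D.toLinearMap hinj hfr).toContinuousLinearEquiv
  have hDe : HasFDerivAt Ψ (De : (ℝ × ((F →L[ℝ] ℝ) × ℝ)) →L[ℝ] (F × ℝ) × ℝ) (1, 0) := by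
    refine hD.congr_fderiv ?_
    exact ContinuousLinearMap.ext fun v => rfl
  have hn : ((k : WithTop ℕ∞) + 1) ≠ 0 := by simp
  let I := hsm.localInverse hDe hn
  have hI : ContDiffAt ℝ (k + 1) I (Ψ (1, 0)) := hsm.to_localInverse hDe hn
  have hI0 : I (Ψ (1, 0)) = (1, 0) := hsm.localInverse_apply_image hDe hn
  have hIr : ∀ᶠ y in 𝓝 (Ψ (1, 0)), Ψ (I y) = y :=
    (hsm.hasStrictFDerivAt' hDe hn).eventually_right_inverse
  rw [hΨ0] at hI hI0 hIr
  have hJ : ContDiff ℝ (k + 1) (fun z : F × ℝ => (z, (0 : ℝ))) := by fun_prop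
  have hr : ContDiffAt ℝ (k + 1) (fun z : F × ℝ => (I (z, 0)).1) z0 :=
    (ContDiffAt.comp (g := I) z0 hI hJ.contDiffAt).fst
  refine ⟨fun z => (I (z, 0)).1, hr, by simp [hI0], ?_⟩
  have e1 : ∀ᶠ z in 𝓝 z0, 0 < (I (z, 0)).1 :=
    hr.continuousAt.eventually (lt_mem_nhds (by simp [hI0]))
  have e2 : ∀ᶠ z in 𝓝 z0, Ψ (I (z, 0)) = (z, 0) :=
    hJ.continuous.continuousAt.eventually hIr
  filter_upwards [e1, e2] with z hz1 hz2
  refine ⟨hz1, (I (z, 0)).2, ?_⟩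
  simp only [hΨ] at hz2
  have h3 : capB ν K (I (z, 0)).2 - (c1, δ) = ((I (z, 0)).1)⁻¹ • (z, 0) := by
    have h4 := congrArg (fun v => ((I (z, 0)).1)⁻¹ • v) hz2
    simp only [smul_smul] at h4
    rwa [inv_mul_cancel₀ hz1.ne', one_smul] at h4
  rw [sub_eq_iff_eq_add.1 h3]
  ext <;> simp [add_comm]

end capE
end Ulam

set_option linter.unusedSectionVars false
namespace Ulam
open Filter

section MMsec
variable {E : Type*} [NormedAddCommGroup E] [NormedSpace ℝ E] [FiniteDimensional ℝ E]
  [MeasurableSpace E] [BorelSpace E] (μ : Measure E) [μ.IsAddHaarMeasure]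

/-- admissible densities -/
def Adm (K : Set E) (δ : ℝ) (f : E → ℝ) : Prop :=
  (∀ y, 0 ≤ f y ∧ f y ≤ 1) ∧ IntegrableOn f K μ ∧ ∫ y in K, f y ∂μ = δ

/-- the Ulam floating body, normalised version -/
def MM (K : Set E) (δ : ℝ) : Set E :=
  {z | ∃ f, Adm μ K δ f ∧ z = (1 / δ) • ∫ y in K, f y • y ∂μ}

variable {K : Set E}

lemma integrable_smul_id {K : Set E} (hcp : IsCompact K) {f : E → ℝ} (hf : IntegrableOn f K μ) :
    IntegrableOn (fun y => f y • y) K μ :=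
  hf.smul_continuousOn continuousOn_id hcp

lemma integrable_mul_cont {K : Set E} (hcp : IsCompact K) {f g : E → ℝ} (hf : IntegrableOn f K μ)
    (hg : Continuous g) : IntegrableOn (fun y => f y * g y) K μ :=
  hf.smul_continuousOn hg.continuousOn hcp

lemma MM_convex (hcp : IsCompact K) (δ : ℝ) : Convex ℝ (MM μ K δ) := by
  rintro z ⟨f, ⟨hf1, hf2, hf3⟩, rfl⟩ z' ⟨g, ⟨hg1, hg2, hg3⟩, rfl⟩ a b ha hb hab
  have hb' : b = 1 - a := by linarith
  refine ⟨fun y => a * f y + b * g y, ⟨fun y => ⟨?_, ?_⟩, ?_, ?_⟩, ?_⟩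
  · have := (hf1 y).1; have := (hg1 y).1; positivity
  · have := (hf1 y).2; have := (hg1 y).2; nlinarith
  · exact (hf2.const_mul a).add (hg2.const_mul b)
  · rw [integral_add (hf2.const_mul a) (hg2.const_mul b), integral_const_mul, integral_const_mul,
      hf3, hg3, ← add_mul, hab, one_mul]
  · have h1 := integrable_smul_id μ hcp hf2
    have h2 := integrable_smul_id μ hcp hg2
    have : ∀ y, (a * f y + b * g y) • y = a • (f y • y) + b • (g y • y) := by
      intro y; module
    simp_rw [this]
    have h1s : IntegrableOn (fun y => a • f y • y) K μ := h1.smul a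
    have h2s : IntegrableOn (fun y => b • g y • y) K μ := h2.smul b
    rw [integral_add h1s h2s, integral_smul, integral_smul]
    module

lemma MM_bounded (hcp : IsCompact K) {δ : ℝ} (hδ : 0 < δ) : Bornology.IsBounded (MM μ K δ) := by
  obtain ⟨R, hR⟩ := hcp.isBounded.subset_closedBall (0 : E)
  refine (Metric.isBounded_closedBall (x := (0 : E)) (r := (1 / δ) * (δ * R))).subset ?_
  rintro z ⟨f, ⟨hf1, hf2, hf3⟩, rfl⟩
  rw [mem_closedBall_zero_iff, norm_smul, Real.norm_of_nonneg (by positivity)]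
  gcongr
  rw [← hf3, ← integral_mul_const]
  refine norm_integral_le_of_norm_le (hf2.mul_const R) ?_
  filter_upwards [ae_restrict_mem hcp.measurableSet] with y hy
  rw [norm_smul, Real.norm_of_nonneg (hf1 y).1]
  have := mem_closedBall_zero_iff.1 (hR hy)
  have := (hf1 y).1
  gcongr

lemma level_null {φ : E →L[ℝ] ℝ} (hφ : φ ≠ 0) (s : ℝ) : μ {x | φ x = s} = 0 := by
  obtain ⟨e, he⟩ : ∃ e, φ e ≠ 0 := by
    by_contra! h; exact hφ (ContinuousLinearMap.ext h)
  have h1 : {x | φ x = s} = (fun x => (-((s / φ e) • e)) + x) ⁻¹' (φ.toLinearMap.ker : Set E) := by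
    ext x
    simp [he]
    constructor <;> intro h <;> linarith
  rw [h1, measure_preimage_add]
  apply Measure.addHaar_submodule
  intro h
  rw [LinearMap.ker_eq_top] at h
  exact hφ (ContinuousLinearMap.ext fun x => by
    have := congrArg (fun f => f x) h; simpa using this)

/-- volume of the cap -/
noncomputable def capV (K : Set E) (φ : E →L[ℝ] ℝ) (s : ℝ) : ℝ := μ.real (K ∩ {x | s < φ x})

lemma capset_meas (hcp : IsCompact K) (φ : E →L[ℝ] ℝ) (s : ℝ) :
    MeasurableSet (K ∩ {x | s < φ x}) :=
  hcp.measurableSet.inter (measurableSet_lt measurable_const φ.continuous.measurable)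

lemma capV_eq (_hcp : IsCompact K) (φ : E →L[ℝ] ℝ) (s : ℝ) :
    capV μ K φ s = ∫ x in K, ({x | s < φ x}).indicator (fun _ => (1 : ℝ)) x ∂μ := by
  have hm : MeasurableSet {x | s < φ x} := measurableSet_lt measurable_const φ.continuous.measurable
  rw [setIntegral_indicator hm, setIntegral_const, smul_eq_mul, mul_one]
  rfl

lemma capV_continuous (hcp : IsCompact K) {φ : E →L[ℝ] ℝ} (hφ : φ ≠ 0) :
    Continuous (capV μ K φ) := by
  rw [continuous_iff_continuousAt]
  intro s
  have : capV μ K φ = fun s => ∫ x in K, ({x | s < φ x}).indicator (fun _ => (1 : ℝ)) x ∂μ :=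
    funext (capV_eq μ hcp φ)
  rw [this]
  refine continuousAt_of_dominated (bound := fun _ => 1) (Eventually.of_forall fun t => ?_)
    (Eventually.of_forall fun t => Eventually.of_forall fun x => ?_) ?_ ?_
  · exact ((measurable_const.indicator
      (measurableSet_lt measurable_const φ.continuous.measurable))).aestronglyMeasurable
  · rw [norm_indicator_eq_indicator_norm]
    refine indicator_le_self' (fun _ _ => by positivity) x |>.trans (by simp)
  · exact integrableOn_const (by exact hcp.measure_lt_top.ne)
  · have h1 : ∀ᵐ x ∂μ, x ∉ {x | φ x = s} := measure_eq_zero_iff_ae_notMem.1 (level_null μ hφ s)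
    filter_upwards [ae_restrict_of_ae h1] with x hx
    have hx : φ x ≠ s := hx
    rcases lt_or_gt_of_ne hx with h | h
    · refine (continuousAt_const (y := (0 : ℝ))).congr ?_
      filter_upwards [lt_mem_nhds h] with t ht
      rw [indicator_of_notMem]
      exact fun h' : t < φ x => lt_asymm h' ht
    · refine (continuousAt_const (y := (1 : ℝ))).congr ?_
      filter_upwards [gt_mem_nhds h] with t ht
      rw [indicator_of_mem]
      exact ht

lemma exists_cap (hcp : IsCompact K) {φ : E →L[ℝ] ℝ} (hφ : φ ≠ 0) {δ : ℝ} (h0 : 0 < δ)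
    (h1 : δ < μ.real K) : ∃ s, capV μ K φ s = δ := by
  obtain ⟨R, hR⟩ := hcp.exists_bound_of_continuousOn φ.continuous.continuousOn
  have hlo : capV μ K φ (-R - 1) = μ.real K := by
    unfold capV
    congr 1
    refine inter_eq_left.2 fun x hx => ?_
    have := neg_le_of_abs_le (hR x hx)
    show -R - 1 < φ x
    linarith
  have hhi : capV μ K φ R = 0 := by
    unfold capV
    have : K ∩ {x | R < φ x} = ∅ := by
      refine eq_empty_of_forall_notMem fun x hx => ?_
      have h1 := le_of_abs_le (hR x hx.1)
      have h2 : R < φ x := hx.2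
      linarith
    rw [this]; simp
  have := mem_range_of_exists_le_of_exists_ge (capV_continuous μ hcp hφ) (c := δ)
    ⟨R, by rw [hhi]; exact h0.le⟩ ⟨-R - 1, by rw [hlo]; exact h1.le⟩
  exact this

/-- barycenter of the cap -/
noncomputable def capb (K : Set E) (φ : E →L[ℝ] ℝ) (s δ : ℝ) : E :=
  (1 / δ) • ∫ x in K ∩ {x | s < φ x}, x ∂μ

lemma ind_adm (hcp : IsCompact K) {φ : E →L[ℝ] ℝ} {s δ : ℝ} (h : capV μ K φ s = δ) :
    Adm μ K δ (({x | s < φ x}).indicator (fun _ => (1 : ℝ))) := by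
  have hm : MeasurableSet {x | s < φ x} := measurableSet_lt measurable_const φ.continuous.measurable
  refine ⟨fun y => ?_, ?_, ?_⟩
  · by_cases hy : y ∈ {x | s < φ x}
    · rw [indicator_of_mem hy]; simp
    · rw [indicator_of_notMem hy]; simp
  · exact (integrableOn_const (by exact hcp.measure_lt_top.ne)).indicator hm
  · rw [← capV_eq μ hcp, h]

lemma ind_bary (_hcp : IsCompact K) (φ : E →L[ℝ] ℝ) (s : ℝ) :
    ∫ y in K, ({x | s < φ x}).indicator (fun _ => (1 : ℝ)) y • y ∂μ =
      ∫ x in K ∩ {x | s < φ x}, x ∂μ := by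
  have hm : MeasurableSet {x | s < φ x} := measurableSet_lt measurable_const φ.continuous.measurable
  rw [← setIntegral_indicator hm]
  congr 1; ext y
  by_cases hy : y ∈ {x | s < φ x}
  · rw [indicator_of_mem hy, indicator_of_mem hy, one_smul]
  · rw [indicator_of_notMem hy, indicator_of_notMem hy, zero_smul]

lemma capb_mem (hcp : IsCompact K) {φ : E →L[ℝ] ℝ} {s δ : ℝ} (h : capV μ K φ s = δ) :
    capb μ K φ s δ ∈ MM μ K δ :=
  ⟨_, ind_adm μ hcp h, by rw [ind_bary μ hcp]; rfl⟩

/-- pairing identity -/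
lemma pair_id (hcp : IsCompact K) {φ : E →L[ℝ] ℝ} {s δ : ℝ} (hδ : 0 < δ) (h : capV μ K φ s = δ)
    {f : E → ℝ} (hf : Adm μ K δ f) :
    ∫ y in K, (({x | s < φ x}).indicator (fun _ => (1 : ℝ)) y - f y) * (φ y - s) ∂μ =
      δ * (φ (capb μ K φ s δ) - φ ((1 / δ) • ∫ y in K, f y • y ∂μ)) := by
  have hg := ind_adm μ hcp h
  unfold capb
  rw [← ind_bary μ hcp]
  set g := ({x | s < φ x}).indicator (fun _ => (1 : ℝ))
  have hp : ∀ f : E → ℝ, Adm μ K δ f → IntegrableOn (fun y => f y * φ y) K μ ∧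
      ∫ y in K, f y * φ y ∂μ = δ * φ ((1 / δ) • ∫ y in K, f y • y ∂μ) := by
    intro f hf
    refine ⟨integrable_mul_cont μ hcp hf.2.1 φ.continuous, ?_⟩
    rw [map_smul, ← ContinuousLinearMap.integral_comp_comm _ (integrable_smul_id μ hcp hf.2.1)]
    simp only [map_smul, smul_eq_mul]
    field_simp
  obtain ⟨i1, e1⟩ := hp f hf
  obtain ⟨i2, e2⟩ := hp g hg
  have : ∀ y, (g y - f y) * (φ y - s) = (g y * φ y - f y * φ y) - s * (g y - f y) := by
    intro y; ring
  simp_rw [this]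
  have i3 : IntegrableOn (fun y => g y * φ y - f y * φ y) K μ := i2.sub i1
  have i4 : IntegrableOn (fun y => s * (g y - f y)) K μ := (hg.2.1.sub hf.2.1).const_mul s
  rw [integral_sub i3 i4, integral_const_mul,
    integral_sub i2 i1, integral_sub hg.2.1 hf.2.1, e1, e2, hg.2.2, hf.2.2]
  ring

lemma ind_sign {φ : E →L[ℝ] ℝ} {s : ℝ} {f : E → ℝ} (hf : ∀ y, 0 ≤ f y ∧ f y ≤ 1) (y : E) :
    (({x | s < φ x}).indicator (fun _ => (1 : ℝ)) y - f y) * (φ y - s) =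
      |({x | s < φ x}).indicator (fun _ => (1 : ℝ)) y - f y| * |φ y - s| := by
  by_cases hy : s < φ y
  · rw [indicator_of_mem (show y ∈ {x | s < φ x} from hy), abs_of_nonneg (by linarith [(hf y).2]),
      abs_of_nonneg (by linarith)]
  · rw [indicator_of_notMem (show y ∉ {x | s < φ x} from hy),
      abs_of_nonpos (by linarith [(hf y).1]), abs_of_nonpos (by linarith)]
    ring

lemma MM_le (hcp : IsCompact K) {φ : E →L[ℝ] ℝ} {s δ : ℝ} (hδ : 0 < δ) (h : capV μ K φ s = δ)
    {z : E} (hz : z ∈ MM μ K δ) : φ z ≤ φ (capb μ K φ s δ) := by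
  obtain ⟨f, hf, rfl⟩ := hz
  have h1 := pair_id μ hcp hδ h hf
  have h2 : 0 ≤ ∫ y in K, (({x | s < φ x}).indicator (fun _ => (1 : ℝ)) y - f y) * (φ y - s) ∂μ :=
    integral_nonneg fun y => by
      show (0 : ℝ) ≤ _
      rw [ind_sign hf.1]; positivity
  rw [h1] at h2
  linarith [nonneg_of_mul_nonneg_right h2 hδ]

lemma MM_quant (hcp : IsCompact K) {R : ℝ} (hR : K ⊆ closedBall 0 R) {φ : E →L[ℝ] ℝ} {s δ : ℝ}
    (hδ : 0 < δ) (h : capV μ K φ s = δ) {z : E} (hz : z ∈ MM μ K δ) {η : ℝ} (hη : 0 < η) :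
    δ * ‖capb μ K φ s δ - z‖ ≤ ((capV μ K φ (s - η) - capV μ K φ (s + η)) +
      δ * (φ (capb μ K φ s δ) - φ z) / η) * R := by
  obtain ⟨f, hf, rfl⟩ := hz
  have h1 := pair_id μ hcp hδ h hf
  have hg := ind_adm μ hcp h
  rw [← h1]
  have hb : capb μ K φ s δ = (1 / δ) • ∫ y in K, ({x | s < φ x}).indicator (fun _ => (1 : ℝ)) y • y ∂μ := by
    unfold capb; rw [ind_bary μ hcp]
  rw [hb, ← smul_sub, norm_smul, Real.norm_of_nonneg (by positivity), ← mul_assoc,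
    mul_one_div_cancel hδ.ne', one_mul,
    ← integral_sub (integrable_smul_id μ hcp hg.2.1) (integrable_smul_id μ hcp hf.2.1),
    capV_eq μ hcp, capV_eq μ hcp]
  have hm : ∀ t, MeasurableSet {x | t < φ x} := fun t =>
    measurableSet_lt measurable_const φ.continuous.measurable
  have hi : ∀ t, IntegrableOn (({x | t < φ x}).indicator (fun _ => (1 : ℝ))) K μ := fun t =>
    (integrableOn_const (by exact hcp.measure_lt_top.ne)).indicator (hm t)
  have i1 : IntegrableOn (fun y => ({x | s - η < φ x}).indicator (fun _ => (1 : ℝ)) y -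
      ({x | s + η < φ x}).indicator (fun _ => (1 : ℝ)) y) K μ := (hi _).sub (hi _)
  have i2 : IntegrableOn (fun y => (({x | s < φ x}).indicator (fun _ => (1 : ℝ)) y - f y) * (φ y - s) / η)
      K μ := (integrable_mul_cont μ hcp (hg.2.1.sub hf.2.1) (g := fun y => φ y - s)
        (by fun_prop)).div_const η
  rw [← integral_sub (hi _) (hi _), ← integral_div, ← integral_add i1 i2, ← integral_mul_const]
  refine norm_integral_le_of_norm_le ((i1.add i2).mul_const R) ?_
  filter_upwards [ae_restrict_mem hcp.measurableSet] with y hy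
  have hyR := mem_closedBall_zero_iff.1 (hR hy)
  have hR0 : 0 ≤ R := (norm_nonneg y).trans hyR
  rw [← sub_smul, norm_smul, ind_sign hf.1, Real.norm_eq_abs]
  have hf1 := (hf.1 y).1
  have hf2 := (hf.1 y).2
  refine mul_le_mul ?_ hyR (norm_nonneg _) ?_
  all_goals
    have hnn : 0 ≤ |({x | s < φ x}).indicator (fun _ => (1 : ℝ)) y - f y| := abs_nonneg _
    have hle : |({x | s < φ x}).indicator (fun _ => (1 : ℝ)) y - f y| ≤ 1 := by
      rw [abs_le]
      have := (hg.1 y).1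
      have := (hg.1 y).2
      constructor <;> linarith
    generalize |({x | s < φ x}).indicator (fun _ => (1 : ℝ)) y - f y| = a at *
    by_cases c1 : s - η < φ y
    · rw [indicator_of_mem (show y ∈ {x | s - η < φ x} from c1)]
      by_cases c2 : s + η < φ y
      · rw [indicator_of_mem (show y ∈ {x | s + η < φ x} from c2)]
        have : η ≤ |φ y - s| := by rw [abs_of_nonneg] <;> linarith
        first
        | rw [sub_self, zero_add, le_div_iff₀ hη]; gcongr
        | positivity
      · rw [indicator_of_notMem (show y ∉ {x | s + η < φ x} from c2)]
        have : 0 ≤ a * |φ y - s| / η := by positivity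
        linarith
    · rw [indicator_of_notMem (show y ∉ {x | s - η < φ x} from c1),
        indicator_of_notMem (show y ∉ {x | s + η < φ x} from fun h : s + η < φ y => c1 (by linarith))]
      have : η ≤ |φ y - s| := by rw [abs_of_nonpos] <;> linarith
      first
      | rw [sub_self, zero_add, le_div_iff₀ hη]; gcongr
      | positivity

lemma MM_unique (hcp : IsCompact K) {φ : E →L[ℝ] ℝ} (hφ : φ ≠ 0) {s δ : ℝ}
    (hδ : 0 < δ) (h : capV μ K φ s = δ) {z : E} (hz : z ∈ closure (MM μ K δ))
    (hmax : φ (capb μ K φ s δ) ≤ φ z) : z = capb μ K φ s δ := by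
  obtain ⟨R0, hR0⟩ := hcp.isBounded.subset_closedBall (0 : E)
  obtain ⟨R, hRpos, hR⟩ : ∃ R : ℝ, 0 ≤ R ∧ K ⊆ closedBall 0 R :=
    ⟨max R0 0, le_max_right _ _, hR0.trans (closedBall_subset_closedBall (le_max_left _ _))⟩
  have h1 : ∀ η : ℝ, 0 < η → δ * ‖capb μ K φ s δ - z‖ ≤
      (capV μ K φ (s - η) - capV μ K φ (s + η)) * R := by
    intro η hη
    have hcl : IsClosed {z | δ * ‖capb μ K φ s δ - z‖ ≤ ((capV μ K φ (s - η) - capV μ K φ (s + η)) +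
      δ * (φ (capb μ K φ s δ) - φ z) / η) * R} :=
      isClosed_le (by fun_prop) (by fun_prop)
    have h2 : δ * ‖capb μ K φ s δ - z‖ ≤ ((capV μ K φ (s - η) - capV μ K φ (s + η)) +
      δ * (φ (capb μ K φ s δ) - φ z) / η) * R :=
      closure_minimal (fun z hz => MM_quant μ hcp hR hδ h hz hη) hcl hz
    refine h2.trans ?_
    gcongr
    have : δ * (φ (capb μ K φ s δ) - φ z) / η ≤ 0 :=
      div_nonpos_of_nonpos_of_nonneg (mul_nonpos_of_nonneg_of_nonpos hδ.le (by linarith)) hη.le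
    linarith
  have hc := capV_continuous μ hcp hφ
  have h3 : Tendsto (fun η : ℝ => (capV μ K φ (s - η) - capV μ K φ (s + η)) * R) (𝓝[>] 0) (𝓝 0) := by
    have : Continuous (fun η : ℝ => (capV μ K φ (s - η) - capV μ K φ (s + η)) * R) := by fun_prop
    have h4 := this.tendsto 0
    simp only [sub_zero, add_zero, sub_self, zero_mul] at h4
    exact h4.mono_left nhdsWithin_le_nhds
  have h5 : δ * ‖capb μ K φ s δ - z‖ ≤ 0 :=
    ge_of_tendsto h3 (by filter_upwards [self_mem_nhdsWithin] with η hη using h1 η hη)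
  have h6 : ‖capb μ K φ s δ - z‖ ≤ 0 := by
    by_contra! h7
    have := mul_pos hδ h7
    linarith
  exact (sub_eq_zero.1 (norm_le_zero_iff.1 h6)).symm

lemma exists_interior_level (hK : Convex ℝ K) (hcp : IsCompact K) (hKi : (interior K).Nonempty)
    {φ : E →L[ℝ] ℝ} (hφ : φ ≠ 0) {s δ : ℝ} (hδ : 0 < δ) (h1 : δ < μ.real K)
    (h : capV μ K φ s = δ) : ∃ c ∈ interior K, φ c = s := by
  have hcl : K ⊆ closure (interior K) := by
    rw [hK.closure_interior_eq_closure_of_nonempty_interior hKi]; exact subset_closure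
  obtain ⟨x, hxK, hx⟩ : ∃ x ∈ K, s < φ x := by
    by_contra! hh
    have : K ∩ {x | s < φ x} = ∅ := eq_empty_of_forall_notMem fun x hx =>
      not_lt.2 (hh x hx.1) hx.2
    unfold capV at h
    rw [this] at h
    simp at h
    linarith
  obtain ⟨y, hyK, hy⟩ : ∃ y ∈ K, φ y < s := by
    by_contra! hh
    have hsub : K ⊆ (K ∩ {x | s < φ x}) ∪ {x | φ x = s} := by
      intro x hx
      rcases (hh x hx).lt_or_eq with h' | h'
      · exact Or.inl ⟨hx, h'⟩
      · exact Or.inr h'.symm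
    have h2 : μ K ≤ μ (K ∩ {x | s < φ x}) := by
      calc μ K ≤ _ := measure_mono hsub
        _ ≤ _ := measure_union_le _ _
        _ = _ := by rw [level_null μ hφ, add_zero]
    have h3 : μ.real K ≤ capV μ K φ s :=
      ENNReal.toReal_mono ((measure_mono inter_subset_left).trans_lt hcp.measure_lt_top).ne h2
    linarith
  obtain ⟨x1, hx1, hx1i⟩ := mem_closure_iff.1 (hcl hxK) {x | s < φ x}
    (isOpen_lt continuous_const φ.continuous) hx
  obtain ⟨y1, hy1, hy1i⟩ := mem_closure_iff.1 (hcl hyK) {x | φ x < s}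
    (isOpen_lt φ.continuous continuous_const) hy
  have := hK.interior.isPreconnected.intermediate_value hy1i hx1i φ.continuous.continuousOn
  obtain ⟨c, hc, hcs⟩ := this ⟨le_of_lt hy1, le_of_lt hx1⟩
  exact ⟨c, hc, hcs⟩

lemma MM_interior (hcp : IsCompact K) (hKi : (interior K).Nonempty) {δ : ℝ} (hδ : 0 < δ)
    (h1 : δ < μ.real K) : (interior (MM μ K δ)).Nonempty := by
  set V := μ.real K with hV
  have hV0 : 0 < V := hδ.trans h1
  set bar : E := (1 / V) • ∫ y in K, y ∂μ with hbar
  have hI : ∀ f : E → E, Continuous f → IntegrableOn f K μ :=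
    fun f hf => hf.continuousOn.integrableOn_compact hcp
  have hIr : ∀ f : E → ℝ, Continuous f → IntegrableOn f K μ :=
    fun f hf => hf.continuousOn.integrableOn_compact hcp
  let T : (E →L[ℝ] ℝ) →ₗ[ℝ] E :=
    { toFun := fun u => ∫ y in K, u (y - bar) • y ∂μ
      map_add' := by
        intro u v
        rw [← integral_add (hI _ (by fun_prop)) (hI _ (by fun_prop))]
        simp only [add_apply, add_smul]
      map_smul' := by
        intro c u
        rw [RingHom.id_apply, ← integral_smul]
        simp only [smul_apply, smul_assoc] }
  have hT : ∀ u, T u = ∫ y in K, u (y - bar) • y ∂μ := fun u => rfl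
  have hz : ∀ u : E →L[ℝ] ℝ, ∫ y in K, u (y - bar) ∂μ = 0 := by
    intro u
    rw [ContinuousLinearMap.integral_comp_comm _ (hI _ (by fun_prop)),
      integral_sub (hI _ (by fun_prop)) (hI _ (by fun_prop)), setIntegral_const, hbar, smul_smul,
      ← hV, mul_one_div_cancel hV0.ne', one_smul, sub_self, map_zero]
  have hinj : Function.Injective T := by
    rw [injective_iff_map_eq_zero]
    intro u hu
    have h2 : ∫ y in K, u (y - bar) * u (y - bar) ∂μ = 0 := by
      have h3 : u (T u) = ∫ y in K, u (y - bar) * u y ∂μ := by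
        rw [hT, ← ContinuousLinearMap.integral_comp_comm _ (hI _ (by fun_prop))]
        simp
      have h4 : ∀ y, u (y - bar) * u (y - bar) = u (y - bar) * u y - u (y - bar) * u bar := by
        intro y; rw [← mul_sub, ← map_sub]
      simp_rw [h4]
      rw [integral_sub (hIr (fun y => u (y - bar) * u y) (by fun_prop))
        (hIr (fun y => u (y - bar) * u bar) (by fun_prop)), ← h3, hu, map_zero,
        integral_mul_const, hz]
      ring
    have hc : Continuous fun y => u (y - bar) * u (y - bar) := by fun_prop
    rw [setIntegral_eq_zero_iff_of_nonneg_ae (Eventually.of_forall fun x => mul_self_nonneg _)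
      (hIr _ hc)] at h2
    have h4 := ae_restrict_of_ae_restrict_of_subset (interior_subset (s := K)) h2
    have h5 := Measure.eqOn_open_of_ae_eq h4 isOpen_interior hc.continuousOn continuousOn_const
    have h6 : ∀ y ∈ interior K, u (y - bar) = 0 := fun y hy => by
      have : u (y - bar) * u (y - bar) = 0 := h5 hy
      simpa using this
    obtain ⟨y0, hy0⟩ := hKi
    ext x
    have h8 : ∀ᶠ t : ℝ in 𝓝[>] 0, y0 + t • x ∈ interior K := by
      have : ContinuousAt (fun t : ℝ => y0 + t • x) 0 := by fun_prop
      exact (this.eventually (isOpen_interior.mem_nhds (by simpa using hy0))).filter_mono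
        nhdsWithin_le_nhds
    obtain ⟨t, ht, ht0⟩ := (h8.and self_mem_nhdsWithin).exists
    have ht0 : 0 < t := ht0
    have h9 := h6 _ ht
    have h10 := h6 _ hy0
    rw [map_sub] at h10
    rw [map_sub, map_add, map_smul, smul_eq_mul] at h9
    have h11 : t * u x = 0 := by linarith
    simpa using (mul_eq_zero.1 h11).resolve_left ht0.ne'
  have hfr : Module.finrank ℝ (E →L[ℝ] ℝ) = Module.finrank ℝ E := by
    rw [← (LinearMap.toContinuousLinearMap (𝕜 := ℝ) (E := E) (F' := ℝ)).finrank_eq]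
    exact Subspace.dual_finrank_eq
  have hsurj : Function.Surjective T :=
    (LinearMap.injective_iff_surjective_of_finrank_eq_finrank hfr).1 hinj
  have hopen : IsOpenMap T := T.isOpenMap_of_finiteDimensional hsurj
  obtain ⟨D, hD⟩ := hcp.exists_bound_of_continuousOn (f := fun y => y - bar) (by fun_prop)
  set ε := min 1 (V / δ - 1) with hε
  have hε0 : 0 < ε := by
    rw [hε, lt_min_iff]
    refine ⟨one_pos, ?_⟩
    rw [sub_pos, one_lt_div hδ]; exact h1
  set U : Set (E →L[ℝ] ℝ) := {u | ∀ y ∈ K, |u (y - bar)| ≤ ε} with hU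
  have hUn : U ∈ 𝓝 (0 : E →L[ℝ] ℝ) := by
    refine mem_of_superset (ball_mem_nhds 0 (show 0 < ε / (max D 0 + 1) by positivity)) ?_
    intro u hu y hy
    rw [mem_ball_zero_iff] at hu
    calc |u (y - bar)| ≤ ‖u‖ * ‖y - bar‖ := u.le_opNorm _
      _ ≤ (ε / (max D 0 + 1)) * (max D 0 + 1) := by
        gcongr
        exact (hD y hy).trans ((le_max_left _ _).trans (by linarith))
      _ = ε := by field_simp
  have hTU : T '' U ∈ 𝓝 (0 : E) := by
    have := hopen.image_mem_nhds hUn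
    rwa [map_zero] at this
  have hsub : ∀ z, V • (z - bar) ∈ T '' U → z ∈ MM μ K δ := by
    rintro z ⟨u, hu, huz⟩
    have hz' : z = bar + (1 / V) • T u := by
      rw [huz, smul_smul, one_div_mul_cancel hV0.ne', one_smul]; abel
    refine ⟨K.indicator fun y => (δ / V) * (1 + u (y - bar)), ⟨fun y => ?_, ?_, ?_⟩, ?_⟩
    · by_cases hy : y ∈ K
      · rw [indicator_of_mem hy]
        have h2 := abs_le.1 (hu y hy)
        have h3 : ε ≤ 1 := min_le_left _ _
        have h4 : ε ≤ V / δ - 1 := min_le_right _ _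
        refine ⟨mul_nonneg (by positivity) (by linarith), ?_⟩
        calc δ / V * (1 + u (y - bar)) ≤ δ / V * (V / δ) := by gcongr; linarith
          _ = 1 := by field_simp
      · rw [indicator_of_notMem hy]; simp
    · exact IntegrableOn.indicator (hIr _ (by fun_prop)) hcp.measurableSet
    · rw [setIntegral_indicator hcp.measurableSet, inter_self, integral_const_mul,
        integral_add (hIr (fun _ => 1) (by fun_prop)) (hIr (fun y => u (y - bar)) (by fun_prop)), hz,
        setIntegral_const, ← hV]
      simp
      field_simp
    · have h2 : ∫ y in K, (K.indicator fun y => (δ / V) * (1 + u (y - bar))) y • y ∂μ =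
          ∫ y in K, ((δ / V) • y + (δ / V) • (u (y - bar) • y)) ∂μ := by
        refine setIntegral_congr_fun hcp.measurableSet fun y hy => ?_
        beta_reduce
        rw [indicator_of_mem hy]; module
      rw [h2, integral_add (hI _ (by fun_prop)) (hI _ (by fun_prop)), integral_smul, integral_smul,
        ← hT, hz', hbar, smul_add, smul_smul, smul_smul]
      congr 2 <;> field_simp
  refine ⟨bar, mem_interior_iff_mem_nhds.2 ?_⟩
  have hc : ContinuousAt (fun z : E => V • (z - bar)) bar := by fun_prop
  have h0' : V • (bar - bar) = 0 := by rw [sub_self, smul_zero]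
  have := hc.preimage_mem_nhds (t := T '' U) (by beta_reduce; rw [h0']; exact hTU)
  filter_upwards [this] with z hz using hsub z hz

end MMsec
end Ulam

set_option linter.unusedSectionVars false
namespace Ulam
open Filter

section transp
variable {F E : Type*}
  [NormedAddCommGroup F] [NormedSpace ℝ F] [FiniteDimensional ℝ F]
  [MeasurableSpace F] [BorelSpace F] {ν : Measure F} [ν.IsAddHaarMeasure]
  [NormedAddCommGroup E] [NormedSpace ℝ E] [FiniteDimensional ℝ E]
  [MeasurableSpace E] [BorelSpace E] {μ : Measure E} [μ.IsAddHaarMeasure]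

/-- the functional whose level sets are the transported graphs -/
noncomputable def phip (L : (F × ℝ) ≃L[ℝ] E) (p : (F →L[ℝ] ℝ) × ℝ) : E →L[ℝ] ℝ :=
  (ContinuousLinearMap.snd ℝ F ℝ - p.1.comp (ContinuousLinearMap.fst ℝ F ℝ)).comp
    (L.symm : E →L[ℝ] F × ℝ)

lemma phip_apply (L : (F × ℝ) ≃L[ℝ] E) (p : (F →L[ℝ] ℝ) × ℝ) (z : F × ℝ) :
    phip L p (L z) = z.2 - p.1 z.1 := by
  simp [phip]

lemma phip_ne (L : (F × ℝ) ≃L[ℝ] E) (p : (F →L[ℝ] ℝ) × ℝ) : phip L p ≠ 0 := by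
  intro h
  have := phip_apply L p (0, 1)
  rw [h] at this
  simp at this

lemma cap_preimage (L : (F × ℝ) ≃L[ℝ] E) (p : (F →L[ℝ] ℝ) × ℝ) (K : Set E) (c0 : E) :
    (fun z => c0 + L z) ⁻¹' (K ∩ {x | p.2 + phip L p c0 < phip L p x}) =
      cap {z | c0 + L z ∈ K} p := by
  ext z
  show (c0 + L z ∈ K ∧ p.2 + phip L p c0 < phip L p (c0 + L z)) ↔
    (c0 + L z ∈ K ∧ ev z.1 p < z.2)
  rw [map_add, phip_apply, ev_apply]
  refine and_congr_right fun _ => ⟨fun h => by linarith, fun h => by linarith⟩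

lemma pre_compact (L : (F × ℝ) ≃L[ℝ] E) {K : Set E} (hK : IsCompact K) (c0 : E) :
    IsCompact {z | c0 + L z ∈ K} := by
  have : {z | c0 + L z ∈ K} = (L.toHomeomorph.trans (Homeomorph.addLeft c0)) ⁻¹' K := by
    ext z; rfl
  rw [this, Homeomorph.isCompact_preimage]
  exact hK

lemma mp_shift (L : (F × ℝ) ≃L[ℝ] E) (hm : MeasurePreserving L (ν.prod volume) μ) (c0 : E) :
    MeasurePreserving (fun z => c0 + L z) (ν.prod volume) μ :=
  (measurePreserving_add_left μ c0).comp hm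

lemma emb_shift (L : (F × ℝ) ≃L[ℝ] E) (c0 : E) :
    MeasurableEmbedding (fun z => c0 + L z) :=
  (L.toHomeomorph.trans (Homeomorph.addLeft c0)).measurableEmbedding

lemma cap_integrable {Z : Type*} [NormedAddCommGroup Z] {K : Set (F × ℝ)} (hcp : IsCompact K)
    (p) (f : F × ℝ → Z) (hf : Continuous f) : IntegrableOn f (cap K p) (ν.prod volume) :=
  (hf.continuousOn.integrableOn_compact hcp).mono_set inter_subset_left

lemma capV_transport (L : (F × ℝ) ≃L[ℝ] E) (hm : MeasurePreserving L (ν.prod volume) μ) {K : Set E}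
    (hK : IsCompact K) (c0 : E) (p) :
    capV μ K (phip L p) (p.2 + phip L p c0) = (capB ν {z | c0 + L z ∈ K} p).2 := by
  have h1 : (capB ν {z | c0 + L z ∈ K} p).2 =
      ∫ z in cap {z | c0 + L z ∈ K} p, (1 : ℝ) ∂(ν.prod volume) :=
    ((ContinuousLinearMap.snd ℝ (F × ℝ) ℝ).integral_comp_comm
      (cap_integrable (ν := ν) (pre_compact L hK c0) p (fun z => (z, (1 : ℝ))) (by fun_prop))).symm
  rw [h1, setIntegral_const, smul_eq_mul, mul_one, ← cap_preimage, capV, Measure.real, Measure.real,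
    (mp_shift L hm c0).measure_preimage_emb (emb_shift L c0)]

lemma capb_transport (L : (F × ℝ) ≃L[ℝ] E) (hm : MeasurePreserving L (ν.prod volume) μ) {K : Set E}
    (hK : IsCompact K) (c0 : E) (p) (δ : ℝ) :
    capb μ K (phip L p) (p.2 + phip L p c0) δ =
      (1 / δ) • ((capB ν {z | c0 + L z ∈ K} p).2 • c0 +
        L (capB ν {z | c0 + L z ∈ K} p).1) := by
  set B := capB ν {z | c0 + L z ∈ K} p with hB
  let T : ((F × ℝ) × ℝ) →L[ℝ] E := (ContinuousLinearMap.snd ℝ (F × ℝ) ℝ).smulRight c0 +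
    (L : (F × ℝ) →L[ℝ] E).comp (ContinuousLinearMap.fst ℝ (F × ℝ) ℝ)
  have hT : ∀ q, T q = q.2 • c0 + L q.1 := fun q => rfl
  rw [capb, ← hT, hB, capB, ← T.integral_comp_comm
      (cap_integrable (ν := ν) (pre_compact L hK c0) p (fun z => (z, (1 : ℝ))) (by fun_prop))]
  simp only [hT, one_smul]
  rw [← cap_preimage, (mp_shift L hm c0).setIntegral_preimage_emb (emb_shift L c0) (fun x => x)]

lemma gauge_pre (L : (F × ℝ) ≃L[ℝ] E) (K : Set E) (c0 : E) :
    gauge {z | c0 + L z ∈ K} = fun z => cg K c0 (L z) := by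
  funext z
  simp only [cg, gauge_def', mem_ofPred_eq, map_smul]

lemma local_L (L : (F × ℝ) ≃L[ℝ] E) (hm : MeasurePreserving L (ν.prod volume) μ) {K : Set E}
    (hK : Convex ℝ K) (hcp : IsCompact K) {c0 : E} (hc0 : c0 ∈ interior K) (k : ℕ)
    (hg : ∀ x, x ≠ 0 → ContDiffAt ℝ k (cg K c0) x) {δ : ℝ} (hδ : 0 < δ)
    (h : capV μ K (phip L 0) (phip L 0 c0) = δ) {w : E}
    (hw : phip L 0 w < phip L 0 (capb μ K (phip L 0) (phip L 0 c0) δ)) :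
    ∃ r : E → ℝ, ContDiffAt ℝ (k + 1) r (capb μ K (phip L 0) (phip L 0 c0) δ - w) ∧
      r (capb μ K (phip L 0) (phip L 0 c0) δ - w) = 1 ∧
      ∀ᶠ z in 𝓝 (capb μ K (phip L 0) (phip L 0 c0) δ - w), 0 < r z ∧
        ∃ ψ : E →L[ℝ] ℝ, ∃ t, ψ ≠ 0 ∧ capV μ K ψ t = δ ∧ capb μ K ψ t δ = w + (r z)⁻¹ • z := by
  have hv := capV_transport L hm hcp c0 0
  have hb := capb_transport L hm hcp c0 0 δ
  have h00 : (0 : (F →L[ℝ] ℝ) × ℝ).2 + phip L 0 c0 = phip L 0 c0 := by simp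
  rw [h00] at hv hb
  rw [h] at hv
  rw [← hv] at hb
  set b := capb μ K (phip L 0) (phip L 0 c0) δ with hbdef
  set K' := {z | c0 + L z ∈ K} with hK'
  set B := capB ν K' 0 with hB
  have hK'c : Convex ℝ K' := (shift_convex hK c0).linear_preimage (L : (F × ℝ) →ₗ[ℝ] E)
  have h0 : (0 : F × ℝ) ∈ interior K' := by
    have hc : Continuous fun z : F × ℝ => c0 + L z := by fun_prop
    refine mem_interior.2 ⟨(fun z : F × ℝ => c0 + L z) ⁻¹' interior K,
      fun z hz => interior_subset (s := K) hz, isOpen_interior.preimage hc, ?_⟩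
    show c0 + L 0 ∈ interior K
    simpa using hc0
  have hg' : ContDiffOn ℝ k (gauge K') {0}ᶜ := by
    rw [gauge_pre]
    intro z hz
    have hz' : L z ≠ 0 := by simpa using hz
    exact ((hg _ hz').comp z L.contDiff.contDiffAt).contDiffWithinAt
  have hBL : L B.1 = δ • (b - c0) := by
    rw [hb, smul_sub, smul_smul, mul_one_div_cancel hδ.ne', one_smul]; abel
  set c1 := L.symm (δ • (w - c0)) with hc1
  have hL1 : B.1 - c1 = L.symm (δ • (b - w)) := by
    apply L.injective
    rw [map_sub, hBL, hc1, L.apply_symm_apply, L.apply_symm_apply, ← smul_sub]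
    congr 1; abel
  have hsnd : ∀ x, phip L 0 x = (L.symm x).2 := by
    intro x
    have := phip_apply L 0 (L.symm x)
    simpa using this
  have hpos : c1.2 < B.1.2 := by
    have h3 : (B.1 - c1).2 = δ * (phip L 0 b - phip L 0 w) := by
      rw [hL1, ← hsnd, map_smul, map_sub, smul_eq_mul]
    have h4 : 0 < (B.1 - c1).2 := by
      rw [h3]; exact mul_pos hδ (by linarith)
    rw [Prod.snd_sub] at h4
    linarith
  obtain ⟨r, hr1, hr2, hr3⟩ := local_radial ν hK'c (pre_compact L hcp c0) h0 k hg' hv.symm hpos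
  rw [← hB, hL1] at hr1 hr2 hr3
  have hcont : ContDiff ℝ (k + 1) (fun x : E => L.symm (δ • x)) := by fun_prop
  refine ⟨fun x => r (L.symm (δ • x)), ?_, hr2, ?_⟩
  · exact ContDiffAt.comp (g := r) (b - w) hr1 hcont.contDiffAt
  · filter_upwards [(hcont.continuous.tendsto (b - w)).eventually hr3] with z hz
    obtain ⟨hz1, p, hp⟩ := hz
    refine ⟨hz1, phip L p, p.2 + phip L p c0, phip_ne L p, ?_, ?_⟩
    · rw [capV_transport L hm hcp, hp]
    · rw [capb_transport L hm hcp, hp]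
      simp only
      rw [map_add, map_smul, hc1, L.apply_symm_apply, L.apply_symm_apply]
      match_scalars <;> field_simp
      ring

end transp

section transp2
variable {E : Type*}
  [NormedAddCommGroup E] [NormedSpace ℝ E] [FiniteDimensional ℝ E]
  [MeasurableSpace E] [BorelSpace E] {μ : Measure E} [μ.IsAddHaarMeasure]

lemma exists_coord (φ : E →L[ℝ] ℝ) (hφ : φ ≠ 0) :
    ∃ (ν : Measure φ.toLinearMap.ker) (_ : ν.IsAddHaarMeasure)
      (L : (φ.toLinearMap.ker × ℝ) ≃L[ℝ] E),
      MeasurePreserving L (ν.prod volume) μ ∧ phip L 0 = φ := by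
  obtain ⟨e, he⟩ : ∃ e, φ e ≠ 0 := by
    by_contra! h; exact hφ (ContinuousLinearMap.ext h)
  let f₂ : ℝ →L[ℝ] E := ContinuousLinearMap.toSpanSingleton ℝ ((φ e)⁻¹ • e)
  have hf : Function.RightInverse f₂ φ := by
    intro t
    simp [f₂, he]
  let L : (φ.toLinearMap.ker × ℝ) ≃L[ℝ] E :=
    (ContinuousLinearEquiv.prodComm ℝ _ _).trans (ContinuousLinearEquiv.equivOfRightInverse φ f₂ hf).symm
  have hL : ∀ x, (L.symm x).2 = φ x := fun x =>
    ContinuousLinearEquiv.fst_equivOfRightInverse φ f₂ hf x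
  let ν0 : Measure φ.toLinearMap.ker := Measure.addHaar
  have hh : (Measure.map L (ν0.prod volume)).IsAddHaarMeasure := L.isAddHaarMeasure_map _
  set c := Measure.addHaarScalarFactor μ (Measure.map L (ν0.prod volume)) with hc
  have hcμ : μ = c • Measure.map L (ν0.prod volume) := Measure.isAddLeftInvariant_eq_smul _ _
  have hc0 : c ≠ 0 := (Measure.addHaarScalarFactor_pos_of_isAddHaarMeasure _ _).ne'
  refine ⟨c • ν0, ?_, L, ⟨L.continuous.measurable, ?_⟩, ?_⟩
  · exact Measure.IsAddHaarMeasure.nnreal_smul _ hc0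
  · rw [Measure.prod_smul_left, Measure.map_smul]; exact hcμ.symm
  · ext x
    rw [← hL]
    simp [phip]

lemma local_E {K : Set E}
    (hK : Convex ℝ K) (hcp : IsCompact K) {c0 : E} (hc0 : c0 ∈ interior K) (k : ℕ)
    (hg : ∀ x, x ≠ 0 → ContDiffAt ℝ k (cg K c0) x) {δ : ℝ} (hδ : 0 < δ)
    {φ : E →L[ℝ] ℝ} (hφ : φ ≠ 0) {s : ℝ} (hs : φ c0 = s)
    (h : capV μ K φ s = δ) {w : E}
    (hw : φ w < φ (capb μ K φ s δ)) :
    ∃ r : E → ℝ, ContDiffAt ℝ (k + 1) r (capb μ K φ s δ - w) ∧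
      r (capb μ K φ s δ - w) = 1 ∧
      ∀ᶠ z in 𝓝 (capb μ K φ s δ - w), 0 < r z ∧
        ∃ ψ : E →L[ℝ] ℝ, ∃ t, ψ ≠ 0 ∧ capV μ K ψ t = δ ∧ capb μ K ψ t δ = w + (r z)⁻¹ • z := by
  subst hs
  obtain ⟨ν, hν, L, hm, hL⟩ := exists_coord (μ := μ) φ hφ
  have := local_L L hm hK hcp hc0 k hg hδ (w := w)
  simp only [hL] at this
  exact this h hw

end transp2
end Ulam

set_option linter.unusedSectionVars false
namespace Ulam
open Filter

variable {n : ℕ}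

lemma ulam_eq_MM {K : Set (EuclideanSpace ℝ (Fin n))} (hcp : IsCompact K) {δ : ℝ} (hδ : 0 < δ) :
    ulam K δ = MM volume K δ := by
  have hc0 : ENNReal.ofReal (1 / δ) ≠ 0 := by
    rw [Ne, ENNReal.ofReal_eq_zero, not_le]; positivity
  have hct : ENNReal.ofReal (1 / δ) ≠ ⊤ := ENNReal.ofReal_ne_top
  have hr : (ENNReal.ofReal (1 / δ)).toReal = 1 / δ := ENNReal.toReal_ofReal (by positivity)
  ext z
  unfold ulam metronoid MM Adm
  rw [withDensity_const]
  simp only [integrable_smul_measure hc0 hct, integral_smul_measure, hr]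
  constructor
  · rintro ⟨f, h1, h2, h3, h4, h5⟩
    refine ⟨f, ⟨h1, h2, ?_⟩, h5⟩
    rw [smul_eq_mul] at h3
    field_simp at h3
    exact h3
  · rintro ⟨f, ⟨h1, h2, h3⟩, h5⟩
    refine ⟨f, h1, h2, ?_, integrable_smul_id volume hcp h2, h5⟩
    rw [h3, smul_eq_mul, one_div_mul_cancel hδ.ne']

lemma radialFn_eq {K : Set (EuclideanSpace ℝ (Fin n))} (hK : Convex ℝ K) (hcp : IsCompact K)
    {v θ : EuclideanSpace ℝ (Fin n)} (hv : v ∈ interior K) (hθ : θ ≠ 0) :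
    radialFn K v θ = (cg K v θ)⁻¹ := by
  have hp : 0 < cg K v θ := cg_pos hcp.isBounded hv hθ
  have : {r : ℝ | 0 ≤ r ∧ v + r • θ ∈ K} = Icc 0 (cg K v θ)⁻¹ := by
    ext r
    show (0 ≤ r ∧ v + r • θ ∈ K) ↔ (0 ≤ r ∧ r ≤ (cg K v θ)⁻¹)
    refine and_congr_right fun hr => ?_
    rcases hr.eq_or_lt with rfl | hr
    · simp only [zero_smul, add_zero, inv_nonneg, hp.le, iff_true]
      exact interior_subset hv
    · have := cg_le_iff (x := θ) hK hcp.isClosed hv (inv_pos.2 hr)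
      rw [inv_inv] at this
      rw [← this, le_inv_comm₀ hp hr]
  rw [radialFn, this, csSup_Icc (inv_nonneg.2 hp.le)]

lemma cg_smooth_aux0 {E : Type*} [NormedAddCommGroup E] [InnerProductSpace ℝ E]
    {rad : E → ℝ} {K : Set E} (hcp : IsCompact K)
    {v : E} (hv : v ∈ interior K) (k : ℕ)
    (hrad : ∀ θ, θ ≠ 0 → rad θ = (cg K v θ)⁻¹)
    (hs : ContDiffOn ℝ k rad (sphere 0 1)) :
    ContDiffOn ℝ k (cg K v) {0}ᶜ := by
  have hn : ContDiffOn ℝ k (fun x : E => ‖x‖) {0}ᶜ :=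
    fun x hx => (contDiffAt_norm ℝ hx).contDiffWithinAt
  have hne : ∀ x ∈ ({0}ᶜ : Set E), ‖x‖ ≠ 0 := fun x hx =>
    norm_ne_zero_iff.2 hx
  have hnn : ContDiffOn ℝ k (fun x : E => ‖x‖⁻¹ • x) {0}ᶜ :=
    (hn.inv hne).smul contDiffOn_id
  have hmap : MapsTo (fun x : E => ‖x‖⁻¹ • x) {0}ᶜ (sphere 0 1) := by
    intro x hx
    simp [norm_smul, hne x hx]
  have hne0 : ∀ x ∈ ({0}ᶜ : Set E), ‖x‖⁻¹ • x ≠ 0 := fun x hx =>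
    smul_ne_zero (inv_ne_zero (hne x hx)) hx
  have hcomp := hs.comp hnn hmap
  have hq : ContDiffOn ℝ k (fun x => ‖x‖ * (rad (‖x‖⁻¹ • x))⁻¹) {0}ᶜ := by
    refine hn.mul (hcomp.inv fun x hx => ?_)
    show rad (‖x‖⁻¹ • x) ≠ 0
    rw [hrad _ (hne0 x hx)]
    exact inv_ne_zero (cg_pos hcp.isBounded hv (hne0 x hx)).ne'
  refine hq.congr fun x hx => ?_
  rw [hrad _ (hne0 x hx), inv_inv]
  unfold cg
  rw [gauge_smul_of_nonneg (by positivity), smul_eq_mul, mul_inv_cancel_left₀ (hne x hx)]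

lemma cg_shift_eq {E : Type*} [NormedAddCommGroup E] [NormedSpace ℝ E] (K : Set E) (v c y : E) :
    cg K c y = cg {y | v + y ∈ K} (c - v) y := by
  have hset : {y | c - v + y ∈ {y | v + y ∈ K}} = {y | c + y ∈ K} := by
    ext y
    show v + (c - v + y) ∈ K ↔ c + y ∈ K
    rw [← add_assoc, add_sub_cancel]
  unfold cg
  rw [hset]

lemma cg_fst_contDiffAt {E : Type*} [NormedAddCommGroup E] [NormedSpace ℝ E] (S : Set E) (k : ℕ)
    {d x : E} (h : ContDiffAt ℝ k (fun q : E × E => cg S q.1 q.2) (d, x)) :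
    ContDiffAt ℝ k (cg S d) x :=
  ContDiffAt.comp (g := fun q : E × E => cg S q.1 q.2) (f := fun y => (d, y)) x h
    (contDiffAt_const.prodMk contDiffAt_id)

lemma cg_move {E : Type*} [NormedAddCommGroup E] [NormedSpace ℝ E] [CompleteSpace E]
    {K : Set E} (hK : Convex ℝ K) (hcp : IsCompact K)
    {v c : E} (hv : v ∈ interior K) (hc : c ∈ interior K) (k : ℕ)
    (h1 : ContDiffOn ℝ k (cg K v) {0}ᶜ) {x : E} (hx : x ≠ 0) :
    ContDiffAt ℝ k (cg K c) x := by
  have h1' : ContDiffOn ℝ k (gauge {y | v + y ∈ K}) {0}ᶜ := h1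
  have hi : (0 : E) ∈ interior {y | v + y ∈ K} := mem_interior_iff_mem_nhds.2 (shift_nhds hv)
  have hci : c - v ∈ interior {y | v + y ∈ K} := by
    rw [shift_interior]
    show v + (c - v) ∈ interior K
    rw [add_sub_cancel]; exact hc
  have h4 : cg K c = cg {y | v + y ∈ K} (c - v) := funext fun y => cg_shift_eq K v c y
  rw [h4]
  exact cg_fst_contDiffAt _ k (cg_contDiffAt (shift_convex hK v) (shift_closed hcp.isClosed v)
    (shift_bounded hcp.isBounded v) hi hci hx k h1')

lemma cg_smooth {K : Set (EuclideanSpace ℝ (Fin n))} (hK : Convex ℝ K) (hcp : IsCompact K)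
    {v c : EuclideanSpace ℝ (Fin n)} (hv : v ∈ interior K) (hc : c ∈ interior K) (k : ℕ)
    (hs : ContDiffOn ℝ k (radialFn K v) (sphere 0 1)) {x : EuclideanSpace ℝ (Fin n)} (hx : x ≠ 0) :
    ContDiffAt ℝ k (cg K c) x :=
  cg_move hK hcp hv hc k (cg_smooth_aux0 hcp hv k (fun _ hθ => radialFn_eq hK hcp hv hθ) hs) hx

lemma line_ev {E : Type*} [NormedAddCommGroup E] [NormedSpace ℝ E] {M : Set E} {z : E}
    (hz : z ∈ interior M) (e : E) : ∀ᶠ t : ℝ in 𝓝[>] 0, z + t • e ∈ M := by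
  have h : ContinuousAt (fun t : ℝ => z + t • e) 0 := by fun_prop
  have h2 : ∀ᶠ t : ℝ in 𝓝 0, z + t • e ∈ M := h.preimage_mem_nhds (t := M) (by
    simpa using mem_interior_iff_mem_nhds.1 hz)
  exact h2.filter_mono nhdsWithin_le_nhds

theorem main {K : Set (EuclideanSpace ℝ (Fin n))}
    (hcp : IsCompact K) (hK : Convex ℝ K) (hKi : (interior K).Nonempty) (k : ℕ)
    {v : EuclideanSpace ℝ (Fin n)} (hv : v ∈ interior K)
    (hs : ContDiffOn ℝ k (radialFn K v) (sphere 0 1))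
    {δ : ℝ} (hδ : 0 < δ) (hδ1 : δ < (volume : Measure (EuclideanSpace ℝ (Fin n))).real K)
    {w : EuclideanSpace ℝ (Fin n)} (hw : w ∈ interior (MM volume K δ)) :
    ContDiffOn ℝ (k + 1) (radialFn (MM volume K δ) w) (sphere 0 1) := by
  set M := MM volume K δ with hM
  have hMc : Convex ℝ M := MM_convex volume hcp δ
  have hMb : Bornology.IsBounded M := MM_bounded volume hcp hδ
  have hbdd : ∀ θ : EuclideanSpace ℝ (Fin n), θ ≠ 0 → BddAbove {r : ℝ | 0 ≤ r ∧ w + r • θ ∈ M} := by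
    intro θ hθ
    obtain ⟨R, hR⟩ := hMb.subset_closedBall w
    refine ⟨R / ‖θ‖, ?_⟩
    rintro r ⟨hr, hrM⟩
    have := hR hrM
    rw [mem_closedBall, dist_eq_norm, add_sub_cancel_left, norm_smul, Real.norm_of_nonneg hr] at this
    rwa [le_div_iff₀ (norm_pos_iff.2 hθ)]
  intro θ0 hθ0
  have hθ0n : θ0 ≠ 0 := by
    rintro rfl; simp at hθ0
  set ρ0 := radialFn M w θ0 with hρ0
  -- positivity
  have hlines : ∀ z ∈ interior M, ∀ᶠ t : ℝ in 𝓝[>] 0, z + t • θ0 ∈ M := fun z hz => line_ev hz θ0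
  have hρpos : 0 < ρ0 := by
    obtain ⟨t, ht, ht0⟩ := ((hlines w hw).and self_mem_nhdsWithin).exists
    have ht0 : 0 < t := ht0
    exact ht0.trans_le (le_csSup (hbdd θ0 hθ0n) ⟨ht0.le, ht⟩)
  set z0 := w + ρ0 • θ0 with hz0
  have hz0cl : z0 ∈ closure M := by
    have h1 : ρ0 ∈ closure {r : ℝ | 0 ≤ r ∧ w + r • θ0 ∈ M} :=
      csSup_mem_closure ⟨0, le_rfl, by simpa using interior_subset hw⟩ (hbdd θ0 hθ0n)
    have hc : Continuous fun r : ℝ => w + r • θ0 := by fun_prop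
    exact map_mem_closure (f := fun r : ℝ => w + r • θ0) hc h1 fun r hr => hr.2
  have hz0i : z0 ∉ interior M := by
    intro hi
    obtain ⟨t, ht, ht0⟩ := ((hlines z0 hi).and self_mem_nhdsWithin).exists
    have ht0 : 0 < t := ht0
    have : ρ0 + t ≤ ρ0 := le_csSup (hbdd θ0 hθ0n)
      ⟨by positivity, by rw [add_smul, ← add_assoc]; exact ht⟩
    linarith
  obtain ⟨φ, hφ⟩ := geometric_hahn_banach_open_point hMc.interior isOpen_interior hz0i
  have hφw := hφ w hw
  have hφ0 : φ ≠ 0 := by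
    rintro rfl; simp at hφw
  have hφM : ∀ z ∈ M, φ z ≤ φ z0 := by
    intro z hz
    have h1 : z ∈ closure (interior M) := by
      rw [hMc.closure_interior_eq_closure_of_nonempty_interior ⟨w, hw⟩]; exact subset_closure hz
    exact closure_minimal (fun y hy => (hφ y hy).le)
      (isClosed_le φ.continuous continuous_const : IsClosed {y | φ y ≤ φ z0}) h1
  obtain ⟨s, hsδ⟩ := exists_cap volume hcp hφ0 hδ hδ1
  have hzb : z0 = capb volume K φ s δ :=
    MM_unique volume hcp hφ0 hδ hsδ hz0cl (hφM _ (capb_mem volume hcp hsδ))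
  obtain ⟨c0, hc0, hc0s⟩ := exists_interior_level volume hK hcp hKi hφ0 hδ hδ1 hsδ
  obtain ⟨r, hr1, hr2, hr3⟩ := local_E (μ := volume) hK hcp hc0 k
    (fun x hx => cg_smooth hK hcp hv hc0 k hs hx) hδ hφ0 hc0s hsδ (w := w) (by rw [← hzb]; exact hφw)
  have hbw : capb volume K φ s δ - w = ρ0 • θ0 := by rw [← hzb, hz0, add_sub_cancel_left]
  rw [hbw] at hr1 hr2 hr3
  have hsm : ContDiff ℝ (k + 1) (fun θ : EuclideanSpace ℝ (Fin n) => ρ0 • θ) := by fun_prop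
  have hfin : ContDiffAt ℝ (k + 1) (fun θ : EuclideanSpace ℝ (Fin n) => (r (ρ0 • θ))⁻¹ * ρ0) θ0 := by
    have h1 : ContDiffAt ℝ (k + 1) (fun θ : EuclideanSpace ℝ (Fin n) => r (ρ0 • θ)) θ0 :=
      ContDiffAt.comp (g := r) θ0 hr1 hsm.contDiffAt
    exact (h1.inv (by rw [hr2]; exact one_ne_zero)).mul contDiffAt_const
  have hev : ∀ᶠ θ in 𝓝 θ0, radialFn M w θ = (r (ρ0 • θ))⁻¹ * ρ0 := by
    have hne : ∀ᶠ θ in 𝓝 θ0, θ ≠ 0 := isOpen_ne.mem_nhds hθ0n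
    filter_upwards [(hsm.continuous.tendsto θ0).eventually hr3] with θ hθ
    obtain ⟨hrp, ψ, t, hψ0, hψ, hb⟩ := hθ
    have hbM : capb volume K ψ t δ ∈ M := capb_mem volume hcp hψ
    rw [smul_smul] at hb
    -- strict inequality at the interior point
    have hlt : ψ w < ψ (capb volume K ψ t δ) := by
      obtain ⟨e, he⟩ : ∃ e, 0 < ψ e := by
        by_contra! h
        refine hψ0 (ContinuousLinearMap.ext fun x => le_antisymm (h x) ?_)
        have := h (-x)
        rw [map_neg] at this
        simpa using this
      have hh := line_ev hw e
      obtain ⟨a, ha, ha0⟩ := (hh.and self_mem_nhdsWithin).exists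
      have ha0 : 0 < a := ha0
      have h2 := MM_le volume hcp hδ hψ ha
      rw [map_add, map_smul, smul_eq_mul] at h2
      have := mul_pos ha0 he
      linarith
    have hlam : 0 < (r (ρ0 • θ))⁻¹ * ρ0 := by positivity
    rw [hb, map_add, map_smul, smul_eq_mul] at hlt
    have hψθ : 0 < ψ θ := by
      by_contra! h
      have := mul_nonpos_of_nonneg_of_nonpos hlam.le h
      linarith
    refine IsGreatest.csSup_eq ⟨⟨hlam.le, by rw [← hb]; exact hbM⟩, ?_⟩
    rintro q ⟨hq, hqM⟩
    have h2 := MM_le volume hcp hδ hψ hqM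
    rw [hb, map_add, map_smul, map_add, map_smul, smul_eq_mul, smul_eq_mul] at h2
    exact le_of_mul_le_mul_right (by linarith) hψθ
  exact (hfin.congr_of_eventuallyEq hev).contDiffWithinAt

end Ulam

/-- If `∂K` is `C^k`, then `∂M_δ(K)` is `C^{k+1}`. -/
theorem stmt12 (n : ℕ) (K : Set (EuclideanSpace ℝ (Fin n)))
    (hK : IsCompact K) (hKc : Convex ℝ K) (hKi : (interior K).Nonempty)
    (k : ℕ)
    (hsmooth : ∃ v ∈ interior K, ContDiffOn ℝ k (radialFn K v) (Metric.sphere 0 1))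
    (δ : ℝ) (hδ0 : 0 < δ) (hδ1 : δ < (volume K).toReal) :
    ∃ w ∈ interior (ulam K δ),
      ContDiffOn ℝ (k + 1) (radialFn (ulam K δ) w) (Metric.sphere 0 1) := by
  obtain ⟨v, hv, hs⟩ := hsmooth
  rw [Ulam.ulam_eq_MM hK hδ0]
  obtain ⟨w, hw⟩ := Ulam.MM_interior volume hK hKi hδ0 hδ1
  exact ⟨w, hw, Ulam.main hK hKc hKi k hv hs hδ0 hδ1 hw⟩
end
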